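/- arXiv:1502.05971 — 2 statements merged into one kernel-verified Lean document; each statement's English description precedes it below -/
import Mathlib

section
/- For ν > 0 and z > 0, ∂Y_ν(z)/∂ν = νπ J_ν(z) ∫_z^∞ Y_ν(t)²/t dt − νπ Y_ν(z) ∫_z^∞ J_ν(t) Y_ν(t)/t dt − (π/2) J_ν(z). -/
open MeasureTheory Real Filter Set Topology

noncomputable def besselJ (ν x : ℝ) : ℝ :=
  (x / 2) ^ ν * ∑' k : ℕ, (-1 : ℝ) ^ k * (x ^ 2 / 4) ^ k / (k.factorial * Real.Gamma (ν + k + 1))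

noncomputable def besselY (ν x : ℝ) : ℝ :=
  limUnder (𝓝[{μ : ℝ | ∀ n : ℤ, μ ≠ (n : ℝ)}] ν)
    (fun μ => (besselJ μ x * Real.cos (μ * Real.pi) - besselJ (-μ) x) / Real.sin (μ * Real.pi))

/-- The coefficients of the entire function `w ↦ ∑ (-w) ^ k / (k! Γ(ν + k + 1))`. -/
noncomputable def besselCoeff (ν : ℝ) (k : ℕ) : ℝ :=
  (-1) ^ k / (k.factorial * Real.Gamma (ν + k + 1))

/-- The entire function with `besselJ ν x = (x / 2) ^ ν * besselSeries ν (x ^ 2 / 4)`. -/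
noncomputable def besselSeries (ν w : ℝ) : ℝ := ∑' k : ℕ, besselCoeff ν k * w ^ k

lemma besselJ_eq (ν x : ℝ) : besselJ ν x = (x / 2) ^ ν * besselSeries ν (x ^ 2 / 4) := by
  unfold besselJ besselSeries besselCoeff
  congr 1
  refine tsum_congr fun k => ?_
  ring

lemma one_div_Gamma_eq (s : ℝ) : (Real.Gamma s)⁻¹ = s * (Real.Gamma (s + 1))⁻¹ := by
  have h := Complex.one_div_Gamma_eq_self_mul_one_div_Gamma_add_one (s : ℂ)
  have e : (s : ℂ) + 1 = ((s + 1 : ℝ) : ℂ) := by push_cast; rfl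
  rw [e, Complex.Gamma_ofReal, Complex.Gamma_ofReal] at h
  exact_mod_cast h

lemma succ_mul_besselCoeff_succ (ν : ℝ) (k : ℕ) :
    ((k : ℝ) + 1) * besselCoeff ν (k + 1) = -besselCoeff (ν + 1) k := by
  unfold besselCoeff
  have hk : (k.factorial : ℝ) ≠ 0 := by positivity
  have h1 : (k : ℝ) + 1 ≠ 0 := by positivity
  rw [Nat.factorial_succ]
  push_cast
  rw [show ν + 1 + (k : ℝ) + 1 = ν + (k + 1) + 1 by ring, pow_succ, div_eq_mul_inv, div_eq_mul_inv,
    mul_inv, mul_inv, mul_inv]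
  field_simp

lemma besselCoeff_sub_one (ν : ℝ) (k : ℕ) :
    besselCoeff (ν - 1) k = (ν + k) * besselCoeff ν k := by
  unfold besselCoeff
  rw [show ν - 1 + (k : ℝ) + 1 = ν + k by ring, div_eq_mul_inv, div_eq_mul_inv,
    mul_inv, mul_inv, one_div_Gamma_eq (ν + k)]
  ring

lemma summable_besselCoeff (ν w : ℝ) : Summable fun k : ℕ => ‖besselCoeff ν k * w ^ k‖ := by
  have key : ∀ k : ℕ, ((k : ℝ) + 1) * (ν + 1 + k) * besselCoeff ν (k + 1) = -besselCoeff ν k := by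
    intro k
    have h := besselCoeff_sub_one (ν + 1) k
    have h' := succ_mul_besselCoeff_succ ν k
    rw [add_sub_cancel_right] at h
    linear_combination (ν + 1 + k) * h' + h
  refine summable_of_ratio_norm_eventually_le (r := 1 / 2) (by norm_num) ?_
  filter_upwards [eventually_ge_atTop (⌈|ν| + 2 * |w|⌉₊)] with k hk
  have hk' : |ν| + 2 * |w| ≤ k := Nat.ceil_le.mp hk
  have h1 : 2 * |w| ≤ ν + 1 + k := by linarith [neg_abs_le ν]
  have h2 : 2 * |w| ≤ ((k : ℝ) + 1) * (ν + 1 + k) := by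
    have := abs_nonneg w
    have hk0 : (0 : ℝ) ≤ k := k.cast_nonneg
    nlinarith
  have h3 : ‖besselCoeff ν k‖ = ((k : ℝ) + 1) * (ν + 1 + k) * ‖besselCoeff ν (k + 1)‖ := by
    rw [← norm_neg, ← key, norm_mul, Real.norm_of_nonneg (le_trans (by positivity) h2)]
  rw [norm_norm, norm_norm, norm_mul, norm_mul, h3, norm_pow, norm_pow, pow_succ,
    Real.norm_eq_abs w]
  have : 0 ≤ ‖besselCoeff ν (k + 1)‖ * |w| ^ k := by positivity
  nlinarith

lemma hasDerivAt_besselSeries (ν w : ℝ) :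
    HasDerivAt (besselSeries ν) (-besselSeries (ν + 1) w) w := by
  have hs : ∀ μ y : ℝ, Summable fun k : ℕ => besselCoeff μ k * y ^ k := fun μ y =>
    (summable_besselCoeff μ y).of_norm
  have hshift : ∀ y : ℝ, besselSeries ν y
      = besselCoeff ν 0 + ∑' k : ℕ, besselCoeff ν (k + 1) * y ^ (k + 1) := by
    intro y
    unfold besselSeries
    rw [(hs ν y).tsum_eq_zero_add]
    simp
  have hd : HasDerivAt (fun y => ∑' k : ℕ, besselCoeff ν (k + 1) * y ^ (k + 1))
      (∑' k : ℕ, -(besselCoeff (ν + 1) k * w ^ k)) w := by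
    refine hasDerivAt_tsum_of_isPreconnected (t := Metric.ball 0 (|w| + 1)) (y₀ := 0)
      (g' := fun k y => -(besselCoeff (ν + 1) k * y ^ k))
      (summable_besselCoeff (ν + 1) (|w| + 1)) Metric.isOpen_ball
      (convex_ball _ _).isPreconnected ?_ ?_ ?_ ?_ ?_
    · intro k y _
      have := (hasDerivAt_pow (k + 1) y).const_mul (besselCoeff ν (k + 1))
      refine this.congr_deriv ?_
      rw [← neg_mul, ← succ_mul_besselCoeff_succ]
      push_cast
      ring
    · intro k y hy
      rw [Metric.mem_ball, dist_zero_right] at hy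
      rw [norm_neg, norm_mul, norm_mul, norm_pow, norm_pow]
      gcongr
      rw [Real.norm_of_nonneg (by positivity : 0 ≤ |w| + 1)]
      exact hy.le
    · simp [Metric.mem_ball]; positivity
    · simp
    · simp [Metric.mem_ball]
  rw [tsum_neg] at hd
  rw [show besselSeries ν = fun y => besselCoeff ν 0 + _ from funext hshift]
  exact hd.const_add _

lemma besselSeries_sub_one (ν w : ℝ) :
    besselSeries (ν - 1) w = ν * besselSeries ν w - w * besselSeries (ν + 1) w := by
  have hs : ∀ μ y : ℝ, Summable fun k : ℕ => besselCoeff μ k * y ^ k := fun μ y =>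
    (summable_besselCoeff μ y).of_norm
  have h1 : ∀ k : ℕ, besselCoeff (ν - 1) k * w ^ k - ν * (besselCoeff ν k * w ^ k)
      = k * besselCoeff ν k * w ^ k := fun k => by rw [besselCoeff_sub_one]; ring
  have hsum := (hs (ν - 1) w).sub ((hs ν w).mul_left ν)
  have h2 := (hs (ν - 1) w).tsum_sub ((hs ν w).mul_left ν)
  rw [hsum.tsum_eq_zero_add] at h2
  simp only [h1] at h2
  have h3 : ∀ k : ℕ, ((k + 1 : ℕ) : ℝ) * besselCoeff ν (k + 1) * w ^ (k + 1)
      = -w * (besselCoeff (ν + 1) k * w ^ k) := fun k => by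
    push_cast
    rw [succ_mul_besselCoeff_succ]; ring
  simp only [h3, tsum_mul_left] at h2
  unfold besselSeries
  push_cast at h2
  linarith

lemma hasDerivAt_besselJ (ν : ℝ) {x : ℝ} (hx : 0 < x) :
    HasDerivAt (besselJ ν) (ν / x * besselJ ν x - besselJ (ν + 1) x) x := by
  have h1 : HasDerivAt (fun y : ℝ => (y / 2) ^ ν) (1 / 2 * ν * (x / 2) ^ (ν - 1)) x :=
    ((hasDerivAt_id x).div_const 2).rpow_const (Or.inl (by simp; positivity))
  have h2 : HasDerivAt (fun y : ℝ => besselSeries ν (y ^ 2 / 4))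
      (-besselSeries (ν + 1) (x ^ 2 / 4) * (x / 2)) x := by
    have := ((hasDerivAt_pow 2 x).div_const 4)
    have h3 := (hasDerivAt_besselSeries ν (x ^ 2 / 4)).comp x this
    refine h3.congr_deriv ?_
    push_cast; ring
  rw [show besselJ ν = fun y => (y / 2) ^ ν * besselSeries ν (y ^ 2 / 4) from
    funext (besselJ_eq ν)]
  refine (h1.mul h2).congr_deriv ?_
  rw [besselJ_eq, Real.rpow_sub_one (by positivity), Real.rpow_add_one (by positivity)]
  field_simp
  ring

lemma besselJ_sub_one (ν : ℝ) {x : ℝ} (hx : 0 < x) :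
    besselJ (ν - 1) x = 2 * ν / x * besselJ ν x - besselJ (ν + 1) x := by
  rw [besselJ_eq, besselJ_eq, besselJ_eq, besselSeries_sub_one,
    Real.rpow_sub_one (by positivity), Real.rpow_add_one (by positivity)]
  field_simp
  ring

lemma hasDerivAt_besselJ_add_one (ν : ℝ) {x : ℝ} (hx : 0 < x) :
    HasDerivAt (besselJ (ν + 1)) (besselJ ν x - (ν + 1) / x * besselJ (ν + 1) x) x := by
  refine (hasDerivAt_besselJ (ν + 1) hx).congr_deriv ?_
  have := besselJ_sub_one (ν + 1) hx
  rw [add_sub_cancel_right] at this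
  rw [this]
  ring

/-- `v` is a complex amplitude for Bessel's equation of order `ν`: the function
`u t = (exp (i t) * v t).im` satisfies `u'' + (1 - (ν ^ 2 - 1 / 4) / t ^ 2) u = 0` on `(0, ∞)`, with
`u' t = (exp (i t) * v t).re`. -/
def IsBesselAmplitude (ν : ℝ) (v : ℝ → ℂ) : Prop :=
  ∀ t : ℝ, 0 < t → HasDerivAt v
    (Complex.exp (-(t * Complex.I)) *
      (((ν ^ 2 - 1 / 4) / t ^ 2 * (Complex.exp (t * Complex.I) * v t).im : ℝ) : ℂ)) t

lemma norm_exp_mul_I_mul (t : ℝ) (w : ℂ) : ‖Complex.exp (t * Complex.I) * w‖ = ‖w‖ := by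
  rw [norm_mul, Complex.norm_exp_ofReal_mul_I, one_mul]

lemma abs_im_exp_mul_I_mul_le (t : ℝ) (w : ℂ) :
    |(Complex.exp (t * Complex.I) * w).im| ≤ ‖w‖ :=
  (Complex.abs_im_le_norm _).trans (norm_exp_mul_I_mul t w).le

lemma conj_exp_mul_I (t : ℝ) :
    (starRingEnd ℂ) (Complex.exp (t * Complex.I)) = Complex.exp (-(t * Complex.I)) := by
  rw [← Complex.exp_conj]; simp

namespace IsBesselAmplitude

variable {μ ν : ℝ} {v w : ℝ → ℂ} {V W : ℂ}

lemma continuousOn (hv : IsBesselAmplitude ν v) : ContinuousOn v (Ioi 0) :=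
  fun t ht => (hv t ht).continuousAt.continuousWithinAt

lemma continuousOn_im (hv : IsBesselAmplitude ν v) :
    ContinuousOn (fun t : ℝ => (Complex.exp (t * Complex.I) * v t).im) (Ioi 0) :=
  Complex.continuous_im.comp_continuousOn (ContinuousOn.mul (by fun_prop) hv.continuousOn)

lemma hasDerivAt_pairing (hv : IsBesselAmplitude μ v) (hw : IsBesselAmplitude ν w) {t : ℝ}
    (ht : 0 < t) :
    HasDerivAt (fun s => (w s * (starRingEnd ℂ) (v s)).im)
      ((μ ^ 2 - ν ^ 2) * ((Complex.exp (t * Complex.I) * v t).im *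
        (Complex.exp (t * Complex.I) * w t).im / t ^ 2)) t := by
  have h := (hw t ht).mul (hv t ht).star
  have h2 := (Complex.imCLM.hasFDerivAt.comp_hasDerivAt t h)
  refine h2.congr_deriv ?_
  rw [← conj_exp_mul_I]
  simp only [Complex.imCLM_apply, Complex.star_def, map_mul, Complex.conj_conj,
    Complex.conj_ofReal, Complex.add_im, Complex.mul_im, Complex.mul_re, Complex.conj_re,
    Complex.conj_im, Complex.ofReal_re, Complex.ofReal_im]
  ring

lemma hasDerivAt_norm_sq (hv : IsBesselAmplitude ν v) {t : ℝ} (ht : 0 < t) :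
    HasDerivAt (fun s => ‖v s‖ ^ 2)
      (2 * ((ν ^ 2 - 1 / 4) / t ^ 2 * (Complex.exp (t * Complex.I) * v t).im *
        (Complex.exp (t * Complex.I) * v t).re)) t := by
  refine (hv t ht).norm_sq.congr_deriv ?_
  rw [← conj_exp_mul_I]
  simp only [Complex.inner, Complex.mul_im, Complex.mul_re, Complex.conj_re,
    Complex.conj_im, Complex.ofReal_re, Complex.ofReal_im]
  ring

lemma abs_deriv_norm_sq_le (κ t : ℝ) (z : ℂ) :
    |2 * (κ / t ^ 2 * (Complex.exp (t * Complex.I) * z).im *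
        (Complex.exp (t * Complex.I) * z).re)| ≤ |κ| / t ^ 2 * ‖z‖ ^ 2 := by
  rw [← norm_exp_mul_I_mul t z, Complex.sq_norm, Complex.normSq_apply]
  set a := (Complex.exp (t * Complex.I) * z).im
  set b := (Complex.exp (t * Complex.I) * z).re
  rw [show 2 * (κ / t ^ 2 * a * b) = κ / t ^ 2 * (2 * a * b) by ring, abs_mul, abs_div,
    abs_of_nonneg (sq_nonneg t)]
  gcongr
  rw [abs_le]
  constructor <;> nlinarith [sq_nonneg (a + b), sq_nonneg (a - b)]

lemma hasDerivAt_exp_div (κ : ℝ) {t : ℝ} (ht : 0 < t) :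
    HasDerivAt (fun s : ℝ => Real.exp (κ / s)) (-(κ / t ^ 2) * Real.exp (κ / t)) t := by
  have h := ((hasDerivAt_inv ht.ne').const_mul κ).exp
  simp only [← div_eq_mul_inv] at h
  refine h.congr_deriv ?_
  field_simp

lemma antitoneOn_norm_sq_mul_exp (hv : IsBesselAmplitude ν v) :
    AntitoneOn (fun t => ‖v t‖ ^ 2 * Real.exp (|ν ^ 2 - 1 / 4| / t)) (Ioi 0) := by
  have hd : ∀ t : ℝ, 0 < t → _ := fun t ht =>
    (hv.hasDerivAt_norm_sq ht).mul (hasDerivAt_exp_div |ν ^ 2 - 1 / 4| ht)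
  refine antitoneOn_of_deriv_nonpos (convex_Ioi 0)
    (fun t ht => (hd t ht).continuousAt.continuousWithinAt)
    (fun t ht => ?_) (fun t ht => ?_)
  · rw [interior_Ioi] at ht
    exact (hd t ht).differentiableAt.differentiableWithinAt
  · rw [interior_Ioi] at ht
    refine (hd t ht).deriv.trans_le ?_
    have h := (abs_le.mp (abs_deriv_norm_sq_le (ν ^ 2 - 1 / 4) t (v t))).2
    have := mul_le_mul_of_nonneg_right h (Real.exp_nonneg (|ν ^ 2 - 1 / 4| / t))
    linarith

lemma monotoneOn_norm_sq_mul_exp (hv : IsBesselAmplitude ν v) :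
    MonotoneOn (fun t => ‖v t‖ ^ 2 * Real.exp (-|ν ^ 2 - 1 / 4| / t)) (Ioi 0) := by
  have hd : ∀ t : ℝ, 0 < t → _ := fun t ht =>
    (hv.hasDerivAt_norm_sq ht).mul (hasDerivAt_exp_div (-|ν ^ 2 - 1 / 4|) ht)
  refine monotoneOn_of_deriv_nonneg (convex_Ioi 0)
    (fun t ht => (hd t ht).continuousAt.continuousWithinAt)
    (fun t ht => ?_) (fun t ht => ?_)
  · rw [interior_Ioi] at ht
    exact (hd t ht).differentiableAt.differentiableWithinAt
  · rw [interior_Ioi] at ht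
    refine le_of_le_of_eq ?_ (hd t ht).deriv.symm
    have h := (abs_le.mp (abs_deriv_norm_sq_le (ν ^ 2 - 1 / 4) t (v t))).1
    have := mul_le_mul_of_nonneg_right h (Real.exp_nonneg (-|ν ^ 2 - 1 / 4| / t))
    simp only [neg_div] at this ⊢
    linarith

lemma exists_norm_le (hv : IsBesselAmplitude ν v) {z : ℝ} (hz : 0 < z) :
    ∃ C, ∀ t, z ≤ t → ‖v t‖ ≤ C := by
  refine ⟨Real.sqrt (‖v z‖ ^ 2 * Real.exp (|ν ^ 2 - 1 / 4| / z)), fun t ht => ?_⟩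
  have ht0 : 0 < t := hz.trans_le ht
  refine Real.le_sqrt_of_sq_le (le_trans ?_ (hv.antitoneOn_norm_sq_mul_exp hz ht0 ht))
  exact le_mul_of_one_le_right (sq_nonneg _) (Real.one_le_exp (by positivity))

lemma integrableOn_inv_sq {z : ℝ} (hz : 0 < z) :
    IntegrableOn (fun t : ℝ => 1 / t ^ 2) (Ioi z) := by
  refine (integrableOn_Ioi_rpow_of_lt (a := -2) (by norm_num) hz).congr_fun (fun t ht => ?_)
    measurableSet_Ioi
  simp only
  rw [Real.rpow_neg (hz.trans ht).le]
  norm_num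

lemma exists_tendsto (hv : IsBesselAmplitude ν v) : ∃ V, Tendsto v atTop (𝓝 V) := by
  obtain ⟨C, hC⟩ := hv.exists_norm_le one_pos
  refine ⟨_, tendsto_limUnder_of_hasDerivAt_of_integrableOn_Ioi (a := 1)
    (fun t ht => hv t (one_pos.trans ht)) ?_⟩
  refine Integrable.mono' ((integrableOn_inv_sq one_pos).const_mul (|ν ^ 2 - 1 / 4| * C)) ?_ ?_
  · refine ContinuousOn.aestronglyMeasurable (ContinuousOn.mul (by fun_prop) ?_) measurableSet_Ioi
    refine Complex.continuous_ofReal.comp_continuousOn (ContinuousOn.mul ?_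
      (hv.continuousOn_im.mono (Ioi_subset_Ioi zero_le_one)))
    refine ContinuousOn.div (by fun_prop) (by fun_prop) fun t ht => ?_
    exact pow_ne_zero _ (one_pos.trans ht).ne'
  · refine (ae_restrict_iff' measurableSet_Ioi).mpr (ae_of_all _ fun t ht => ?_)
    rw [norm_mul, ← conj_exp_mul_I, RCLike.norm_conj, Complex.norm_exp_ofReal_mul_I, one_mul,
      Complex.norm_real, norm_mul, Real.norm_eq_abs, Real.norm_eq_abs, abs_div,
      abs_of_nonneg (sq_nonneg t)]
    have h := (abs_im_exp_mul_I_mul_le t (v t)).trans (hC t (le_of_lt ht))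
    calc |ν ^ 2 - 1 / 4| / t ^ 2 * |(Complex.exp (t * Complex.I) * v t).im|
        ≤ |ν ^ 2 - 1 / 4| / t ^ 2 * C := by gcongr
      _ = _ := by ring

lemma norm_le (hv : IsBesselAmplitude ν v) (hV : Tendsto v atTop (𝓝 V)) {t : ℝ} (ht : 0 < t) :
    ‖v t‖ ≤ ‖V‖ * Real.exp (|ν ^ 2 - 1 / 4| / t) := by
  have hlim : Tendsto (fun t => ‖v t‖ ^ 2 * Real.exp (-|ν ^ 2 - 1 / 4| / t)) atTop
      (𝓝 (‖V‖ ^ 2 * Real.exp 0)) :=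
    (hV.norm.pow 2).mul ((Real.continuous_exp.tendsto 0).comp (tendsto_const_nhds.div_atTop
      tendsto_id))
  have h1 : ‖v t‖ ^ 2 * Real.exp (-|ν ^ 2 - 1 / 4| / t) ≤ ‖V‖ ^ 2 * Real.exp 0 := by
    refine ge_of_tendsto hlim ?_
    filter_upwards [eventually_ge_atTop t] with s hs
    exact hv.monotoneOn_norm_sq_mul_exp ht (ht.trans_le hs) hs
  rw [neg_div, Real.exp_neg, Real.exp_zero, mul_one, ← div_eq_mul_inv,
    div_le_iff₀ (Real.exp_pos _)] at h1
  have h2 : 1 ≤ Real.exp (|ν ^ 2 - 1 / 4| / t) := Real.one_le_exp (by positivity)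
  refine le_of_sq_le_sq ?_ (by positivity)
  rw [mul_pow]
  refine h1.trans (mul_le_mul_of_nonneg_left ?_ (sq_nonneg _))
  nlinarith

lemma abs_im_le (hv : IsBesselAmplitude ν v) (hV : Tendsto v atTop (𝓝 V)) {t : ℝ} (ht : 0 < t) :
    |(Complex.exp (t * Complex.I) * v t).im| ≤ ‖V‖ * Real.exp (|ν ^ 2 - 1 / 4| / t) :=
  (abs_im_exp_mul_I_mul_le t (v t)).trans (hv.norm_le hV ht)

lemma integrableOn_pairing (hv : IsBesselAmplitude μ v) (hw : IsBesselAmplitude ν w) {z : ℝ}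
    (hz : 0 < z) :
    IntegrableOn (fun t : ℝ => (Complex.exp (t * Complex.I) * v t).im *
        (Complex.exp (t * Complex.I) * w t).im / t ^ 2) (Ioi z) := by
  obtain ⟨C, hC⟩ := hv.exists_norm_le hz
  obtain ⟨D, hD⟩ := hw.exists_norm_le hz
  have hsub : Ioi z ⊆ Ioi (0 : ℝ) := Ioi_subset_Ioi hz.le
  refine Integrable.mono' ((integrableOn_inv_sq hz).const_mul (C * D)) ?_ ?_
  · refine ContinuousOn.aestronglyMeasurable (ContinuousOn.div
      ((hv.continuousOn_im.mono hsub).mul (hw.continuousOn_im.mono hsub)) (by fun_prop)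
      fun t ht => pow_ne_zero _ (hz.trans ht).ne') measurableSet_Ioi
  · refine (ae_restrict_iff' measurableSet_Ioi).mpr (ae_of_all _ fun t ht => ?_)
    rw [norm_div, norm_mul, Real.norm_eq_abs, Real.norm_eq_abs, norm_pow, Real.norm_eq_abs,
      sq_abs, ← mul_one_div]
    have h1 := (abs_im_exp_mul_I_mul_le t (v t)).trans (hC t (le_of_lt ht))
    have h2 := (abs_im_exp_mul_I_mul_le t (w t)).trans (hD t (le_of_lt ht))
    have h3 : 0 ≤ C := (abs_nonneg _).trans h1
    gcongr

lemma pairing_eq (hv : IsBesselAmplitude μ v) (hw : IsBesselAmplitude ν w)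
    (hV : Tendsto v atTop (𝓝 V)) (hW : Tendsto w atTop (𝓝 W)) {z : ℝ} (hz : 0 < z) :
    (w z * (starRingEnd ℂ) (v z)).im = (W * (starRingEnd ℂ) V).im
      - (μ ^ 2 - ν ^ 2) * ∫ t in Ioi z, (Complex.exp (t * Complex.I) * v t).im *
        (Complex.exp (t * Complex.I) * w t).im / t ^ 2 := by
  have h := integral_Ioi_of_hasDerivAt_of_tendsto'
    (fun t (ht : t ∈ Ici z) => hv.hasDerivAt_pairing hw (hz.trans_le ht))
    ((hv.integrableOn_pairing hw hz).const_mul _)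
    ((Complex.continuous_im.tendsto _).comp (hW.mul ((Complex.continuous_conj.tendsto V).comp hV)))
  rw [integral_const_mul] at h
  linarith

/-- Three amplitudes at the same point are linearly dependent over the reals. -/
lemma im_mul_cross (e a b c : ℂ) :
    (e * c).im * (a * (starRingEnd ℂ) b).im + (e * a).im * (b * (starRingEnd ℂ) c).im
      + (e * b).im * (c * (starRingEnd ℂ) a).im = 0 := by
  simp only [Complex.mul_im, Complex.conj_re, Complex.conj_im]
  ring

end IsBesselAmplitude

lemma isBesselAmplitude_of_hasDerivAt {ν : ℝ} {u p : ℝ → ℝ}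
    (hu : ∀ t, 0 < t → HasDerivAt u (p t) t)
    (hp : ∀ t, 0 < t → HasDerivAt p ((ν ^ 2 - 1 / 4) / t ^ 2 * u t - u t) t) :
    IsBesselAmplitude ν
      (fun t => Complex.exp (-(t * Complex.I)) * ((p t : ℂ) + u t * Complex.I)) := by
  intro t ht
  have he : HasDerivAt (fun s : ℝ => Complex.exp (-((s : ℂ) * Complex.I)))
      (Complex.exp (-((t : ℂ) * Complex.I)) * -(1 * Complex.I)) t :=
    ((Complex.ofRealCLM.hasDerivAt (x := t)).mul_const Complex.I).neg.cexp
  have h := he.mul (((hp t ht).ofReal_comp).add (((hu t ht).ofReal_comp).mul_const Complex.I))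
  refine h.congr_deriv ?_
  have hE : Complex.exp (t * Complex.I) * (Complex.exp (-(t * Complex.I)) *
      ((p t : ℂ) + u t * Complex.I)) = (p t : ℂ) + u t * Complex.I := by
    rw [← mul_assoc, ← Complex.exp_add, add_neg_cancel, Complex.exp_zero, one_mul]
  have him : ((p t : ℂ) + u t * Complex.I).im = u t := by simp
  rw [hE, him, Pi.add_apply]
  push_cast
  linear_combination -(Complex.exp (-((t : ℂ) * Complex.I)) * u t) * Complex.I_sq

/-- The complex amplitude of `√t * besselJ ν t`. -/
noncomputable def besselJAmplitude (ν t : ℝ) : ℂ :=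
  Complex.exp (-(t * Complex.I)) *
    (((√t * ((ν + 1 / 2) / t * besselJ ν t - besselJ (ν + 1) t) : ℝ) : ℂ)
      + ((√t * besselJ ν t : ℝ) : ℂ) * Complex.I)

lemma exp_mul_besselJAmplitude (ν t : ℝ) :
    Complex.exp (t * Complex.I) * besselJAmplitude ν t =
    (((√t * ((ν + 1 / 2) / t * besselJ ν t - besselJ (ν + 1) t) : ℝ) : ℂ)
      + ((√t * besselJ ν t : ℝ) : ℂ) * Complex.I) := by
  rw [besselJAmplitude, ← mul_assoc, ← Complex.exp_add, add_neg_cancel, Complex.exp_zero, one_mul]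

lemma im_exp_mul_besselJAmplitude (ν t : ℝ) :
    (Complex.exp (t * Complex.I) * besselJAmplitude ν t).im = √t * besselJ ν t := by
  rw [exp_mul_besselJAmplitude]
  simp only [Complex.add_im, Complex.mul_im, Complex.ofReal_re, Complex.ofReal_im, Complex.I_re,
    Complex.I_im]
  ring

lemma re_exp_mul_besselJAmplitude (ν t : ℝ) :
    (Complex.exp (t * Complex.I) * besselJAmplitude ν t).re =
      √t * ((ν + 1 / 2) / t * besselJ ν t - besselJ (ν + 1) t) := by
  rw [exp_mul_besselJAmplitude]
  simp only [Complex.add_re, Complex.mul_re, Complex.ofReal_re, Complex.ofReal_im, Complex.I_re,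
    Complex.I_im]
  ring

lemma isBesselAmplitude_besselJAmplitude (ν : ℝ) :
    IsBesselAmplitude ν (besselJAmplitude ν) := by
  refine isBesselAmplitude_of_hasDerivAt (u := fun t => √t * besselJ ν t)
    (p := fun t => √t * ((ν + 1 / 2) / t * besselJ ν t - besselJ (ν + 1) t))
    (fun t ht => ?_) (fun t ht => ?_)
  · refine ((Real.hasDerivAt_sqrt ht.ne').mul (hasDerivAt_besselJ ν ht)).congr_deriv ?_
    have hs : √t ≠ 0 := (Real.sqrt_pos.mpr ht).ne'
    have hq : √t ^ 2 = t := Real.sq_sqrt ht.le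
    field_simp
    rw [hq]
    ring
  · have h1 := ((hasDerivAt_inv ht.ne').const_mul (ν + 1 / 2)).mul (hasDerivAt_besselJ ν ht)
    simp only [← div_eq_mul_inv] at h1
    refine ((Real.hasDerivAt_sqrt ht.ne').mul (h1.sub
      (hasDerivAt_besselJ_add_one ν ht))).congr_deriv ?_
    have hs : √t ≠ 0 := (Real.sqrt_pos.mpr ht).ne'
    have hq : √t ^ 2 = t := Real.sq_sqrt ht.le
    simp only [Pi.sub_apply, Pi.mul_apply]
    field_simp
    rw [hq]
    ring

lemma continuousOn_besselJ (ν : ℝ) : ContinuousOn (besselJ ν) (Ioi 0) :=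
  fun _ ht => (hasDerivAt_besselJ ν ht).continuousAt.continuousWithinAt

lemma eq_zero_of_tendsto_im_exp_mul {W : ℂ}
    (h : Tendsto (fun t : ℝ => (Complex.exp (t * Complex.I) * W).im) atTop (𝓝 0)) : W = 0 := by
  have key : ∀ θ : ℝ, (Complex.exp (θ * Complex.I) * W).im = 0 := by
    intro θ
    have hseq : Tendsto (fun n : ℕ => θ + n * (2 * π)) atTop atTop :=
      tendsto_atTop_add_const_left _ _
        (tendsto_natCast_atTop_atTop.atTop_mul_const (by positivity))
    refine tendsto_nhds_unique (tendsto_const_nhds.congr fun n : ℕ => ?_) (h.comp hseq)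
    simp only [Function.comp_apply]
    have : ((θ + n * (2 * π) : ℝ) : ℂ) * Complex.I
        = θ * Complex.I + n * (2 * π * Complex.I) := by push_cast; ring
    rw [this, Complex.exp_periodic.nat_mul]
  have h0 := key 0
  have h1 := key (π / 2)
  rw [Complex.ofReal_div, Complex.ofReal_ofNat, Complex.exp_pi_div_two_mul_I] at h1
  simp at h0 h1
  exact Complex.ext h1 h0

/-- The limit of the amplitude of order `ν - 1` from the one of order `ν`. -/
lemma tendsto_besselJAmplitude_sub_one {ν : ℝ} {V : ℂ}
    (h : Tendsto (besselJAmplitude ν) atTop (𝓝 V)) :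
    Tendsto (besselJAmplitude (ν - 1)) atTop (𝓝 (Complex.I * V)) := by
  obtain ⟨W, hW⟩ := (isBesselAmplitude_besselJAmplitude (ν - 1)).exists_tendsto
  obtain ⟨C, hC⟩ := (isBesselAmplitude_besselJAmplitude ν).exists_norm_le one_pos
  have hid : ∀ t : ℝ, 0 < t →
      (Complex.exp (t * Complex.I) * (besselJAmplitude (ν - 1) t
        - Complex.I * besselJAmplitude ν t)).im
      = (ν - 1 / 2) / t * (Complex.exp (t * Complex.I) * besselJAmplitude ν t).im := by
    intro t ht
    rw [mul_sub, mul_left_comm, Complex.sub_im, Complex.I_mul_im, im_exp_mul_besselJAmplitude,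
      im_exp_mul_besselJAmplitude, re_exp_mul_besselJAmplitude, besselJ_sub_one ν ht]
    field_simp
    ring
  have h1 : Tendsto (fun t : ℝ => (Complex.exp (t * Complex.I) * (besselJAmplitude (ν - 1) t
        - Complex.I * besselJAmplitude ν t)).im) atTop (𝓝 0) := by
    have hz : Tendsto (fun t : ℝ => |ν - 1 / 2| * C / t) atTop (𝓝 0) :=
      tendsto_const_nhds.div_atTop tendsto_id
    refine squeeze_zero_norm' ?_ hz
    filter_upwards [eventually_ge_atTop 1] with t ht
    have ht0 : 0 < t := one_pos.trans_le ht
    rw [hid t ht0, norm_mul, Real.norm_eq_abs, Real.norm_eq_abs, abs_div, abs_of_pos ht0,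
      mul_div_right_comm]
    gcongr
    exact (abs_im_exp_mul_I_mul_le t _).trans (hC t ht)
  have h2 : Tendsto (fun t : ℝ => (Complex.exp (t * Complex.I) * ((W - Complex.I * V) -
      (besselJAmplitude (ν - 1) t - Complex.I * besselJAmplitude ν t))).im) atTop (𝓝 0) := by
    have hz : Tendsto (fun t : ℝ => ‖(W - Complex.I * V) -
      (besselJAmplitude (ν - 1) t - Complex.I * besselJAmplitude ν t)‖) atTop (𝓝 0) := by
      have := (tendsto_const_nhds (x := W - Complex.I * V)).sub (hW.sub (h.const_mul Complex.I))
      simpa using this.norm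
    exact squeeze_zero_norm (fun t => abs_im_exp_mul_I_mul_le t _) hz
  have h3 := h1.add h2
  simp only [← Complex.add_im, ← mul_add, add_sub_cancel, add_zero] at h3
  have := eq_zero_of_tendsto_im_exp_mul h3
  rwa [sub_eq_zero.mp this] at hW

lemma integrableOn_rpow_mul_exp_neg {p b : ℝ} (hp : -1 < p) (hb : 0 < b) :
    IntegrableOn (fun t : ℝ => t ^ p * Real.exp (-(b * t))) (Ioi 0) := by
  simpa only [Real.rpow_one, neg_mul] using
    integrableOn_rpow_mul_exp_neg_mul_rpow (p := 1) hp one_pos hb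

lemma norm_exp_neg_mul_ofReal (s : ℂ) (t : ℝ) :
    ‖Complex.exp (-(s * t))‖ = Real.exp (-(s.re * t)) := by
  rw [Complex.norm_exp]
  simp

lemma aestronglyMeasurable_laplace {f : ℝ → ℝ} (hf : ContinuousOn f (Ioi 0)) (s : ℂ) :
    AEStronglyMeasurable (fun t : ℝ => (f t : ℂ) * Complex.exp (-(s * t)))
      (volume.restrict (Ioi 0)) :=
  ((Complex.continuous_ofReal.comp_continuousOn hf).mul (by fun_prop)).aestronglyMeasurable
    measurableSet_Ioi

lemma norm_laplace_le {f : ℝ → ℝ} {C p : ℝ} (hC : ∀ t, 0 < t → |f t| ≤ C * t ^ p) (s : ℂ) {t : ℝ} (ht : 0 < t) :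
    ‖(f t : ℂ) * Complex.exp (-(s * t))‖ ≤ C * (t ^ p * Real.exp (-(s.re * t))) := by
  rw [norm_mul, norm_exp_neg_mul_ofReal, Complex.norm_real, Real.norm_eq_abs, ← mul_assoc]
  exact mul_le_mul_of_nonneg_right (hC t ht) (Real.exp_nonneg _)

lemma integrableOn_laplace {f : ℝ → ℝ} {C p : ℝ} (hf : ContinuousOn f (Ioi 0))
    (hC : ∀ t, 0 < t → |f t| ≤ C * t ^ p) (hp : -1 < p) {s : ℂ} (hs : 0 < s.re) :
    IntegrableOn (fun t : ℝ => (f t : ℂ) * Complex.exp (-(s * t))) (Ioi 0) :=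
  Integrable.mono' ((integrableOn_rpow_mul_exp_neg hp hs).const_mul C)
    (aestronglyMeasurable_laplace hf s)
    ((ae_restrict_iff' measurableSet_Ioi).mpr (ae_of_all _ fun _ ht => norm_laplace_le hC s ht))

lemma hasDerivAt_laplace {f : ℝ → ℝ} {C p : ℝ} (hf : ContinuousOn f (Ioi 0))
    (hC : ∀ t, 0 < t → |f t| ≤ C * t ^ p) (hp : -1 < p) {s : ℂ} (hs : 0 < s.re) :
    HasDerivAt (fun s : ℂ => ∫ t in Ioi (0 : ℝ), (f t : ℂ) * Complex.exp (-(s * t)))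
      (∫ t in Ioi (0 : ℝ), -(((t * f t : ℝ) : ℂ) * Complex.exp (-(s * t)))) s := by
  have hC' : ∀ t : ℝ, 0 < t → |t * f t| ≤ C * t ^ (p + 1) := by
    intro t ht
    rw [abs_mul, abs_of_pos ht, Real.rpow_add_one ht.ne']
    nlinarith [hC t ht]
  have hf' : ContinuousOn (fun t => t * f t) (Ioi 0) := continuousOn_id.mul hf
  have hC0 : 0 ≤ C := by simpa using (abs_nonneg _).trans (hC 1 one_pos)
  refine (hasDerivAt_integral_of_dominated_loc_of_deriv_le (s := {z : ℂ | s.re / 2 < z.re})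
    (bound := fun t => C * (t ^ (p + 1) * Real.exp (-(s.re / 2 * t))))
    ((isOpen_lt continuous_const Complex.continuous_re).mem_nhds (half_lt_self hs))
    (Eventually.of_forall fun z => aestronglyMeasurable_laplace hf z)
    (integrableOn_laplace hf hC hp hs)
    (F' := fun s (t : ℝ) => -(((t * f t : ℝ) : ℂ) * Complex.exp (-(s * t))))
    (aestronglyMeasurable_laplace hf' s).neg ?_
    ((integrableOn_rpow_mul_exp_neg (by linarith) (half_pos hs)).const_mul C) ?_).2
  · refine (ae_restrict_iff' measurableSet_Ioi).mpr (ae_of_all _ fun t ht z hz => ?_)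
    have ht : 0 < t := ht
    have hz : s.re / 2 < z.re := hz
    rw [norm_neg]
    refine (norm_laplace_le hC' z ht).trans ?_
    gcongr
  · refine ae_of_all _ fun t z _ => ?_
    have h := (((hasDerivAt_id z).mul_const (t : ℂ)).neg.cexp).const_mul (f t : ℂ)
    refine h.congr_deriv ?_
    push_cast
    simp only [id, Pi.neg_apply]
    ring

lemma exists_abs_besselJ_le {ν : ℝ} (hν : 0 ≤ ν) :
    ∃ C, ∀ t, 0 < t → |besselJ ν t| ≤ C * t ^ ν := by
  have hcont : Continuous (besselSeries ν) := continuous_iff_continuousAt.mpr fun w =>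
    (hasDerivAt_besselSeries ν w).continuousAt
  obtain ⟨A, hA⟩ := (isCompact_Icc (a := (0 : ℝ)) (b := 1)).exists_bound_of_continuousOn
    hcont.continuousOn
  obtain ⟨B, hB⟩ := (isBesselAmplitude_besselJAmplitude ν).exists_norm_le one_pos
  refine ⟨max A B, fun t ht => ?_⟩
  rcases le_total t 1 with h1 | h1
  · rw [besselJ_eq, abs_mul, mul_comm]
    have hw := hA (t ^ 2 / 4) ⟨by positivity, by nlinarith⟩
    rw [Real.norm_eq_abs] at hw
    have h2 : |(t / 2) ^ ν| ≤ t ^ ν := by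
      rw [abs_of_nonneg (by positivity)]
      exact Real.rpow_le_rpow (by positivity) (by linarith) hν
    exact mul_le_mul (hw.trans (le_max_left _ _)) h2 (abs_nonneg _)
      (((abs_nonneg _).trans hw).trans (le_max_left _ _))
  · have h2 := (abs_im_exp_mul_I_mul_le t _).trans (hB t h1)
    rw [im_exp_mul_besselJAmplitude, abs_mul, abs_of_nonneg (Real.sqrt_nonneg t)] at h2
    have h3 : 1 ≤ √t := Real.one_le_sqrt.mpr h1
    have h4 : 1 ≤ t ^ ν := Real.one_le_rpow h1 hν
    have h5 : |besselJ ν t| ≤ B := by nlinarith [abs_nonneg (besselJ ν t)]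
    have h6 : 0 ≤ B := (abs_nonneg _).trans h5
    exact (h5.trans (le_max_right A B)).trans
      (le_mul_of_one_le_right (h6.trans (le_max_right A B)) h4)

lemma exists_abs_sqrt_mul_besselJ_le {ν : ℝ} (hν : 0 ≤ ν) :
    ∃ C, ∀ t, 0 < t → |√t * besselJ ν t| ≤ C := by
  obtain ⟨A, hA⟩ := exists_abs_besselJ_le hν
  obtain ⟨B, hB⟩ := (isBesselAmplitude_besselJAmplitude ν).exists_norm_le one_pos
  refine ⟨max A B, fun t ht => ?_⟩
  rcases le_total t 1 with h1 | h1
  · refine le_trans ?_ (le_max_left A B)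
    have h2 : √t ≤ 1 := Real.sqrt_le_one.mpr h1
    have h3 : t ^ ν ≤ 1 := Real.rpow_le_one ht.le h1 hν
    have h4 := hA t ht
    have h0 : 0 ≤ A := by simpa using (abs_nonneg _).trans (hA 1 one_pos)
    rw [abs_mul, abs_of_nonneg (Real.sqrt_nonneg t)]
    have h5 : |besselJ ν t| ≤ A := h4.trans (mul_le_of_le_one_right h0 h3)
    nlinarith [abs_nonneg (besselJ ν t), Real.sqrt_nonneg t]
  · rw [← im_exp_mul_besselJAmplitude]
    exact ((abs_im_exp_mul_I_mul_le t _).trans (hB t h1)).trans (le_max_right A B)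

/-- The Laplace transform of `t ^ ν * besselJ ν t`. -/
noncomputable def besselLaplace (ν : ℝ) (s : ℂ) : ℂ :=
  ∫ t in Ioi (0 : ℝ), ((t ^ ν * besselJ ν t : ℝ) : ℂ) * Complex.exp (-(s * t))

lemma continuousOn_rpow_mul_besselJ (ν : ℝ) :
    ContinuousOn (fun t => t ^ ν * besselJ ν t) (Ioi 0) :=
  (continuousOn_id.rpow_const fun _ ht => Or.inl (ne_of_gt ht)).mul (continuousOn_besselJ ν)

lemma exists_abs_rpow_mul_besselJ_le {ν : ℝ} (hν : 0 ≤ ν) :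
    ∃ C, ∀ t, 0 < t → |t ^ ν * besselJ ν t| ≤ C * t ^ (2 * ν) := by
  obtain ⟨C, hC⟩ := exists_abs_besselJ_le hν
  refine ⟨C, fun t ht => ?_⟩
  rw [abs_mul, abs_of_nonneg (Real.rpow_nonneg ht.le ν), two_mul, Real.rpow_add ht]
  have := hC t ht
  have h2 := Real.rpow_nonneg ht.le ν
  nlinarith

lemma hasDerivAt_rpow_mul_besselJ (ν : ℝ) {t : ℝ} (ht : 0 < t) :
    HasDerivAt (fun t => t ^ ν * besselJ ν t)
      ((2 * ν * (t ^ ν * besselJ ν t) - t ^ (ν + 1) * besselJ (ν + 1) t) / t) t := by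
  refine ((Real.hasDerivAt_rpow_const (Or.inl ht.ne')).mul
    (hasDerivAt_besselJ ν ht)).congr_deriv ?_
  rw [Real.rpow_sub_one ht.ne', Real.rpow_add_one ht.ne']
  field_simp
  ring

lemma hasDerivAt_rpow_mul_besselJ_add_one (ν : ℝ) {t : ℝ} (ht : 0 < t) :
    HasDerivAt (fun t => t ^ (ν + 1) * besselJ (ν + 1) t) (t * (t ^ ν * besselJ ν t)) t := by
  refine ((Real.hasDerivAt_rpow_const (Or.inl ht.ne')).mul
    (hasDerivAt_besselJ_add_one ν ht)).congr_deriv ?_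
  rw [Real.rpow_sub_one ht.ne', Real.rpow_add_one ht.ne']
  field_simp
  ring

lemma hasDerivAt_besselLaplace {ν : ℝ} (hν : 0 < ν) {s : ℂ} (hs : 0 < s.re) :
    HasDerivAt (besselLaplace ν)
      (∫ t in Ioi (0 : ℝ), -(((t * (t ^ ν * besselJ ν t) : ℝ) : ℂ) * Complex.exp (-(s * t)))) s := by
  obtain ⟨C, hC⟩ := exists_abs_rpow_mul_besselJ_le hν.le
  exact hasDerivAt_laplace (continuousOn_rpow_mul_besselJ ν) hC (by linarith) hs

/-- The first order differential equation of the Laplace transform. -/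
lemma one_add_sq_mul_deriv_besselLaplace {ν : ℝ} (hν : 0 < ν) {s : ℂ} (hs : 0 < s.re) :
    (1 + s ^ 2) * deriv (besselLaplace ν) s = -((2 * ν + 1) * s * besselLaplace ν s) := by
  obtain ⟨C, hC⟩ := exists_abs_rpow_mul_besselJ_le hν.le
  obtain ⟨D, hD⟩ := exists_abs_rpow_mul_besselJ_le (ν := ν + 1) (by linarith)
  have hC1 : ∀ t : ℝ, 0 < t → |t * (t ^ ν * besselJ ν t)| ≤ C * t ^ (2 * ν + 1) := by
    intro t ht
    rw [abs_mul, abs_of_pos ht, Real.rpow_add_one ht.ne']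
    nlinarith [hC t ht]
  have hcont1 : ContinuousOn (fun t => t * (t ^ ν * besselJ ν t)) (Ioi 0) :=
    continuousOn_id.mul (continuousOn_rpow_mul_besselJ ν)
  have hint0 := integrableOn_laplace (continuousOn_rpow_mul_besselJ ν) hC (by linarith) hs
  have hint1 := integrableOn_laplace hcont1 hC1 (by linarith) hs
  set g : ℝ → ℂ := fun t => (s * ((t * (t ^ ν * besselJ ν t) : ℝ) : ℂ)
    - ((t ^ (ν + 1) * besselJ (ν + 1) t : ℝ) : ℂ)) * Complex.exp (-(s * t)) with hg
  have hderiv : ∀ t ∈ Ioi (0 : ℝ), HasDerivAt g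
      ((2 * ν + 1) * s * (((t ^ ν * besselJ ν t : ℝ) : ℂ) * Complex.exp (-(s * t)))
        - (1 + s ^ 2) * (((t * (t ^ ν * besselJ ν t) : ℝ) : ℂ) * Complex.exp (-(s * t)))) t := by
    intro t ht
    have ht : 0 < t := ht
    have h1 := ((hasDerivAt_id t).mul (hasDerivAt_rpow_mul_besselJ ν ht)).ofReal_comp.const_mul s
    have h2 := (hasDerivAt_rpow_mul_besselJ_add_one ν ht).ofReal_comp
    have he : HasDerivAt (fun t : ℝ => Complex.exp (-(s * t)))
        (Complex.exp (-(s * t)) * -(s * 1)) t :=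
      ((Complex.ofRealCLM.hasDerivAt (x := t)).const_mul s).neg.cexp
    refine ((h1.sub h2).mul he).congr_deriv ?_
    simp only [Pi.sub_apply, Pi.mul_apply, id]
    rw [mul_div_cancel₀ _ ht.ne']
    push_cast
    ring
  have hbound : ∀ t : ℝ, 0 < t → ‖g t‖ ≤
      ‖s‖ * C * (t ^ (2 * ν + 1) * Real.exp (-(s.re * t)))
        + D * (t ^ (2 * (ν + 1)) * Real.exp (-(s.re * t))) := by
    intro t ht
    have h1 := norm_laplace_le hC1 s ht
    have h2 := norm_laplace_le hD s ht
    rw [hg]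
    simp only
    rw [sub_mul, mul_assoc]
    refine (norm_sub_le _ _).trans (add_le_add ?_ h2)
    rw [norm_mul, mul_assoc]
    exact mul_le_mul_of_nonneg_left h1 (norm_nonneg _)
  have hg0 : g 0 = 0 := by
    simp [hg, Real.zero_rpow (by linarith : ν + 1 ≠ 0)]
  have hcont : ContinuousWithinAt g (Ici 0) 0 := by
    rw [ContinuousWithinAt, hg0]
    have hB : Tendsto (fun t : ℝ => ‖s‖ * C * (t ^ (2 * ν + 1) * Real.exp (-(s.re * t)))
        + D * (t ^ (2 * (ν + 1)) * Real.exp (-(s.re * t)))) (𝓝[Ici 0] 0) (𝓝 0) := by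
      have hc : Continuous (fun t : ℝ => ‖s‖ * C * (t ^ (2 * ν + 1) * Real.exp (-(s.re * t)))
        + D * (t ^ (2 * (ν + 1)) * Real.exp (-(s.re * t)))) := by
        have h1 := Real.continuous_rpow_const (q := 2 * ν + 1) (by linarith)
        have h2 := Real.continuous_rpow_const (q := 2 * (ν + 1)) (by linarith)
        fun_prop
      have := hc.tendsto 0
      simp only [Real.zero_rpow (by linarith : 2 * ν + 1 ≠ 0),
        Real.zero_rpow (by linarith : 2 * (ν + 1) ≠ 0), zero_mul, mul_zero, add_zero] at this
      exact this.mono_left nhdsWithin_le_nhds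
    refine squeeze_zero_norm' ?_ hB
    filter_upwards [self_mem_nhdsWithin] with t ht
    rcases eq_or_lt_of_le (show (0 : ℝ) ≤ t from ht) with h | h
    · rw [← h, hg0, Real.zero_rpow (by linarith : 2 * ν + 1 ≠ 0),
        Real.zero_rpow (by linarith : 2 * (ν + 1) ≠ 0)]
      simp
    · exact hbound t h
  have htop : Tendsto g atTop (𝓝 0) := by
    have h1 := tendsto_rpow_mul_exp_neg_mul_atTop_nhds_zero (2 * ν + 1) s.re hs
    have h2 := tendsto_rpow_mul_exp_neg_mul_atTop_nhds_zero (2 * (ν + 1)) s.re hs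
    have h3 := (h1.const_mul (‖s‖ * C)).add (h2.const_mul D)
    simp only [mul_zero, add_zero, neg_mul] at h3
    refine squeeze_zero_norm' ?_ h3
    filter_upwards [eventually_gt_atTop 0] with t ht using hbound t ht
  have h := integral_Ioi_of_hasDerivAt_of_tendsto hcont hderiv
    ((hint0.const_mul _).sub (hint1.const_mul _)) htop
  rw [hg0, integral_sub (hint0.const_mul _) (hint1.const_mul _), integral_const_mul,
    integral_const_mul] at h
  rw [(hasDerivAt_besselLaplace hν hs).deriv, integral_neg]
  unfold besselLaplace
  linear_combination h

lemma one_add_sq_mem_slitPlane {s : ℂ} (hs : 0 < s.re) : 1 + s ^ 2 ∈ Complex.slitPlane := by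
  rw [Complex.mem_slitPlane_iff]
  have hre : (1 + s ^ 2).re = 1 + (s.re * s.re - s.im * s.im) := by simp [pow_two]
  have him : (1 + s ^ 2).im = 2 * s.re * s.im := by simp [pow_two]; ring
  rw [hre, him]
  by_cases h : s.im = 0
  · left
    rw [h]
    nlinarith
  · right
    exact mul_ne_zero (by positivity) h

lemma exists_besselLaplace_mul_cpow_eq {ν : ℝ} (hν : 0 < ν) :
    ∃ c : ℂ, ∀ s : ℂ, 0 < s.re →
      besselLaplace ν s * (1 + s ^ 2) ^ ((ν + 1 / 2 : ℝ) : ℂ) = c := by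
  have hd : ∀ s : ℂ, 0 < s.re →
      HasDerivAt (fun s => besselLaplace ν s * (1 + s ^ 2) ^ ((ν + 1 / 2 : ℝ) : ℂ)) 0 s := by
    intro s hs
    have h1 := (hasDerivAt_besselLaplace hν hs).differentiableAt.hasDerivAt
    have h2 : HasDerivAt (fun s : ℂ => 1 + s ^ 2) (2 * s) s := by
      simpa using (hasDerivAt_pow 2 s).const_add 1
    have hm := one_add_sq_mem_slitPlane hs
    refine (h1.mul (h2.cpow_const (c := ((ν + 1 / 2 : ℝ) : ℂ)) hm)).congr_deriv ?_
    have h0 : 1 + s ^ 2 ≠ 0 := Complex.slitPlane_ne_zero hm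
    rw [Complex.cpow_sub _ _ h0, Complex.cpow_one]
    have h3 := one_add_sq_mul_deriv_besselLaplace hν hs
    generalize (1 + s ^ 2) ^ ((ν + 1 / 2 : ℝ) : ℂ) = P
    push_cast
    field_simp
    linear_combination P * h3
  have ho : IsOpen {s : ℂ | 0 < s.re} := isOpen_lt continuous_const Complex.continuous_re
  exact ho.exists_is_const_of_deriv_eq_zero (convex_halfSpace_re_gt 0).isPreconnected
    (fun s hs => (hd s hs).differentiableAt.differentiableWithinAt) fun s hs => (hd s hs).deriv

/-- Rescaling the integration variable in the Laplace transform. -/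
lemma besselLaplace_eq_scaled (ν : ℝ) (s : ℂ) {x : ℝ} (hx : 0 < x) :
    besselLaplace ν s = ((x⁻¹ : ℝ) : ℂ) * ∫ t in Ioi (0 : ℝ),
      ((((x⁻¹ * t) ^ ν * besselJ ν (x⁻¹ * t) : ℝ) : ℂ) *
        Complex.exp (-(s * ((x⁻¹ * t : ℝ) : ℂ)))) := by
  have h := integral_comp_mul_left_Ioi (fun t : ℝ => ((t ^ ν * besselJ ν t : ℝ) : ℂ) *
    Complex.exp (-(s * t))) 0 (inv_pos.mpr hx)
  rw [h, mul_zero, inv_inv, Complex.real_smul, ← mul_assoc, ← Complex.ofReal_mul,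
    inv_mul_cancel₀ hx.ne', Complex.ofReal_one, one_mul, besselLaplace]

lemma integral_rpow_mul_exp_neg {a : ℝ} (ha : -1 < a) :
    ∫ t in Ioi (0 : ℝ), t ^ a * Real.exp (-t) = Real.Gamma (a + 1) := by
  rw [Real.Gamma_eq_integral (by linarith), add_sub_cancel_right]
  exact integral_congr_ae (ae_of_all _ fun t => mul_comm _ _)

lemma integrableOn_rpow_mul_exp_neg_self {a : ℝ} (ha : -1 < a) :
    IntegrableOn (fun t : ℝ => t ^ a * Real.exp (-t)) (Ioi 0) := by
  simpa using integrableOn_rpow_mul_exp_neg ha one_pos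

lemma tendsto_besselLaplace_atTop {ν : ℝ} (hν : 0 < ν) :
    Tendsto (fun x : ℝ => ((x ^ (2 * ν + 1) : ℝ) : ℂ) * besselLaplace ν x) atTop
      (𝓝 ((Real.Gamma (2 * ν + 1) / (2 ^ ν * Real.Gamma (ν + 1)) : ℝ) : ℂ)) := by
  obtain ⟨C, hC⟩ := exists_abs_rpow_mul_besselJ_le hν.le
  have hscale : ∀ x : ℝ, 0 < x → ((x ^ (2 * ν + 1) : ℝ) : ℂ) * besselLaplace ν x =
      ((∫ t in Ioi (0 : ℝ), x ^ (2 * ν) * ((x⁻¹ * t) ^ ν * besselJ ν (x⁻¹ * t))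
        * Real.exp (-t) : ℝ) : ℂ) := by
    intro x hx
    rw [besselLaplace_eq_scaled ν x hx, Real.rpow_add_one hx.ne', ← mul_assoc,
      ← Complex.ofReal_mul, mul_assoc, mul_inv_cancel₀ hx.ne', mul_one, ← integral_const_mul,
      ← integral_complex_ofReal]
    refine integral_congr_ae (ae_of_all _ fun t => ?_)
    have : (x : ℂ) ≠ 0 := by exact_mod_cast hx.ne'
    have h2 : (x : ℂ) * ((x⁻¹ * t : ℝ) : ℂ) = t := by push_cast; field_simp
    simp only [h2]
    push_cast
    ring
  have hsub : ∀ x t : ℝ, 0 < x → 0 < t → x ^ (2 * ν) * ((x⁻¹ * t) ^ ν * besselJ ν (x⁻¹ * t)) =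
      t ^ (2 * ν) * (2 ^ ν)⁻¹ * besselSeries ν ((x⁻¹ * t) ^ 2 / 4) := by
    intro x t hx ht
    have hxt : 0 < x⁻¹ * t := by positivity
    rw [besselJ_eq, Real.div_rpow hxt.le (by norm_num), Real.mul_rpow (by positivity) ht.le,
      Real.inv_rpow hx.le, two_mul, Real.rpow_add hx, Real.rpow_add ht]
    have : x ^ ν ≠ 0 := (Real.rpow_pos_of_pos hx ν).ne'
    field_simp
  have hseries : Continuous (besselSeries ν) := continuous_iff_continuousAt.mpr fun w =>
    (hasDerivAt_besselSeries ν w).continuousAt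
  have hzero : besselSeries ν 0 = (Real.Gamma (ν + 1))⁻¹ := by
    unfold besselSeries
    rw [tsum_eq_single 0 fun k hk => by simp [hk]]
    simp [besselCoeff]
  have hlim : Tendsto (fun x : ℝ => ∫ t in Ioi (0 : ℝ),
      x ^ (2 * ν) * ((x⁻¹ * t) ^ ν * besselJ ν (x⁻¹ * t)) * Real.exp (-t)) atTop
      (𝓝 (∫ t in Ioi (0 : ℝ), (t ^ (2 * ν) * (2 ^ ν)⁻¹ * (Real.Gamma (ν + 1))⁻¹)
        * Real.exp (-t))) := by
    refine tendsto_integral_filter_of_dominated_convergence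
      (fun t => C * (t ^ (2 * ν) * Real.exp (-t))) ?_ ?_
      ((integrableOn_rpow_mul_exp_neg_self (by linarith)).const_mul C) ?_
    · filter_upwards [eventually_gt_atTop 0] with x hx
      refine ContinuousOn.aestronglyMeasurable ?_ measurableSet_Ioi
      refine ContinuousOn.mul (continuousOn_const.mul ?_) (by fun_prop)
      exact (continuousOn_rpow_mul_besselJ ν).comp (by fun_prop)
        fun t ht => mul_pos (inv_pos.mpr hx) ht
    · filter_upwards [eventually_gt_atTop 0] with x hx
      refine (ae_restrict_iff' measurableSet_Ioi).mpr (ae_of_all _ fun t ht => ?_)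
      have ht : 0 < t := ht
      have h := hC (x⁻¹ * t) (by positivity)
      rw [Real.mul_rpow (z := 2 * ν) (by positivity) ht.le, Real.inv_rpow hx.le] at h
      have hx2 : 0 < x ^ (2 * ν) := Real.rpow_pos_of_pos hx _
      rw [norm_mul, norm_mul, Real.norm_eq_abs, Real.norm_eq_abs, Real.norm_eq_abs,
        abs_of_pos hx2, abs_of_pos (Real.exp_pos _), ← mul_assoc]
      refine mul_le_mul_of_nonneg_right ?_ (Real.exp_nonneg _)
      calc _ ≤ x ^ (2 * ν) * (C * ((x ^ (2 * ν))⁻¹ * t ^ (2 * ν))) := by gcongr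
        _ = _ := by field_simp
    · refine (ae_restrict_iff' measurableSet_Ioi).mpr (ae_of_all _ fun t ht => ?_)
      have ht : 0 < t := ht
      refine Tendsto.mul_const _ ?_
      have h1 : Tendsto (fun x : ℝ => (x⁻¹ * t) ^ 2 / 4) atTop (𝓝 0) := by
        have := ((tendsto_inv_atTop_zero (𝕜 := ℝ)).mul_const t).pow 2 |>.div_const 4
        simpa using this
      have h2 := ((hseries.tendsto 0).comp h1).const_mul (t ^ (2 * ν) * (2 ^ ν)⁻¹)
      rw [hzero] at h2
      refine h2.congr' ?_
      filter_upwards [eventually_gt_atTop 0] with x hx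
      exact (hsub x t hx ht).symm
  have hval : ∫ t in Ioi (0 : ℝ), (t ^ (2 * ν) * (2 ^ ν)⁻¹ * (Real.Gamma (ν + 1))⁻¹)
        * Real.exp (-t) = Real.Gamma (2 * ν + 1) / (2 ^ ν * Real.Gamma (ν + 1)) := by
    rw [← integral_rpow_mul_exp_neg (by linarith : -1 < 2 * ν), div_eq_mul_inv,
      ← integral_mul_const]
    refine integral_congr_ae (ae_of_all _ fun t => ?_)
    simp only
    rw [mul_inv]
    ring
  rw [hval] at hlim
  refine ((Complex.continuous_ofReal.tendsto _).comp hlim).congr' ?_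
  filter_upwards [eventually_gt_atTop 0] with x hx
  exact (hscale x hx).symm

lemma besselLaplace_mul_cpow_eq {ν : ℝ} (hν : 0 < ν) {s : ℂ} (hs : 0 < s.re) :
    besselLaplace ν s * (1 + s ^ 2) ^ ((ν + 1 / 2 : ℝ) : ℂ) =
      ((2 ^ ν * Real.Gamma (ν + 1 / 2) / √π : ℝ) : ℂ) := by
  obtain ⟨c, hc⟩ := exists_besselLaplace_mul_cpow_eq hν
  rw [hc s hs]
  have h1 : Tendsto (fun x : ℝ => (((1 + (x ^ 2)⁻¹) ^ (ν + 1 / 2) : ℝ) : ℂ)) atTop (𝓝 1) := by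
    have h2 : Tendsto (fun x : ℝ => 1 + (x ^ 2)⁻¹) atTop (𝓝 1) := by
      simpa using (tendsto_pow_atTop (α := ℝ) two_ne_zero).inv_tendsto_atTop.const_add 1
    have h3 := h2.rpow_const (p := ν + 1 / 2) (Or.inl one_ne_zero)
    rw [Real.one_rpow] at h3
    exact_mod_cast (Complex.continuous_ofReal.tendsto _).comp h3
  have h2 := (tendsto_besselLaplace_atTop hν).mul h1
  rw [mul_one] at h2
  have h3 : Tendsto (fun _ : ℝ => c) atTop
      (𝓝 ((Real.Gamma (2 * ν + 1) / (2 ^ ν * Real.Gamma (ν + 1)) : ℝ) : ℂ)) := by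
    refine h2.congr' ?_
    filter_upwards [eventually_gt_atTop 0] with x hx
    rw [← hc x (by simpa using hx), mul_comm _ (besselLaplace ν x), mul_assoc,
      ← Complex.ofReal_mul]
    congr 1
    have e : (1 : ℂ) + (x : ℂ) ^ 2 = ((1 + x ^ 2 : ℝ) : ℂ) := by push_cast; rfl
    rw [e, ← Complex.ofReal_cpow (by positivity)]
    congr 1
    rw [show 2 * ν + 1 = 2 * (ν + 1 / 2) by ring, Real.rpow_mul hx.le,
      ← Real.mul_rpow (by positivity) (by positivity)]
    congr 1
    rw [Real.rpow_two]
    field_simp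
    ring
  rw [tendsto_nhds_unique tendsto_const_nhds h3]
  congr 1
  have h4 := Real.Gamma_mul_Gamma_add_half (ν + 1 / 2)
  rw [show ν + 1 / 2 + 1 / 2 = ν + 1 by ring, show 2 * (ν + 1 / 2) = 2 * ν + 1 by ring,
    show 1 - (2 * ν + 1) = -(2 * ν) by ring, Real.rpow_neg (by norm_num), two_mul,
    Real.rpow_add (by norm_num)] at h4
  rw [two_mul]
  have h5 : √π ≠ 0 := (Real.sqrt_pos.mpr Real.pi_pos).ne'
  have h6 := (Real.Gamma_pos_of_pos (by linarith : 0 < ν + 1)).ne'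
  have h7 : (2 : ℝ) ^ ν ≠ 0 := (Real.rpow_pos_of_pos two_pos ν).ne'
  field_simp
  field_simp at h4
  linarith

lemma besselJ_mul_exp_neg_eq (ν t : ℝ) :
    ((√t * besselJ ν t : ℝ) : ℂ) * Complex.exp (-(t * Complex.I)) =
      (besselJAmplitude ν t - Complex.exp (-(t * Complex.I)) ^ 2 *
        (starRingEnd ℂ) (besselJAmplitude ν t)) / (2 * Complex.I) := by
  have h := Complex.sub_conj (Complex.exp (t * Complex.I) * besselJAmplitude ν t)
  rw [im_exp_mul_besselJAmplitude, map_mul, conj_exp_mul_I] at h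
  have hE : Complex.exp (t * Complex.I) * Complex.exp (-(t * Complex.I)) = 1 := by
    rw [← Complex.exp_add, add_neg_cancel, Complex.exp_zero]
  have hI := Complex.I_ne_zero
  rw [eq_div_iff (by simp)]
  push_cast at h ⊢
  linear_combination (-Complex.exp (-(t * Complex.I))) * h + besselJAmplitude ν t * hE

lemma tendsto_besselJ_mul_exp_neg_add {ν : ℝ} {V : ℂ}
    (hV : Tendsto (besselJAmplitude ν) atTop (𝓝 V)) :
    Tendsto (fun t : ℝ => ((√t * besselJ ν t : ℝ) : ℂ) * Complex.exp (-(t * Complex.I)) +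
      Complex.exp (-(t * Complex.I)) ^ 2 * ((starRingEnd ℂ) V / (2 * Complex.I))) atTop
      (𝓝 (V / (2 * Complex.I))) := by
  have h0 : Tendsto (fun t : ℝ => Complex.exp (-(t * Complex.I)) ^ 2 *
      ((starRingEnd ℂ) (besselJAmplitude ν t) - (starRingEnd ℂ) V)) atTop (𝓝 0) := by
    have h1 : Tendsto (fun t : ℝ => ‖besselJAmplitude ν t - V‖) atTop (𝓝 0) := by
      simpa using (hV.sub_const V).norm
    refine squeeze_zero_norm (fun t => le_of_eq ?_) h1
    rw [norm_mul, norm_pow, ← conj_exp_mul_I, RCLike.norm_conj, Complex.norm_exp_ofReal_mul_I,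
      one_pow, one_mul, ← map_sub, RCLike.norm_conj]
  have h2 := (hV.sub h0).div_const (2 * Complex.I)
  rw [sub_zero] at h2
  refine h2.congr fun t => ?_
  rw [besselJ_mul_exp_neg_eq]
  ring

lemma tendsto_integral_exp_oscillating {g : ℝ → ℝ} :
    Tendsto (fun x : ℝ => ∫ t in Ioi (0 : ℝ),
      (g t : ℂ) * Complex.exp (-(((x * t : ℝ) : ℂ) * Complex.I)) ^ 2) atTop (𝓝 0) := by
  have h := Real.tendsto_integral_exp_smul_cocompact
    ((Ioi (0 : ℝ)).indicator fun t => (g t : ℂ))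
  have hx : Tendsto (fun x : ℝ => x / π) atTop (cocompact ℝ) :=
    (tendsto_id.atTop_div_const Real.pi_pos).mono_right atTop_le_cocompact
  refine (h.comp hx).congr fun x => ?_
  simp only [Function.comp_apply]
  rw [← integral_indicator measurableSet_Ioi]
  refine integral_congr_ae (ae_of_all _ fun t => ?_)
  by_cases ht : t ∈ Ioi (0 : ℝ)
  · simp only [indicator_of_mem ht]
    rw [Circle.smul_def, Real.fourierChar_apply, smul_eq_mul, mul_comm, ← Complex.exp_nat_mul]
    congr 2
    have : (π : ℂ) ≠ 0 := by exact_mod_cast Real.pi_ne_zero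
    push_cast
    field_simp
  · simp only [indicator_of_notMem ht, smul_zero]

lemma rpow_mul_besselLaplace_eq (ν : ℝ) {x : ℝ} (hx : 0 < x) :
    (((x ^ (ν + 1 / 2))⁻¹ : ℝ) : ℂ) * besselLaplace ν (((x⁻¹ : ℝ) : ℂ) + Complex.I) =
      ∫ t in Ioi (0 : ℝ), ((t ^ (ν - 1 / 2) * Real.exp (-t) : ℝ) : ℂ) *
        (((√(x * t) * besselJ ν (x * t) : ℝ) : ℂ) *
          Complex.exp (-(((x * t : ℝ) : ℂ) * Complex.I))) := by
  rw [besselLaplace_eq_scaled ν _ (inv_pos.mpr hx), inv_inv, ← mul_assoc, ← Complex.ofReal_mul,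
    ← integral_const_mul]
  refine setIntegral_congr_fun measurableSet_Ioi fun t ht => ?_
  have ht : 0 < t := ht
  have hx0 : (x : ℂ) ≠ 0 := by exact_mod_cast hx.ne'
  have he : Complex.exp (-((((x⁻¹ : ℝ) : ℂ) + Complex.I) * ((x * t : ℝ) : ℂ))) =
      ((Real.exp (-t) : ℝ) : ℂ) * Complex.exp (-(((x * t : ℝ) : ℂ) * Complex.I)) := by
    rw [Complex.ofReal_exp, ← Complex.exp_add]
    congr 1
    push_cast
    field_simp
    ring
  have hr : (x ^ (ν + 1 / 2))⁻¹ * x * (x * t) ^ ν = t ^ (ν - 1 / 2) * √(x * t) := by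
    rw [Real.sqrt_eq_rpow, Real.mul_rpow hx.le ht.le, Real.mul_rpow hx.le ht.le,
      Real.rpow_add hx, Real.rpow_sub ht]
    have h1 := (Real.rpow_pos_of_pos hx ν).ne'
    have h2 := (Real.rpow_pos_of_pos hx (1 / 2)).ne'
    have h3 := (Real.rpow_pos_of_pos ht (1 / 2)).ne'
    have h4 : x ^ (1 / 2 : ℝ) * x ^ (1 / 2 : ℝ) = x := by
      rw [← Real.rpow_add hx]; norm_num
    field_simp
    rw [pow_two, h4]
  rw [he]
  have hr' := congrArg (fun r : ℝ => (r : ℂ)) hr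
  push_cast at hr' ⊢
  linear_combination (besselJ ν (x * t) : ℂ) * (Complex.exp (-t) *
    Complex.exp (-((x : ℂ) * t * Complex.I))) * hr'

lemma tendsto_besselLaplace_add_I {ν : ℝ} (hν : 0 < ν) {V : ℂ}
    (hV : Tendsto (besselJAmplitude ν) atTop (𝓝 V)) :
    Tendsto (fun x : ℝ => (((x ^ (ν + 1 / 2))⁻¹ : ℝ) : ℂ) *
      besselLaplace ν (((x⁻¹ : ℝ) : ℂ) + Complex.I)) atTop
      (𝓝 (Real.Gamma (ν + 1 / 2) * (V / (2 * Complex.I)))) := by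
  obtain ⟨C, hC⟩ := exists_abs_sqrt_mul_besselJ_le hν.le
  set U : ℂ := (starRingEnd ℂ) V / (2 * Complex.I) with hU
  have hgint : IntegrableOn (fun t : ℝ => t ^ (ν - 1 / 2) * Real.exp (-t)) (Ioi 0) :=
    integrableOn_rpow_mul_exp_neg_self (by linarith)
  have hgcont : ContinuousOn (fun t : ℝ => ((t ^ (ν - 1 / 2) * Real.exp (-t) : ℝ) : ℂ))
      (Ioi 0) := Complex.continuous_ofReal.comp_continuousOn
    ((continuousOn_id.rpow_const fun _ ht => Or.inl (ne_of_gt ht)).mul (by fun_prop))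
  have hnorm : ∀ t : ℝ, ‖Complex.exp (-((t : ℂ) * Complex.I))‖ = 1 := fun t => by
    rw [← conj_exp_mul_I, RCLike.norm_conj, Complex.norm_exp_ofReal_mul_I]
  have hmap : ∀ x : ℝ, 0 < x → MapsTo (fun t => x * t) (Ioi 0) (Ioi 0) :=
    fun x hx t ht => mul_pos hx ht
  have hJcont : ∀ x : ℝ, 0 < x →
      ContinuousOn (fun t : ℝ => ((√(x * t) * besselJ ν (x * t) : ℝ) : ℂ)) (Ioi 0) :=
    fun x hx => Complex.continuous_ofReal.comp_continuousOn
      (ContinuousOn.mul (by fun_prop) ((continuousOn_besselJ ν).comp (by fun_prop) (hmap x hx)))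
  have hexp : ∀ x : ℝ, Continuous fun t : ℝ => Complex.exp (-(((x * t : ℝ) : ℂ) * Complex.I)) :=
    fun x => by fun_prop
  have hmain : Tendsto (fun x : ℝ => ∫ t in Ioi (0 : ℝ),
      ((t ^ (ν - 1 / 2) * Real.exp (-t) : ℝ) : ℂ) *
        (((√(x * t) * besselJ ν (x * t) : ℝ) : ℂ) *
          Complex.exp (-(((x * t : ℝ) : ℂ) * Complex.I)) +
          Complex.exp (-(((x * t : ℝ) : ℂ) * Complex.I)) ^ 2 * U)) atTop
      (𝓝 (∫ t in Ioi (0 : ℝ), ((t ^ (ν - 1 / 2) * Real.exp (-t) : ℝ) : ℂ) *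
        (V / (2 * Complex.I)))) := by
    refine tendsto_integral_filter_of_dominated_convergence
      (fun t => t ^ (ν - 1 / 2) * Real.exp (-t) * (C + ‖U‖)) ?_ ?_ (hgint.mul_const _) ?_
    · filter_upwards [eventually_gt_atTop 0] with x hx
      exact (hgcont.mul (((hJcont x hx).mul (hexp x).continuousOn).add
        (((hexp x).pow 2).mul continuous_const).continuousOn)).aestronglyMeasurable
        measurableSet_Ioi
    · filter_upwards [eventually_gt_atTop 0] with x hx
      refine (ae_restrict_iff' measurableSet_Ioi).mpr (ae_of_all _ fun t ht => ?_)
      have ht : 0 < t := ht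
      rw [norm_mul, Complex.norm_real, Real.norm_of_nonneg (by positivity)]
      refine mul_le_mul_of_nonneg_left ((norm_add_le _ _).trans ?_) (by positivity)
      rw [norm_mul, norm_mul, norm_pow, hnorm, one_pow, one_mul, mul_one, Complex.norm_real,
        Real.norm_eq_abs]
      exact add_le_add_left (hC (x * t) (by positivity)) _
    · refine (ae_restrict_iff' measurableSet_Ioi).mpr (ae_of_all _ fun t ht => ?_)
      have ht : 0 < t := ht
      exact ((tendsto_besselJ_mul_exp_neg_add hV).comp
        (tendsto_id.atTop_mul_const ht)).const_mul _
  have hosc := (tendsto_integral_exp_oscillating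
    (g := fun t => t ^ (ν - 1 / 2) * Real.exp (-t))).mul_const U
  have hval : ∫ t in Ioi (0 : ℝ), ((t ^ (ν - 1 / 2) * Real.exp (-t) : ℝ) : ℂ) *
        (V / (2 * Complex.I)) = Real.Gamma (ν + 1 / 2) * (V / (2 * Complex.I)) := by
    rw [integral_mul_const, integral_complex_ofReal, integral_rpow_mul_exp_neg (by linarith)]
    norm_num [sub_add]
  rw [hval] at hmain
  have h := hmain.sub hosc
  rw [zero_mul, sub_zero] at h
  refine h.congr' ?_
  filter_upwards [eventually_gt_atTop 0] with x hx
  rw [rpow_mul_besselLaplace_eq ν hx, ← integral_mul_const, ← integral_sub]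
  · refine integral_congr_ae (ae_of_all _ fun t => ?_)
    simp only
    ring
  · refine Integrable.mono' (hgint.mul_const (C + ‖U‖)) ((hgcont.mul
      (((hJcont x hx).mul (hexp x).continuousOn).add
        (((hexp x).pow 2).mul continuous_const).continuousOn)).aestronglyMeasurable
        measurableSet_Ioi)
      ((ae_restrict_iff' measurableSet_Ioi).mpr (ae_of_all _ fun t ht => ?_))
    have ht : 0 < t := ht
    rw [norm_mul, Complex.norm_real, Real.norm_of_nonneg (by positivity)]
    refine mul_le_mul_of_nonneg_left ((norm_add_le _ _).trans ?_) (by positivity)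
    rw [norm_mul, norm_mul, norm_pow, hnorm, one_pow, one_mul, mul_one, Complex.norm_real,
      Real.norm_eq_abs]
    exact add_le_add_left (hC (x * t) (by positivity)) _
  · refine Integrable.mono' (hgint.mul_const ‖U‖) ((hgcont.mul
      ((hexp x).pow 2).continuousOn).mul continuousOn_const |>.aestronglyMeasurable
        measurableSet_Ioi)
      ((ae_restrict_iff' measurableSet_Ioi).mpr (ae_of_all _ fun t ht => ?_))
    have ht : 0 < t := ht
    rw [norm_mul, norm_mul, norm_pow, hnorm, one_pow, mul_one, Complex.norm_real,
      Real.norm_of_nonneg (by positivity)]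

/-- The limiting amplitude of `besselJ ν`. -/
noncomputable def besselPhase (ν : ℝ) : ℂ :=
  ((√(2 / π) : ℝ) : ℂ) * Complex.exp (((π / 4 - π * ν / 2 : ℝ) : ℂ) * Complex.I)

lemma tendsto_besselJAmplitude_of_pos {ν : ℝ} (hν : 0 < ν) :
    Tendsto (besselJAmplitude ν) atTop (𝓝 (besselPhase ν)) := by
  obtain ⟨V, hV⟩ := (isBesselAmplitude_besselJAmplitude ν).exists_tendsto
  have h1 := tendsto_besselLaplace_add_I hν hV
  set b : ℝ := ν + 1 / 2 with hb
  have hb0 : 0 < b := by positivity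
  have hI0 : (2 : ℂ) * Complex.I ≠ 0 := by simp
  have h2 : Tendsto (fun x : ℝ => (((x⁻¹ : ℝ) : ℂ) + 2 * Complex.I) ^ (b : ℂ)) atTop
      (𝓝 ((2 * Complex.I) ^ (b : ℂ))) := by
    have h3 : Tendsto (fun x : ℝ => ((x⁻¹ : ℝ) : ℂ) + 2 * Complex.I) atTop
        (𝓝 (2 * Complex.I)) := by
      have := ((Complex.continuous_ofReal.tendsto 0).comp
        (tendsto_inv_atTop_zero (𝕜 := ℝ))).add_const (2 * Complex.I)
      simpa using this
    exact h3.cpow tendsto_const_nhds (Or.inr (by simp))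
  have h3 := h1.mul h2
  have h4 : Tendsto (fun _ : ℝ => ((2 ^ ν * Real.Gamma b / √π : ℝ) : ℂ)) atTop
      (𝓝 (Real.Gamma b * (V / (2 * Complex.I)) * (2 * Complex.I) ^ (b : ℂ))) := by
    refine h3.congr' ?_
    filter_upwards [eventually_gt_atTop 0] with x hx
    have hs : 0 < (((x⁻¹ : ℝ) : ℂ) + Complex.I).re := by simpa using hx
    rw [← besselLaplace_mul_cpow_eq hν hs]
    have hne : ((x⁻¹ : ℝ) : ℂ) + 2 * Complex.I ≠ 0 := by
      intro h
      simpa using congrArg Complex.im h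
    have hfac : 1 + (((x⁻¹ : ℝ) : ℂ) + Complex.I) ^ 2 =
        ((x⁻¹ : ℝ) : ℂ) * (((x⁻¹ : ℝ) : ℂ) + 2 * Complex.I) := by
      linear_combination Complex.I_sq
    have hxi : ((x⁻¹ : ℝ) : ℂ) ≠ 0 := by exact_mod_cast (inv_pos.mpr hx).ne'
    have hcp : (1 + (((x⁻¹ : ℝ) : ℂ) + Complex.I) ^ 2) ^ (b : ℂ) =
        (((x ^ b)⁻¹ : ℝ) : ℂ) * (((x⁻¹ : ℝ) : ℂ) + 2 * Complex.I) ^ (b : ℂ) := by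
      rw [hfac, Complex.cpow_def_of_ne_zero (mul_ne_zero hxi hne),
        Complex.log_ofReal_mul (inv_pos.mpr hx) hne, add_mul, Complex.exp_add,
        Complex.cpow_def_of_ne_zero hne, ← Real.inv_rpow hx.le,
        Real.rpow_def_of_pos (inv_pos.mpr hx)]
      push_cast
      rfl
    rw [hcp]
    ring
  have h5 := tendsto_nhds_unique tendsto_const_nhds h4
  have hG : (Real.Gamma b : ℂ) ≠ 0 := by exact_mod_cast (Real.Gamma_pos_of_pos hb0).ne'
  have hcp : (2 * Complex.I) ^ (b : ℂ) =
      ((2 ^ b : ℝ) : ℂ) * Complex.exp (((π / 2 * b : ℝ) : ℂ) * Complex.I) := by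
    have : (2 : ℂ) * Complex.I = ((2 : ℝ) : ℂ) * Complex.I := by norm_num
    rw [this, Complex.cpow_def_of_ne_zero (by simp),
      Complex.log_ofReal_mul two_pos Complex.I_ne_zero, Complex.log_I, add_mul, Complex.exp_add,
      Real.rpow_def_of_pos two_pos]
    push_cast
    congr 2
    ring
  have hV' : V = besselPhase ν := by
    rw [hcp] at h5
    have hpi : (√π : ℂ) ≠ 0 := by exact_mod_cast (Real.sqrt_pos.mpr Real.pi_pos).ne'
    have h2ν : ((2 ^ ν : ℝ) : ℂ) ≠ 0 := by
      exact_mod_cast (Real.rpow_pos_of_pos two_pos ν).ne'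
    have h2s : ((√2 : ℝ) : ℂ) ≠ 0 := by exact_mod_cast (Real.sqrt_pos.mpr two_pos).ne'
    have hsq : ((√2 : ℝ) : ℂ) * ((√2 : ℝ) : ℂ) = 2 := by
      exact_mod_cast Real.mul_self_sqrt zero_le_two
    have h2b : ((2 ^ b : ℝ) : ℂ) = ((2 ^ ν : ℝ) : ℂ) * ((√2 : ℝ) : ℂ) := by
      rw [hb, Real.rpow_add two_pos, ← Real.sqrt_eq_rpow, Complex.ofReal_mul]
    have hE : Complex.exp (((π / 4 - π * ν / 2 : ℝ) : ℂ) * Complex.I) *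
        Complex.exp (((π / 2 * b : ℝ) : ℂ) * Complex.I) = Complex.I := by
      rw [← Complex.exp_add]
      refine Eq.trans ?_ Complex.exp_pi_div_two_mul_I
      congr 1
      rw [hb]
      push_cast
      ring
    have hE0 := Complex.exp_ne_zero (((π / 2 * b : ℝ) : ℂ) * Complex.I)
    rw [besselPhase, Real.sqrt_div zero_le_two, Complex.ofReal_div]
    rw [h2b, Complex.ofReal_div, Complex.ofReal_mul] at h5
    generalize Complex.exp (((π / 2 * b : ℝ) : ℂ) * Complex.I) = E at *
    generalize ((2 ^ ν : ℝ) : ℂ) = P at *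
    generalize Complex.exp (((π / 4 - π * ν / 2 : ℝ) : ℂ) * Complex.I) = D at *
    field_simp at h5 ⊢
    have h6 : (V * (√π : ℂ) - ((√2 : ℝ) : ℂ) * D) * (((√2 : ℝ) : ℂ) * E) = 0 := by
      linear_combination -h5 - D * E * hsq - 2 * hE
    rcases mul_eq_zero.mp h6 with h | h
    · linear_combination h
    · exact absurd h (mul_ne_zero h2s hE0)
  rwa [hV'] at hV

lemma I_mul_besselPhase (ν : ℝ) : Complex.I * besselPhase ν = besselPhase (ν - 1) := by
  have h : Complex.exp (π / 2 * Complex.I) *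
      Complex.exp (((π / 4 - π * ν / 2 : ℝ) : ℂ) * Complex.I) =
      Complex.exp (((π / 4 - π * (ν - 1) / 2 : ℝ) : ℂ) * Complex.I) := by
    rw [← Complex.exp_add]
    congr 1
    push_cast
    ring
  rw [Complex.exp_pi_div_two_mul_I] at h
  rw [besselPhase, besselPhase, mul_left_comm, h]

lemma tendsto_besselJAmplitude (ν : ℝ) :
    Tendsto (besselJAmplitude ν) atTop (𝓝 (besselPhase ν)) := by
  have key : ∀ (n : ℕ) (μ : ℝ), 0 < μ + n →
      Tendsto (besselJAmplitude μ) atTop (𝓝 (besselPhase μ)) := by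
    intro n
    induction n with
    | zero => exact fun μ h => tendsto_besselJAmplitude_of_pos (by simpa using h)
    | succ n ih =>
      intro μ h
      have h1 := tendsto_besselJAmplitude_sub_one (ih (μ + 1) (by push_cast at h; linarith))
      rwa [I_mul_besselPhase, add_sub_cancel_right] at h1
  obtain ⟨n, hn⟩ := exists_nat_gt (-ν)
  exact key n ν (by linarith)

lemma besselPhase_neg (ν : ℝ) :
    besselPhase (-ν) = besselPhase ν * (Real.cos (ν * π) + Real.sin (ν * π) * Complex.I) := by
  rw [Complex.ofReal_cos, Complex.ofReal_sin, ← Complex.exp_mul_I, besselPhase, besselPhase,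
    mul_assoc, ← Complex.exp_add]
  congr 2
  push_cast
  ring

lemma besselPhase_mul_conj (μ ν : ℝ) :
    besselPhase ν * (starRingEnd ℂ) (besselPhase μ) =
      ((2 / π : ℝ) : ℂ) * (Real.cos (π * (μ - ν) / 2) + Real.sin (π * (μ - ν) / 2) * Complex.I) := by
  rw [besselPhase, besselPhase, map_mul, Complex.conj_ofReal, conj_exp_mul_I, mul_mul_mul_comm,
    ← Complex.ofReal_mul, Real.mul_self_sqrt (by positivity), ← Complex.exp_add,
    Complex.ofReal_cos, Complex.ofReal_sin, ← Complex.exp_mul_I]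
  congr 2
  push_cast
  ring

lemma re_besselPhase_mul_conj (μ ν : ℝ) :
    (besselPhase ν * (starRingEnd ℂ) (besselPhase μ)).re = 2 / π * Real.cos (π * (μ - ν) / 2) := by
  rw [besselPhase_mul_conj, Complex.re_ofReal_mul, Complex.add_re, Complex.re_ofReal_mul,
    Complex.ofReal_re, Complex.I_re, mul_zero, add_zero]

lemma im_besselPhase_mul_conj (μ ν : ℝ) :
    (besselPhase ν * (starRingEnd ℂ) (besselPhase μ)).im = 2 / π * Real.sin (π * (μ - ν) / 2) := by
  rw [besselPhase_mul_conj, Complex.im_ofReal_mul, Complex.add_im, Complex.im_ofReal_mul,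
    Complex.ofReal_im, Complex.I_im, mul_one, zero_add]

lemma norm_besselPhase (ν : ℝ) : ‖besselPhase ν‖ = √(2 / π) := by
  rw [besselPhase, norm_mul, Complex.norm_exp_ofReal_mul_I, mul_one, Complex.norm_real,
    Real.norm_of_nonneg (Real.sqrt_nonneg _)]

/-- The real numbers that are not integers. -/
def nonInteger : Set ℝ := {μ : ℝ | ∀ n : ℤ, μ ≠ (n : ℝ)}

lemma sin_mul_pi_ne_zero {μ : ℝ} (hμ : μ ∈ nonInteger) : Real.sin (μ * π) ≠ 0 := by
  rw [Real.sin_ne_zero_iff]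
  intro n h
  exact hμ n (mul_right_cancel₀ Real.pi_ne_zero h).symm

lemma eventually_mem_nonInteger (ν : ℝ) : ∀ᶠ μ in 𝓝[≠] ν, μ ∈ nonInteger := by
  have hc : IsClosed (((↑) : ℤ → ℝ) '' {n : ℤ | (n : ℝ) ≠ ν}) :=
    Int.isClosedEmbedding_coe_real.isClosedMap _ (isClosed_discrete _)
  have hν : ν ∉ ((↑) : ℤ → ℝ) '' {n : ℤ | (n : ℝ) ≠ ν} := by
    rintro ⟨n, hn, rfl⟩
    exact hn rfl
  filter_upwards [nhdsWithin_le_nhds (hc.isOpen_compl.mem_nhds hν), self_mem_nhdsWithin]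
    with μ h1 h2 n hn
  exact h1 ⟨n, fun h => h2 (hn.trans h), hn.symm⟩

instance neBot_nhdsWithin_nonInteger (ν : ℝ) : (𝓝[nonInteger] ν).NeBot :=
  Filter.NeBot.mono (f := 𝓝[≠] ν) inferInstance
    (le_inf nhdsWithin_le_nhds (le_principal_iff.mpr (eventually_mem_nonInteger ν)))

/-- The Bessel function of the second kind at non-integer order. -/
noncomputable def besselYQuotient (μ x : ℝ) : ℝ :=
  (besselJ μ x * Real.cos (μ * π) - besselJ (-μ) x) / Real.sin (μ * π)

/-- The amplitude of `besselYQuotient μ`. -/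
noncomputable def besselYAmplitude (μ t : ℝ) : ℂ :=
  (besselJAmplitude μ t * Real.cos (μ * π) - besselJAmplitude (-μ) t) / Real.sin (μ * π)

lemma im_exp_mul_besselYAmplitude (μ t : ℝ) :
    (Complex.exp (t * Complex.I) * besselYAmplitude μ t).im = √t * besselYQuotient μ t := by
  rw [besselYAmplitude, ← mul_div_assoc, Complex.div_ofReal_im, mul_sub, ← mul_assoc,
    Complex.sub_im, Complex.im_mul_ofReal, im_exp_mul_besselJAmplitude,
    im_exp_mul_besselJAmplitude, besselYQuotient]
  ring

lemma isBesselAmplitude_besselYAmplitude (μ : ℝ) :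
    IsBesselAmplitude μ (besselYAmplitude μ) := by
  intro t ht
  have h1 := isBesselAmplitude_besselJAmplitude μ t ht
  have h2 := isBesselAmplitude_besselJAmplitude (-μ) t ht
  refine (((h1.mul_const ((Real.cos (μ * π) : ℝ) : ℂ)).sub h2).div_const
    ((Real.sin (μ * π) : ℝ) : ℂ)).congr_deriv ?_
  rw [im_exp_mul_besselYAmplitude, im_exp_mul_besselJAmplitude, im_exp_mul_besselJAmplitude,
    besselYQuotient, neg_sq]
  push_cast
  ring

lemma tendsto_besselYAmplitude {μ : ℝ} (hμ : μ ∈ nonInteger) :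
    Tendsto (besselYAmplitude μ) atTop (𝓝 (-Complex.I * besselPhase μ)) := by
  have h := (((tendsto_besselJAmplitude μ).mul_const ((Real.cos (μ * π) : ℝ) : ℂ)).sub
    (tendsto_besselJAmplitude (-μ))).div_const ((Real.sin (μ * π) : ℝ) : ℂ)
  have hs : ((Real.sin (μ * π) : ℝ) : ℂ) ≠ 0 := by exact_mod_cast sin_mul_pi_ne_zero hμ
  have hlim : -Complex.I * besselPhase μ = (besselPhase μ * ((Real.cos (μ * π) : ℝ) : ℂ) -
      besselPhase (-μ)) / ((Real.sin (μ * π) : ℝ) : ℂ) := by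
    rw [besselPhase_neg, eq_div_iff hs]
    ring
  rw [hlim]
  exact h

lemma setIntegral_sqrt_mul_sqrt_div_sq (f g : ℝ → ℝ) {z : ℝ} (hz : 0 < z) :
    ∫ t in Ioi z, (√t * f t) * (√t * g t) / t ^ 2 = ∫ t in Ioi z, f t * g t / t := by
  refine setIntegral_congr_fun measurableSet_Ioi fun t ht => ?_
  have ht : 0 < t := hz.trans ht
  have h := Real.mul_self_sqrt ht.le
  have : (√t * f t) * (√t * g t) = t * (f t * g t) := by
    linear_combination (f t * g t) * h
  rw [this]
  field_simp

lemma besselAmplitude_expansion {μ ν : ℝ} {f : ℝ → ℝ} {v : ℝ → ℂ} {V : ℂ}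
    (hν : ν ∈ nonInteger) (hv : IsBesselAmplitude μ v) (hV : Tendsto v atTop (𝓝 V))
    (hf : ∀ t : ℝ, (Complex.exp (t * Complex.I) * v t).im = √t * f t) {z : ℝ} (hz : 0 < z) :
    f z * (2 / π) =
      besselYQuotient ν z * ((besselPhase ν * (starRingEnd ℂ) V).im
        - (μ ^ 2 - ν ^ 2) * ∫ t in Ioi z, f t * besselJ ν t / t) +
      besselJ ν z * ((besselPhase ν * (starRingEnd ℂ) V).re
        + (μ ^ 2 - ν ^ 2) * ∫ t in Ioi z, f t * besselYQuotient ν t / t) := by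
  have hJ := isBesselAmplitude_besselJAmplitude ν
  have hY := isBesselAmplitude_besselYAmplitude ν
  have hJl := tendsto_besselJAmplitude ν
  have hYl := tendsto_besselYAmplitude hν
  have h := IsBesselAmplitude.im_mul_cross (Complex.exp (z * Complex.I)) (besselJAmplitude ν z)
    (besselYAmplitude ν z) (v z)
  have h1 := hY.pairing_eq hJ hYl hJl hz
  have h2 := hv.pairing_eq hY hV hYl hz
  have h3 := hv.pairing_eq hJ hV hJl hz
  have h4 : (v z * (starRingEnd ℂ) (besselJAmplitude ν z)).im =
      -(besselJAmplitude ν z * (starRingEnd ℂ) (v z)).im := by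
    simp only [Complex.mul_im, Complex.conj_re, Complex.conj_im]
    ring
  have h5 : (besselPhase ν * (starRingEnd ℂ) (-Complex.I * besselPhase ν)).im = 2 / π := by
    have := re_besselPhase_mul_conj ν ν
    rw [sub_self, mul_zero, zero_div, Real.cos_zero, mul_one] at this
    rw [← this]
    simp
  have h6 : (-Complex.I * besselPhase ν * (starRingEnd ℂ) V).im =
      -(besselPhase ν * (starRingEnd ℂ) V).re := by
    rw [mul_assoc]
    simp
  simp only [im_exp_mul_besselJAmplitude, im_exp_mul_besselYAmplitude, hf] at h h1 h2 h3
  rw [setIntegral_sqrt_mul_sqrt_div_sq _ _ hz] at h2 h3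
  rw [h5, sub_self, zero_mul, sub_zero] at h1
  rw [h6] at h2
  rw [h1, h2, h4, h3] at h
  have hs : √z ≠ 0 := (Real.sqrt_pos.mpr hz).ne'
  refine mul_left_cancel₀ hs ?_
  linear_combination h

lemma besselYQuotient_expansion {μ ν : ℝ} (hμ : μ ∈ nonInteger) (hν : ν ∈ nonInteger) {z : ℝ}
    (hz : 0 < z) :
    besselYQuotient μ z =
      besselYQuotient ν z * (Real.cos (π * (μ - ν) / 2)
        - π / 2 * ((μ ^ 2 - ν ^ 2) * ∫ t in Ioi z, besselYQuotient μ t * besselJ ν t / t)) -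
      besselJ ν z * (Real.sin (π * (μ - ν) / 2)
        - π / 2 * ((μ ^ 2 - ν ^ 2) * ∫ t in Ioi z, besselYQuotient μ t * besselYQuotient ν t /
          t)) := by
  have h := besselAmplitude_expansion hν (isBesselAmplitude_besselYAmplitude μ)
    (tendsto_besselYAmplitude hμ) (im_exp_mul_besselYAmplitude μ) hz
  have h1 : besselPhase ν * (starRingEnd ℂ) (-Complex.I * besselPhase μ) =
      Complex.I * (besselPhase ν * (starRingEnd ℂ) (besselPhase μ)) := by
    simp only [map_mul, map_neg, Complex.conj_I]
    ring
  rw [h1, Complex.I_mul_im, Complex.I_mul_re, re_besselPhase_mul_conj,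
    im_besselPhase_mul_conj] at h
  have hpi := Real.pi_ne_zero
  field_simp at h ⊢
  linear_combination h

lemma besselJ_expansion {μ ν : ℝ} (hν : ν ∈ nonInteger) {z : ℝ} (hz : 0 < z) :
    besselJ μ z =
      besselJ ν z * (Real.cos (π * (μ - ν) / 2)
        + π / 2 * ((μ ^ 2 - ν ^ 2) * ∫ t in Ioi z, besselJ μ t * besselYQuotient ν t / t)) +
      besselYQuotient ν z * (Real.sin (π * (μ - ν) / 2)
        - π / 2 * ((μ ^ 2 - ν ^ 2) * ∫ t in Ioi z, besselJ μ t * besselJ ν t / t)) := by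
  have h := besselAmplitude_expansion hν (isBesselAmplitude_besselJAmplitude μ)
    (tendsto_besselJAmplitude μ) (im_exp_mul_besselJAmplitude μ) hz
  rw [re_besselPhase_mul_conj, im_besselPhase_mul_conj] at h
  have hpi := Real.pi_ne_zero
  field_simp at h ⊢
  linear_combination h

/-- A uniform bound, on `[z, ∞)` and for orders in `[-M, M]`, for the Bessel functions
multiplied by the square root of the argument. -/
noncomputable def besselBound (M z : ℝ) : ℝ := √(2 / π) * Real.exp ((M ^ 2 + 1 / 4) / z)

lemma IsBesselAmplitude.abs_le_besselBound {μ M z t : ℝ} {v : ℝ → ℂ} {V : ℂ}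
    (hv : IsBesselAmplitude μ v) (hV : Tendsto v atTop (𝓝 V)) (hVn : ‖V‖ = √(2 / π))
    (hμ : |μ| ≤ M) (hz : 0 < z) (ht : z ≤ t) :
    |(Complex.exp (t * Complex.I) * v t).im| ≤ besselBound M z := by
  refine (hv.abs_im_le hV (hz.trans_le ht)).trans ?_
  rw [hVn, besselBound]
  have h1 : |μ ^ 2 - 1 / 4| ≤ M ^ 2 + 1 / 4 := by
    have := sq_le_sq' (abs_le.mp hμ).1 (abs_le.mp hμ).2
    rw [abs_le]
    constructor <;> nlinarith [sq_nonneg μ, sq_nonneg M]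
  gcongr

lemma abs_sqrt_mul_besselJ_le {μ M z t : ℝ} (hμ : |μ| ≤ M) (hz : 0 < z) (ht : z ≤ t) :
    |√t * besselJ μ t| ≤ besselBound M z := by
  rw [← im_exp_mul_besselJAmplitude]
  exact (isBesselAmplitude_besselJAmplitude μ).abs_le_besselBound (tendsto_besselJAmplitude μ)
    (norm_besselPhase μ) hμ hz ht

lemma abs_sqrt_mul_besselYQuotient_le {μ M z t : ℝ} (hμN : μ ∈ nonInteger) (hμ : |μ| ≤ M)
    (hz : 0 < z) (ht : z ≤ t) : |√t * besselYQuotient μ t| ≤ besselBound M z := by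
  rw [← im_exp_mul_besselYAmplitude]
  exact (isBesselAmplitude_besselYAmplitude μ).abs_le_besselBound (tendsto_besselYAmplitude hμN)
    (by simp [norm_besselPhase μ]) hμ hz ht

lemma abs_mul_div_le {a b B t : ℝ} (ht : 0 < t) (ha : |√t * a| ≤ B) (hb : |√t * b| ≤ B) :
    |a * b / t| ≤ B ^ 2 * (1 / t ^ 2) := by
  have h := mul_le_mul ha hb (abs_nonneg _) ((abs_nonneg _).trans ha)
  rw [← abs_mul, mul_mul_mul_comm, Real.mul_self_sqrt ht.le, abs_mul, abs_of_pos ht] at h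
  rw [abs_div, abs_of_pos ht, mul_one_div, div_le_div_iff₀ ht (by positivity)]
  nlinarith

lemma abs_setIntegral_mul_div_le {f g : ℝ → ℝ} {B z : ℝ} (hz : 0 < z)
    (hf : ∀ t, z ≤ t → |√t * f t| ≤ B) (hg : ∀ t, z ≤ t → |√t * g t| ≤ B) :
    |∫ t in Ioi z, f t * g t / t| ≤ ∫ t in Ioi z, B ^ 2 * (1 / t ^ 2) := by
  rw [← Real.norm_eq_abs]
  refine norm_integral_le_of_norm_le ((IsBesselAmplitude.integrableOn_inv_sq hz).const_mul _)
    ((ae_restrict_iff' measurableSet_Ioi).mpr (ae_of_all _ fun t ht => ?_))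
  have ht : z < t := ht
  exact abs_mul_div_le (hz.trans ht) (hf t ht.le) (hg t ht.le)

lemma abs_expansion_sub_le {j y p q D K M μ ν : ℝ} (hj : |j| ≤ D) (hy : |y| ≤ D) (hp : |p| ≤ K)
    (hq : |q| ≤ K) (hμ : |μ| ≤ M) (hν : |ν| ≤ M) :
    |y * (Real.cos (π * (μ - ν) / 2) - π / 2 * ((μ ^ 2 - ν ^ 2) * p)) -
      j * (Real.sin (π * (μ - ν) / 2) - π / 2 * ((μ ^ 2 - ν ^ 2) * q)) - y| ≤
      π * D * (1 + 2 * M * K) * |μ - ν| := by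
  have hpi := Real.pi_pos
  have hD : 0 ≤ D := (abs_nonneg _).trans hj
  have hK : 0 ≤ K := (abs_nonneg _).trans hp
  set x : ℝ := π * (μ - ν) / 2 with hx
  have hxa : |x| = π / 2 * |μ - ν| := by
    rw [hx, mul_div_right_comm, abs_mul, abs_of_pos (by positivity)]
  have hs : |Real.sin x| ≤ |x| := Real.abs_sin_le_abs
  have hc : |Real.cos x - 1| ≤ |x| := by
    have := Real.abs_cos_sub_cos_le x 0
    simpa using this
  have hd : |μ ^ 2 - ν ^ 2| ≤ 2 * M * |μ - ν| := by
    rw [show μ ^ 2 - ν ^ 2 = (μ + ν) * (μ - ν) by ring, abs_mul]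
    have := (abs_add_le μ ν).trans (add_le_add hμ hν)
    exact mul_le_mul_of_nonneg_right (by linarith) (abs_nonneg _)
  have hM : 0 ≤ M := (abs_nonneg _).trans hμ
  rw [show y * (Real.cos x - π / 2 * ((μ ^ 2 - ν ^ 2) * p)) -
      j * (Real.sin x - π / 2 * ((μ ^ 2 - ν ^ 2) * q)) - y =
      (y * (Real.cos x - 1) + -(j * Real.sin x)) + (-(π / 2 * (y * (μ ^ 2 - ν ^ 2) * p)) +
        π / 2 * (j * (μ ^ 2 - ν ^ 2) * q)) by ring]
  have e1 : |y * (Real.cos x - 1)| ≤ D * (π / 2 * |μ - ν|) := by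
    rw [abs_mul, ← hxa]; gcongr
  have e2 : |-(j * Real.sin x)| ≤ D * (π / 2 * |μ - ν|) := by
    rw [abs_neg, abs_mul, ← hxa]; gcongr
  have e3 : |-(π / 2 * (y * (μ ^ 2 - ν ^ 2) * p))| ≤ π / 2 * (D * (2 * M * |μ - ν|) * K) := by
    rw [abs_neg, abs_mul, abs_mul, abs_mul, abs_of_pos (by positivity : 0 < π / 2)]; gcongr
  have e4 : |π / 2 * (j * (μ ^ 2 - ν ^ 2) * q)| ≤ π / 2 * (D * (2 * M * |μ - ν|) * K) := by
    rw [abs_mul, abs_mul, abs_mul, abs_of_pos (by positivity : 0 < π / 2)]; gcongr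
  calc _ ≤ _ := (abs_add_le _ _).trans (add_le_add (abs_add_le _ _) (abs_add_le _ _))
    _ ≤ _ := add_le_add (add_le_add e1 e2) (add_le_add e3 e4)
    _ = _ := by ring

lemma abs_le_div_sqrt {a B t : ℝ} (ht : 0 < t) (h : |√t * a| ≤ B) : |a| ≤ B / √t := by
  rw [abs_mul, abs_of_nonneg (Real.sqrt_nonneg t)] at h
  rw [le_div_iff₀ (Real.sqrt_pos.mpr ht)]
  linarith

lemma exists_abs_besselYQuotient_sub_le (M : ℝ) {z : ℝ} (hz : 0 < z) :
    ∃ C, ∀ μ ν : ℝ, μ ∈ nonInteger → ν ∈ nonInteger → |μ| ≤ M → |ν| ≤ M →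
      |besselYQuotient μ z - besselYQuotient ν z| ≤ C * |μ - ν| := by
  refine ⟨π * (besselBound M z / √z) *
    (1 + 2 * M * ∫ t in Ioi z, besselBound M z ^ 2 * (1 / t ^ 2)),
    fun μ ν hμN hνN hμ hν => ?_⟩
  rw [besselYQuotient_expansion hμN hνN hz]
  exact abs_expansion_sub_le
    (abs_le_div_sqrt hz (abs_sqrt_mul_besselJ_le hν hz le_rfl))
    (abs_le_div_sqrt hz (abs_sqrt_mul_besselYQuotient_le hνN hν hz le_rfl))
    (abs_setIntegral_mul_div_le hz (fun t ht => abs_sqrt_mul_besselYQuotient_le hμN hμ hz ht)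
      fun t ht => abs_sqrt_mul_besselJ_le hν hz ht)
    (abs_setIntegral_mul_div_le hz (fun t ht => abs_sqrt_mul_besselYQuotient_le hμN hμ hz ht)
      fun t ht => abs_sqrt_mul_besselYQuotient_le hνN hν hz ht) hμ hν

lemma exists_abs_besselJ_sub_le (M : ℝ) {z : ℝ} (hz : 0 < z) :
    ∃ C, ∀ μ ν : ℝ, ν ∈ nonInteger → |μ| ≤ M → |ν| ≤ M →
      |besselJ μ z - besselJ ν z| ≤ C * |μ - ν| := by
  refine ⟨π * (besselBound M z / √z) *
    (1 + 2 * M * ∫ t in Ioi z, besselBound M z ^ 2 * (1 / t ^ 2)),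
    fun μ ν hνN hμ hν => ?_⟩
  have h := abs_expansion_sub_le
    (j := -besselYQuotient ν z) (y := besselJ ν z)
    (p := -∫ t in Ioi z, besselJ μ t * besselYQuotient ν t / t)
    (q := ∫ t in Ioi z, besselJ μ t * besselJ ν t / t)
    ((abs_neg _).trans_le (abs_le_div_sqrt hz
      (abs_sqrt_mul_besselYQuotient_le hνN hν hz le_rfl)))
    (abs_le_div_sqrt hz (abs_sqrt_mul_besselJ_le hν hz le_rfl))
    ((abs_neg _).trans_le (abs_setIntegral_mul_div_le hz
      (fun t ht => abs_sqrt_mul_besselJ_le hμ hz ht)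
      fun t ht => abs_sqrt_mul_besselYQuotient_le hνN hν hz ht))
    (abs_setIntegral_mul_div_le hz (fun t ht => abs_sqrt_mul_besselJ_le hμ hz ht)
      fun t ht => abs_sqrt_mul_besselJ_le hν hz ht) hμ hν
  refine le_of_eq_of_le (congrArg abs ?_) h
  conv_lhs => rw [besselJ_expansion (μ := μ) hνN hz]
  ring

lemma tendsto_besselJ_order (ν : ℝ) {z : ℝ} (hz : 0 < z) :
    Tendsto (fun μ => besselJ μ z) (𝓝[nonInteger] ν) (𝓝 (besselJ ν z)) := by
  obtain ⟨C, hC⟩ := exists_abs_besselJ_sub_le (|ν| + 1) hz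
  rw [tendsto_iff_norm_sub_tendsto_zero]
  have h0 : Tendsto (fun μ : ℝ => C * |ν - μ|) (𝓝[nonInteger] ν) (𝓝 0) := by
    have : Continuous fun μ : ℝ => C * |ν - μ| := by fun_prop
    simpa using (this.tendsto ν).mono_left nhdsWithin_le_nhds
  refine squeeze_zero' (Eventually.of_forall fun μ => norm_nonneg _) ?_ h0
  have hM : ∀ᶠ μ : ℝ in 𝓝[nonInteger] ν, |μ| < |ν| + 1 :=
    nhdsWithin_le_nhds (continuous_abs.continuousAt.eventually_lt_const (lt_add_one |ν|))
  filter_upwards [self_mem_nhdsWithin, hM] with μ hμN hμ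
  rw [norm_sub_rev]
  exact hC ν μ hμN (by linarith) hμ.le

lemma exists_continuous_besselY_eq (M : ℝ) {z : ℝ} (hz : 0 < z) :
    ∃ g : ℝ → ℝ, Continuous g ∧ (∀ ν, |ν| < M → besselY ν z = g ν) ∧
      ∀ ν ∈ nonInteger, |ν| < M → besselYQuotient ν z = g ν := by
  obtain ⟨C, hC⟩ := exists_abs_besselYQuotient_sub_le M hz
  have hL : LipschitzOnWith C.toNNReal (fun μ => besselYQuotient μ z)
      (nonInteger ∩ {μ | |μ| < M}) := by
    refine LipschitzOnWith.of_dist_le_mul fun μ hμ ν hν => ?_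
    rw [Real.dist_eq, Real.dist_eq]
    refine (hC μ ν hμ.1 hν.1 (le_of_lt hμ.2) (le_of_lt hν.2)).trans ?_
    exact mul_le_mul_of_nonneg_right (Real.le_coe_toNNReal C) (abs_nonneg _)
  obtain ⟨g, hg, hgeq⟩ := hL.extend_real
  refine ⟨g, hg.continuous, fun ν hν => ?_, fun ν hνN hν => hgeq ⟨hνN, hν⟩⟩
  refine Tendsto.limUnder_eq (f := 𝓝[nonInteger] ν)
    (((hg.continuous.tendsto ν).mono_left nhdsWithin_le_nhds).congr' ?_)
  filter_upwards [self_mem_nhdsWithin, nhdsWithin_le_nhds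
    (continuous_abs.continuousAt.eventually_lt_const hν)] with μ hμN hμ
  exact (hgeq ⟨hμN, hμ⟩).symm

lemma besselY_eq_besselYQuotient {ν z : ℝ} (hν : ν ∈ nonInteger) (hz : 0 < z) :
    besselY ν z = besselYQuotient ν z := by
  obtain ⟨g, -, h1, h2⟩ := exists_continuous_besselY_eq (|ν| + 1) hz
  rw [h1 ν (lt_add_one _), h2 ν hν (lt_add_one _)]

lemma continuous_besselY_order {z : ℝ} (hz : 0 < z) : Continuous fun ν => besselY ν z := by
  refine continuous_iff_continuousAt.mpr fun ν => ?_
  obtain ⟨g, hg, h1, -⟩ := exists_continuous_besselY_eq (|ν| + 1) hz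
  refine hg.continuousAt.congr ?_
  filter_upwards [continuous_abs.continuousAt.eventually_lt_const (lt_add_one |ν|)] with μ hμ
  exact (h1 μ hμ).symm

lemma abs_sqrt_mul_besselY_le {μ M z t : ℝ} (hμ : |μ| < M) (hz : 0 < z) (ht : z ≤ t) :
    |√t * besselY μ t| ≤ besselBound M z := by
  have ht0 := hz.trans_le ht
  have h : Tendsto (fun κ => |√t * besselY κ t|) (𝓝[nonInteger] μ) (𝓝 |√t * besselY μ t|) :=
    (((continuous_besselY_order ht0).const_mul √t).abs.tendsto μ).mono_left nhdsWithin_le_nhds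
  refine le_of_tendsto h ?_
  filter_upwards [self_mem_nhdsWithin, nhdsWithin_le_nhds
    (continuous_abs.continuousAt.eventually_lt_const hμ)] with κ hκN hκ
  rw [besselY_eq_besselYQuotient hκN ht0]
  exact abs_sqrt_mul_besselYQuotient_le hκN hκ.le hz ht

lemma aestronglyMeasurable_besselJ (ν : ℝ) {z : ℝ} (hz : 0 < z) :
    AEStronglyMeasurable (besselJ ν) (volume.restrict (Ioi z)) :=
  ((continuousOn_besselJ ν).mono (Ioi_subset_Ioi hz.le)).aestronglyMeasurable measurableSet_Ioi

lemma aestronglyMeasurable_besselY (ν : ℝ) {z : ℝ} (hz : 0 < z) :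
    AEStronglyMeasurable (besselY ν) (volume.restrict (Ioi z)) := by
  refine aestronglyMeasurable_of_tendsto_ae (𝓝[nonInteger] ν) (f := besselYQuotient)
    (fun μ => ?_) ((ae_restrict_iff' measurableSet_Ioi).mpr (ae_of_all _ fun t ht => ?_))
  · have h := (((aestronglyMeasurable_besselJ μ hz).mul_const (Real.cos (μ * π))).sub
      (aestronglyMeasurable_besselJ (-μ) hz)).mul_const (Real.sin (μ * π))⁻¹
    exact h
  · have ht : 0 < t := hz.trans ht
    refine (((continuous_besselY_order ht).tendsto ν).mono_left nhdsWithin_le_nhds).congr' ?_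
    filter_upwards [self_mem_nhdsWithin] with μ hμ
    exact besselY_eq_besselYQuotient hμ ht

lemma tendsto_setIntegral_mul_div {l : Filter ℝ} [l.IsCountablyGenerated] {F G : ℝ → ℝ → ℝ}
    {f g : ℝ → ℝ} {B z : ℝ} (hz : 0 < z)
    (hFm : ∀ᶠ μ in l, AEStronglyMeasurable (F μ) (volume.restrict (Ioi z)))
    (hGm : ∀ᶠ μ in l, AEStronglyMeasurable (G μ) (volume.restrict (Ioi z)))
    (hF : ∀ᶠ μ in l, ∀ t, z ≤ t → |√t * F μ t| ≤ B)
    (hG : ∀ᶠ μ in l, ∀ t, z ≤ t → |√t * G μ t| ≤ B)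
    (hFl : ∀ t, 0 < t → Tendsto (fun μ => F μ t) l (𝓝 (f t)))
    (hGl : ∀ t, 0 < t → Tendsto (fun μ => G μ t) l (𝓝 (g t))) :
    Tendsto (fun μ => ∫ t in Ioi z, F μ t * G μ t / t) l (𝓝 (∫ t in Ioi z, f t * g t / t)) := by
  refine tendsto_integral_filter_of_dominated_convergence (fun t => B ^ 2 * (1 / t ^ 2)) ?_ ?_
    ((IsBesselAmplitude.integrableOn_inv_sq hz).const_mul _) ?_
  · filter_upwards [hFm, hGm] with μ h1 h2
    exact (h1.mul h2).mul (measurable_inv.aestronglyMeasurable)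
  · filter_upwards [hF, hG] with μ h1 h2
    refine (ae_restrict_iff' measurableSet_Ioi).mpr (ae_of_all _ fun t ht => ?_)
    have ht : z < t := ht
    exact abs_mul_div_le (hz.trans ht) (h1 t ht.le) (h2 t ht.le)
  · refine (ae_restrict_iff' measurableSet_Ioi).mpr (ae_of_all _ fun t ht => ?_)
    exact ((hFl t (hz.trans ht)).mul (hGl t (hz.trans ht))).div_const t

lemma besselY_expansion {μ : ℝ} (ν : ℝ) (hμ : μ ∈ nonInteger) {z : ℝ} (hz : 0 < z) :
    besselY μ z =
      besselY ν z * (Real.cos (π * (μ - ν) / 2)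
        - π / 2 * ((μ ^ 2 - ν ^ 2) * ∫ t in Ioi z, besselY μ t * besselJ ν t / t)) -
      besselJ ν z * (Real.sin (π * (μ - ν) / 2)
        - π / 2 * ((μ ^ 2 - ν ^ 2) * ∫ t in Ioi z, besselY μ t * besselY ν t / t)) := by
  set M : ℝ := |μ| + |ν| + 1 with hM
  have hμM : |μ| < M := by rw [hM]; linarith [abs_nonneg ν]
  have hνM : |ν| < M := by rw [hM]; linarith [abs_nonneg μ]
  have hev : ∀ᶠ κ : ℝ in 𝓝[nonInteger] ν, |κ| < M :=
    nhdsWithin_le_nhds (continuous_abs.continuousAt.eventually_lt_const hνM)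
  have hY : ∀ t : ℝ, 0 < t →
      Tendsto (fun κ => besselY κ t) (𝓝[nonInteger] ν) (𝓝 (besselY ν t)) := fun t ht =>
    ((continuous_besselY_order ht).tendsto ν).mono_left nhdsWithin_le_nhds
  have hJ : ∀ t : ℝ, 0 < t →
      Tendsto (fun κ => besselJ κ t) (𝓝[nonInteger] ν) (𝓝 (besselJ ν t)) := fun t ht =>
    tendsto_besselJ_order ν ht
  have hYb : ∀ᶠ κ : ℝ in 𝓝[nonInteger] ν, ∀ t, z ≤ t → |√t * besselY κ t| ≤ besselBound M z := by
    filter_upwards [hev] with κ hκ t ht using abs_sqrt_mul_besselY_le hκ hz ht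
  have hJb : ∀ᶠ κ : ℝ in 𝓝[nonInteger] ν, ∀ t, z ≤ t → |√t * besselJ κ t| ≤ besselBound M z := by
    filter_upwards [hev] with κ hκ t ht using abs_sqrt_mul_besselJ_le hκ.le hz ht
  have hI1 := tendsto_setIntegral_mul_div (F := fun _ => besselY μ) (G := besselJ) hz
    (Eventually.of_forall fun κ => aestronglyMeasurable_besselY μ hz)
    (Eventually.of_forall fun κ => aestronglyMeasurable_besselJ κ hz)
    (Eventually.of_forall fun κ t ht => abs_sqrt_mul_besselY_le hμM hz ht) hJb
    (fun t _ => tendsto_const_nhds) hJ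
  have hI2 := tendsto_setIntegral_mul_div (F := fun _ => besselY μ) (G := besselY) hz
    (Eventually.of_forall fun κ => aestronglyMeasurable_besselY μ hz)
    (Eventually.of_forall fun κ => aestronglyMeasurable_besselY κ hz)
    (Eventually.of_forall fun κ t ht => abs_sqrt_mul_besselY_le hμM hz ht) hYb
    (fun t _ => tendsto_const_nhds) hY
  have hlim : ∀ {h : ℝ → ℝ}, Continuous h → Tendsto h (𝓝[nonInteger] ν) (𝓝 (h ν)) :=
    fun hh => (hh.tendsto ν).mono_left nhdsWithin_le_nhds
  have hcos := hlim (h := fun κ => Real.cos (π * (μ - κ) / 2)) (by fun_prop)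
  have hsin := hlim (h := fun κ => Real.sin (π * (μ - κ) / 2)) (by fun_prop)
  have hsq := hlim (h := fun κ => μ ^ 2 - κ ^ 2) (by fun_prop)
  have hmain := ((hY z hz).mul (hcos.sub ((hsq.mul hI1).const_mul (π / 2)))).sub
    ((hJ z hz).mul (hsin.sub ((hsq.mul hI2).const_mul (π / 2))))
  refine tendsto_nhds_unique (tendsto_const_nhds.congr' ?_) hmain
  filter_upwards [self_mem_nhdsWithin] with κ hκ
  have hQ : ∀ {κ}, κ ∈ nonInteger → ∀ h : ℝ → ℝ → ℝ, ∫ t in Ioi z, h (besselY κ t) t / t =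
      ∫ t in Ioi z, h (besselYQuotient κ t) t / t := fun hκ h =>
    setIntegral_congr_fun measurableSet_Ioi fun t ht => by
      simp only [besselY_eq_besselYQuotient hκ (hz.trans ht)]
  rw [hQ hμ fun y t => y * besselJ κ t, hQ hμ fun y t => y * besselY κ t,
    hQ hκ fun y t => besselYQuotient μ t * y, besselY_eq_besselYQuotient hμ hz,
    besselY_eq_besselYQuotient hκ hz]
  exact besselYQuotient_expansion hμ hκ hz

lemma tendsto_setIntegral_besselY_mul (ν : ℝ) {g : ℝ → ℝ} {z : ℝ} (hz : 0 < z)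
    (hgm : AEStronglyMeasurable g (volume.restrict (Ioi z)))
    (hg : ∀ t, z ≤ t → |√t * g t| ≤ besselBound (|ν| + 1) z) :
    Tendsto (fun μ => ∫ t in Ioi z, besselY μ t * g t / t) (𝓝 ν)
      (𝓝 (∫ t in Ioi z, besselY ν t * g t / t)) := by
  refine tendsto_setIntegral_mul_div (G := fun _ => g) hz
    (Eventually.of_forall fun κ => aestronglyMeasurable_besselY κ hz)
    (Eventually.of_forall fun _ => hgm) ?_ (Eventually.of_forall fun _ => hg)
    (fun t ht => (continuous_besselY_order ht).tendsto ν) fun t _ => tendsto_const_nhds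
  filter_upwards [continuous_abs.continuousAt.eventually_lt_const (lt_add_one |ν|)]
    with μ hμ t ht using abs_sqrt_mul_besselY_le hμ hz ht

lemma hasDerivAt_sq_sub_sq_mul {h : ℝ → ℝ} {ν : ℝ} (hh : ContinuousAt h ν) :
    HasDerivAt (fun μ => (μ ^ 2 - ν ^ 2) * h μ) (2 * ν * h ν) ν := by
  rw [hasDerivAt_iff_tendsto_slope]
  have h1 : Tendsto (fun μ => (μ + ν) * h μ) (𝓝[≠] ν) (𝓝 ((ν + ν) * h ν)) :=
    (((continuousAt_id.add continuousAt_const).mul hh).tendsto).mono_left nhdsWithin_le_nhds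
  rw [two_mul]
  refine h1.congr' ?_
  filter_upwards [self_mem_nhdsWithin] with μ hμ
  have : μ - ν ≠ 0 := sub_ne_zero.mpr hμ
  rw [slope_def_field, sub_self, zero_mul, sub_zero, eq_div_iff this]
  ring

lemma hasDerivAt_besselY_order (ν : ℝ) {z : ℝ} (hz : 0 < z) :
    HasDerivAt (fun μ => besselY μ z)
      (ν * π * besselJ ν z * (∫ t in Ioi z, besselY ν t ^ 2 / t)
        - ν * π * besselY ν z * (∫ t in Ioi z, besselJ ν t * besselY ν t / t)
        - π / 2 * besselJ ν z) ν := by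
  have hI1 : HasDerivAt
      (fun μ => (μ ^ 2 - ν ^ 2) * ∫ t in Ioi z, besselY μ t * besselJ ν t / t) _ ν :=
    hasDerivAt_sq_sub_sq_mul (tendsto_setIntegral_besselY_mul ν hz
      (aestronglyMeasurable_besselJ ν hz)
      fun t ht => abs_sqrt_mul_besselJ_le (lt_add_one |ν|).le hz ht)
  have hI2 : HasDerivAt
      (fun μ => (μ ^ 2 - ν ^ 2) * ∫ t in Ioi z, besselY μ t * besselY ν t / t) _ ν :=
    hasDerivAt_sq_sub_sq_mul (tendsto_setIntegral_besselY_mul ν hz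
      (aestronglyMeasurable_besselY ν hz)
      fun t ht => abs_sqrt_mul_besselY_le (lt_add_one |ν|) hz ht)
  have hx : HasDerivAt (fun μ : ℝ => π * (μ - ν) / 2) (π / 2) ν := by
    simpa using (((hasDerivAt_id ν).sub_const ν).const_mul π).div_const 2
  have h := (((hx.cos).sub (hI1.const_mul (π / 2))).const_mul (besselY ν z)).sub
    (((hx.sin).sub (hI2.const_mul (π / 2))).const_mul (besselJ ν z))
  have h' := h.congr_of_eventuallyEq (f₁ := fun μ => besselY μ z) (by
    rw [Filter.EventuallyEq, ← nhdsNE_sup_pure, eventually_sup]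
    refine ⟨?_, ?_⟩
    · filter_upwards [eventually_mem_nonInteger ν] with μ hμ using besselY_expansion ν hμ hz
    · simp)
  refine h'.congr_deriv ?_
  simp only [sub_self, mul_zero, zero_div, Real.sin_zero, Real.cos_zero, pow_two,
    mul_comm (besselJ ν _) (besselY ν _)]
  ring

theorem stmt3 (ν z : ℝ) (hν : 0 < ν) (hz : 0 < z) :
    deriv (fun μ => besselY μ z) ν
      = ν * Real.pi * besselJ ν z * (∫ t in Set.Ioi z, besselY ν t ^ 2 / t)
        - ν * Real.pi * besselY ν z * (∫ t in Set.Ioi z, besselJ ν t * besselY ν t / t)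
        - Real.pi / 2 * besselJ ν z :=
  (hasDerivAt_besselY_order ν hz).deriv
end

section
/- For x > 0, ∫_x^∞ J₀(t)²/t dt = − ∑_{n=0}^∞ ε_n J_n(x) · (∂J_ν(x)/∂ν)|_{ν=n}, where ε₀ = 1 and ε_n = 2 for n ≥ 1. -/
open MeasureTheory Real Filter Set Topology

/-- The power series `∑ k, (-w) ^ k * c (n + k) / k!`. -/
noncomputable def shiftSeries (c : ℕ → ℝ) (n : ℕ) (w : ℝ) : ℝ :=
  ∑' k : ℕ, (-1 : ℝ) ^ k * w ^ k * c (n + k) / k.factorial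

theorem abs_shiftSeries_term_le {c : ℕ → ℝ} {n : ℕ} {C : ℝ} (hc : ∀ k, |c (n + k)| ≤ C)
    (w : ℝ) (k : ℕ) :
    ‖(-1 : ℝ) ^ k * w ^ k * c (n + k) / k.factorial‖ ≤ C * (|w| ^ k / k.factorial) := by
  rw [norm_div, norm_mul, norm_mul, norm_pow, norm_neg, norm_one, one_pow, one_mul, norm_pow,
    Real.norm_eq_abs, Real.norm_eq_abs, RCLike.norm_natCast, ← mul_div_assoc, mul_comm C]
  gcongr
  exact hc k

theorem summable_shiftSeries {c : ℕ → ℝ} {n : ℕ} {C : ℝ} (hc : ∀ k, |c (n + k)| ≤ C) (w : ℝ) :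
    Summable fun k : ℕ => (-1 : ℝ) ^ k * w ^ k * c (n + k) / k.factorial :=
  .of_norm_bounded ((Real.summable_pow_div_factorial |w|).mul_left C)
    (abs_shiftSeries_term_le hc w)

theorem abs_shiftSeries_le {c : ℕ → ℝ} {n : ℕ} {C : ℝ} (hc : ∀ k, |c (n + k)| ≤ C) (w : ℝ) :
    |shiftSeries c n w| ≤ C * Real.exp |w| := by
  refine tsum_of_norm_bounded ?_ (abs_shiftSeries_term_le hc w)
  rw [Real.exp_eq_exp_ℝ]
  exact (NormedSpace.expSeries_div_hasSum_exp |w|).mul_left C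

theorem hasDerivAt_shiftSeries {c : ℕ → ℝ} {C : ℝ} (hc : ∀ k, |c k| ≤ C) (n : ℕ) (w : ℝ) :
    HasDerivAt (shiftSeries c n) (-shiftSeries c (n + 1) w) w := by
  have hC : 0 ≤ C := (abs_nonneg _).trans (hc 0)
  set R := |w| + 1
  have hu : Summable fun k : ℕ => C * (k * R ^ (k - 1) / k.factorial) := by
    refine Summable.mul_left C ?_
    rw [← summable_nat_add_iff 1]
    refine (Real.summable_pow_div_factorial R).congr fun k => ?_
    rw [Nat.factorial_succ]
    push_cast
    have : (k : ℝ) + 1 ≠ 0 := by positivity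
    field_simp
  have key := hasDerivAt_tsum_of_isPreconnected (𝕜 := ℝ) (F := ℝ)
    (g := fun (k : ℕ) (y : ℝ) => (-1 : ℝ) ^ k * y ^ k * c (n + k) / k.factorial)
    (g' := fun (k : ℕ) (y : ℝ) => (-1 : ℝ) ^ k * (k * y ^ (k - 1)) * c (n + k) / k.factorial)
    (t := Metric.ball 0 R) (y₀ := 0) (y := w) hu Metric.isOpen_ball
    (convex_ball (0 : ℝ) R).isPreconnected
    (fun k y _ => (((hasDerivAt_pow k y).const_mul _).mul_const _).div_const _)
    (fun k y hy => ?_) (by simp [R]; positivity)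
    (summable_shiftSeries (fun k => hc (n + k)) 0) (by simp [R])
  · convert! key using 1
    rw [Summable.tsum_eq_zero_add]
    · simp only [Nat.cast_zero, zero_mul, mul_zero, zero_div, zero_add, shiftSeries, ← tsum_neg]
      refine tsum_congr fun k => ?_
      rw [Nat.factorial_succ, show n + 1 + k = n + (k + 1) by ring]
      push_cast
      have : (k : ℝ) + 1 ≠ 0 := by positivity
      field_simp
      ring
    · rw [← summable_nat_add_iff 1]
      refine (summable_shiftSeries (n := n + 1) (fun k => hc (n + 1 + k)) w).neg.congr fun k => ?_
      rw [Nat.factorial_succ, show n + 1 + k = n + (k + 1) by ring]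
      push_cast
      have : (k : ℝ) + 1 ≠ 0 := by positivity
      field_simp
      ring
  · have hy' : |y| ≤ R := by simpa using (Metric.mem_ball.1 hy).le
    rw [norm_div, norm_mul, norm_mul, norm_pow, norm_neg, norm_one, one_pow, one_mul, norm_mul,
      norm_pow, Real.norm_eq_abs y, Real.norm_eq_abs (c _), RCLike.norm_natCast,
      RCLike.norm_natCast, ← mul_div_assoc, mul_comm C]
    gcongr
    exact hc _

theorem shiftSeries_recurrence {c e : ℕ → ℝ} {C : ℝ} (hc : ∀ k, |c k| ≤ C) (he : ∀ k, |e k| ≤ C)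
    (h : ∀ m, c m = (m + 1) * c (m + 1) - e (m + 1)) (n : ℕ) (w : ℝ) :
    shiftSeries c n w + w * shiftSeries c (n + 2) w
      = (n + 1) * shiftSeries c (n + 1) w - shiftSeries e (n + 1) w := by
  have h0 := (summable_shiftSeries (fun k => hc (n + k)) w).hasSum
  have h1 := (summable_shiftSeries (n := n + 1) (fun k => hc (n + 1 + k)) w).hasSum
  have h2 := (summable_shiftSeries (n := n + 2) (fun k => hc (n + 2 + k)) w).hasSum
  have h3 := (summable_shiftSeries (n := n + 1) (fun k => he (n + 1 + k)) w).hasSum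
  have h4 : HasSum (fun k : ℕ => -((-1 : ℝ) ^ k * w ^ k * (k * c (n + 1 + k)) / k.factorial))
      (w * shiftSeries c (n + 2) w) := by
    rw [← hasSum_nat_add_iff' 1]
    simp only [Finset.range_one, Finset.sum_singleton, Nat.cast_zero, zero_mul, mul_zero, zero_div,
      neg_zero, sub_zero]
    convert! h2.mul_left w using 1
    funext k
    rw [Nat.factorial_succ, show n + 1 + (k + 1) = n + 2 + k by ring]
    push_cast
    have : (k : ℝ) + 1 ≠ 0 := by positivity
    field_simp
    ring
  refine (h0.add h4).unique ?_
  convert! (h1.mul_left ((n : ℝ) + 1)).sub h3 using 1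
  funext k
  rw [h (n + k), show n + 1 + k = n + k + 1 by ring]
  push_cast
  ring

theorem norm_inv_Gamma_add_nat_le {z : ℂ} (hz : -(1 / 2) ≤ z.re) (k : ℕ) :
    ‖(Complex.Gamma (z + k + 1))⁻¹‖ ≤ ‖(Complex.Gamma (z + 1))⁻¹‖ * 2 ^ k := by
  induction k with
  | zero => simp
  | succ k ih =>
    have h1 := Complex.one_div_Gamma_eq_self_mul_one_div_Gamma_add_one (z + k + 1)
    have h2 : 1 / 2 ≤ ‖z + k + 1‖ := by
      refine le_trans ?_ (Complex.re_le_norm _)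
      simp only [Complex.add_re, Complex.natCast_re, Complex.one_re]
      have : (0 : ℝ) ≤ k := k.cast_nonneg
      linarith
    rw [h1, norm_mul] at ih
    push_cast
    rw [← add_assoc z, pow_succ]
    nlinarith [norm_nonneg (Complex.Gamma (z + k + 1 + 1))⁻¹]

theorem hasDerivAt_inv_Gamma_nat (m : ℕ) :
    HasDerivAt (fun z : ℂ => (Complex.Gamma z)⁻¹)
      ((Real.eulerMascheroniConstant - harmonic m) / m.factorial) (m + 1) := by
  have h := (Complex.hasDerivAt_Gamma_nat m).inv
    (by rw [Complex.Gamma_nat_eq_factorial]; exact_mod_cast m.factorial_ne_zero)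
  refine h.congr_deriv ?_
  rw [Complex.Gamma_nat_eq_factorial]
  have : (m.factorial : ℂ) ≠ 0 := by exact_mod_cast m.factorial_ne_zero
  field_simp
  ring

theorem hasDerivAt_tsum_div_Gamma (w : ℝ) (n : ℕ) :
    HasDerivAt (fun μ : ℝ => ∑' k : ℕ, (-1 : ℝ) ^ k * w ^ k / (k.factorial * Real.Gamma (μ + k + 1)))
      (∑' k : ℕ, (-1 : ℝ) ^ k * w ^ k *
        ((Real.eulerMascheroniConstant - harmonic (n + k)) / (n + k).factorial) / k.factorial) n := by
  let f : ℕ → ℂ → ℂ := fun k z => (-1) ^ k * w ^ k / k.factorial * (Complex.Gamma (z + k + 1))⁻¹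
  have hf : ∀ k, Differentiable ℂ (f k) := fun k => by
    refine Differentiable.const_mul ?_ _
    exact Complex.differentiable_one_div_Gamma.comp
      (f := fun z : ℂ => z + k + 1) (by fun_prop)
  obtain ⟨M, hM⟩ : ∃ M, ∀ z ∈ Metric.closedBall (n : ℂ) (1 / 2),
      ‖(Complex.Gamma (z + 1))⁻¹‖ ≤ M :=
    (isCompact_closedBall _ _).exists_bound_of_continuousOn
      (Complex.differentiable_one_div_Gamma.comp
        (f := fun z : ℂ => z + 1) (by fun_prop)).continuous.continuousOn
  have hu : Summable fun k : ℕ => M * ((|w| * 2) ^ k / k.factorial) :=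
    (Real.summable_pow_div_factorial _).mul_left M
  have hb : ∀ (k : ℕ) (z : ℂ), z ∈ Metric.ball (n : ℂ) (1 / 2) →
      ‖f k z‖ ≤ M * ((|w| * 2) ^ k / k.factorial) := by
    intro k z hz
    have hre : -(1 / 2) ≤ z.re := by
      have h1 := (Complex.abs_re_le_norm (z - n)).trans (mem_ball_iff_norm.1 hz).le
      have h2 := (abs_le.1 h1).1
      simp only [Complex.sub_re, Complex.natCast_re] at h2
      have : (0 : ℝ) ≤ n := n.cast_nonneg
      linarith
    have h1 := (norm_inv_Gamma_add_nat_le hre k).trans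
      (mul_le_mul_of_nonneg_right (hM z (Metric.ball_subset_closedBall hz)) (by positivity))
    simp only [f, norm_mul, norm_div, norm_pow, norm_neg, norm_one, one_pow, one_mul,
      Complex.norm_real, Real.norm_eq_abs, Complex.norm_natCast]
    calc |w| ^ k / k.factorial * ‖(Complex.Gamma (z + k + 1))⁻¹‖
        ≤ |w| ^ k / k.factorial * (M * 2 ^ k) := by gcongr
      _ = M * ((|w| * 2) ^ k / k.factorial) := by rw [mul_pow]; ring
  have hn : (n : ℂ) ∈ Metric.ball (n : ℂ) (1 / 2) := by simp
  have hs := Complex.hasSum_deriv_of_summable_norm hu (fun k => (hf k).differentiableOn)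
    Metric.isOpen_ball hb hn
  have hd := ((Complex.differentiableOn_tsum_of_summable_norm hu
    (fun k => (hf k).differentiableOn) Metric.isOpen_ball hb).differentiableAt
      (Metric.isOpen_ball.mem_nhds hn)).hasDerivAt
  have hdk : ∀ k, deriv (f k) n = (((-1 : ℝ) ^ k * w ^ k *
        ((Real.eulerMascheroniConstant - harmonic (n + k)) / (n + k).factorial) / k.factorial : ℝ) : ℂ) := by
    intro k
    have h := hasDerivAt_inv_Gamma_nat (n + k)
    push_cast at h
    have h' : HasDerivAt (f k) _ (n : ℂ) := HasDerivAt.const_mul _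
      ((HasDerivAt.comp_add_const (n : ℂ) ((k : ℂ) + 1)
        (by rw [← add_assoc]; exact h)).congr_of_eventuallyEq
          (.of_forall fun z => by simp only [add_assoc]))
    rw [h'.deriv]
    push_cast
    ring
  rw [← hs.tsum_eq] at hd
  simp_rw [hdk] at hd
  rw [← Complex.ofReal_tsum] at hd
  have hr := HasDerivAt.real_of_complex (z := (n : ℝ)) (by simpa using hd)
  refine (hr.congr_deriv (by simp)).congr_of_eventuallyEq (.of_forall fun μ => ?_)
  have : (∑' k, f k μ) = ((∑' k : ℕ, (-1 : ℝ) ^ k * w ^ k /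
      (k.factorial * Real.Gamma (μ + k + 1)) : ℝ) : ℂ) := by
    rw [Complex.ofReal_tsum]
    refine tsum_congr fun k => ?_
    simp only [f]
    push_cast [← Complex.Gamma_ofReal]
    rw [← div_eq_mul_inv, div_div]
  simp [this]

theorem abs_inv_factorial_le (k : ℕ) : |((k.factorial : ℝ))⁻¹| ≤ 1 := by
  rw [abs_of_nonneg (by positivity)]
  exact inv_le_one_of_one_le₀ (by exact_mod_cast Nat.one_le_iff_ne_zero.2 k.factorial_ne_zero)

theorem harmonic_le_self (k : ℕ) : (harmonic k : ℝ) ≤ k := by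
  induction k with
  | zero => simp
  | succ k ih =>
    rw [harmonic_succ]
    push_cast
    have : ((k : ℝ) + 1)⁻¹ ≤ 1 := inv_le_one_of_one_le₀ (by linarith [k.cast_nonneg (α := ℝ)])
    linarith

theorem harmonic_nonneg (k : ℕ) : (0 : ℝ) ≤ harmonic k := by
  rw [harmonic]
  push_cast
  positivity

theorem abs_harmonic_div_factorial_le (k : ℕ) : |(harmonic k : ℝ) / k.factorial| ≤ 1 := by
  rw [abs_of_nonneg (div_nonneg (harmonic_nonneg k) (by positivity)),
    div_le_one (by positivity)]
  exact (harmonic_le_self k).trans (by exact_mod_cast k.self_le_factorial)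

/-- The entire function `j` with `J_n(x) = (x / 2) ^ n * j (x ^ 2 / 4)`. -/
noncomputable def besselCore (n : ℕ) (w : ℝ) : ℝ :=
  shiftSeries (fun m => ((m.factorial : ℝ))⁻¹) n w

/-- The series `∑ k, (-w) ^ k * H (n + k) / (k! * (n + k)!)`, with `H` the harmonic numbers. -/
noncomputable def besselHarmonic (n : ℕ) (w : ℝ) : ℝ :=
  shiftSeries (fun m => (harmonic m : ℝ) / m.factorial) n w

theorem besselJ_natCast (n : ℕ) (x : ℝ) :
    besselJ n x = (x / 2) ^ n * besselCore n (x ^ 2 / 4) := by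
  rw [besselJ, Real.rpow_natCast, besselCore, shiftSeries]
  congr 1
  refine tsum_congr fun k => ?_
  rw [← Nat.cast_add, Real.Gamma_nat_eq_factorial]
  field_simp

theorem hasDerivAt_besselJ_order {x : ℝ} (hx : 0 < x) (n : ℕ) :
    HasDerivAt (fun μ => besselJ μ x) ((x / 2) ^ n *
      ((Real.log (x / 2) + Real.eulerMascheroniConstant) * besselCore n (x ^ 2 / 4)
        - besselHarmonic n (x ^ 2 / 4))) n := by
  have h1 : HasDerivAt (fun μ : ℝ => (x / 2) ^ μ) ((x / 2) ^ (n : ℝ) * Real.log (x / 2)) n :=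
    Real.hasStrictDerivAt_const_rpow (by positivity) _ |>.hasDerivAt
  refine (h1.mul (hasDerivAt_tsum_div_Gamma (x ^ 2 / 4) n)).congr_deriv ?_
  have h2 : (∑' k : ℕ, (-1 : ℝ) ^ k * (x ^ 2 / 4) ^ k *
        ((Real.eulerMascheroniConstant - harmonic (n + k)) / (n + k).factorial) / k.factorial)
      = Real.eulerMascheroniConstant * besselCore n (x ^ 2 / 4) - besselHarmonic n (x ^ 2 / 4) := by
    rw [besselCore, besselHarmonic, shiftSeries, shiftSeries, ← tsum_mul_left,
      ← Summable.tsum_sub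
        ((summable_shiftSeries (c := fun m => ((m.factorial : ℝ))⁻¹)
          (fun k => abs_inv_factorial_le (n + k)) _).mul_left _)
        (summable_shiftSeries (c := fun m => (harmonic m : ℝ) / m.factorial)
          (fun k => abs_harmonic_div_factorial_le (n + k)) _)]
    exact tsum_congr fun k => by ring
  have h3 : (∑' k : ℕ, (-1 : ℝ) ^ k * (x ^ 2 / 4) ^ k /
      (k.factorial * Real.Gamma (n + k + 1))) = besselCore n (x ^ 2 / 4) := by
    rw [besselCore, shiftSeries]
    refine tsum_congr fun k => ?_
    rw [← Nat.cast_add, Real.Gamma_nat_eq_factorial]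
    field_simp
  rw [h2, h3, Real.rpow_natCast]
  ring

/-- The derivative of `J_ν(x)` with respect to the order `ν`, at `ν = n`. -/
noncomputable def besselJOrderDeriv (n : ℕ) (x : ℝ) : ℝ :=
  (x / 2) ^ n * ((Real.log (x / 2) + eulerMascheroniConstant) * besselCore n (x ^ 2 / 4)
    - besselHarmonic n (x ^ 2 / 4))

theorem hasDerivAt_besselCore (n : ℕ) (w : ℝ) :
    HasDerivAt (besselCore n) (-besselCore (n + 1) w) w :=
  hasDerivAt_shiftSeries abs_inv_factorial_le n w

theorem hasDerivAt_besselHarmonic (n : ℕ) (w : ℝ) :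
    HasDerivAt (besselHarmonic n) (-besselHarmonic (n + 1) w) w :=
  hasDerivAt_shiftSeries abs_harmonic_div_factorial_le n w

theorem continuous_besselCore (n : ℕ) : Continuous (besselCore n) :=
  continuous_iff_continuousAt.2 fun w => (hasDerivAt_besselCore n w).continuousAt

theorem continuous_besselHarmonic (n : ℕ) : Continuous (besselHarmonic n) :=
  continuous_iff_continuousAt.2 fun w => (hasDerivAt_besselHarmonic n w).continuousAt

theorem besselCore_recurrence (n : ℕ) (w : ℝ) :
    besselCore n w + w * besselCore (n + 2) w = (n + 1) * besselCore (n + 1) w := by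
  have h := shiftSeries_recurrence (c := fun m => ((m.factorial : ℝ))⁻¹) (e := fun _ => 0) (C := 1)
    abs_inv_factorial_le (by simp) (fun m => by
      rw [Nat.factorial_succ]
      push_cast
      have : (m : ℝ) + 1 ≠ 0 := by positivity
      field_simp
      simp) n w
  rw [show shiftSeries (fun _ => 0) (n + 1) w = 0 by simp [shiftSeries], sub_zero] at h
  exact h

theorem besselHarmonic_recurrence (n : ℕ) (w : ℝ) :
    besselHarmonic n w + w * besselHarmonic (n + 2) w
      = (n + 1) * besselHarmonic (n + 1) w - besselCore (n + 1) w :=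
  shiftSeries_recurrence abs_harmonic_div_factorial_le abs_inv_factorial_le (fun m => by
    rw [Nat.factorial_succ, harmonic_succ]
    push_cast
    have : (m : ℝ) + 1 ≠ 0 := by positivity
    field_simp
    ring) n w

theorem hasDerivAt_sq_div_four (x : ℝ) : HasDerivAt (fun y : ℝ => y ^ 2 / 4) (x / 2) x := by
  refine ((hasDerivAt_pow 2 x).div_const 4).congr_deriv ?_
  push_cast
  ring

theorem hasDerivAt_half_pow {x : ℝ} (hx : 0 < x) (n : ℕ) :
    HasDerivAt (fun y : ℝ => (y / 2) ^ n) (n / x * (x / 2) ^ n) x := by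
  refine (((hasDerivAt_id x).div_const 2).pow n).congr_deriv ?_
  rcases n with _ | n
  · simp
  · simp only [id_eq, Nat.add_sub_cancel, pow_succ]
    field_simp

theorem hasDerivAt_besselJ_natCast {x : ℝ} (hx : 0 < x) (n : ℕ) :
    HasDerivAt (fun y => besselJ n y) (n / x * besselJ n x - besselJ (n + 1 : ℕ) x) x := by
  simp only [besselJ_natCast]
  refine ((hasDerivAt_half_pow hx n).mul
    ((hasDerivAt_besselCore n _).comp x (hasDerivAt_sq_div_four x))).congr_deriv ?_
  simp only [Function.comp_apply]
  ring

theorem hasDerivAt_besselJOrderDeriv {x : ℝ} (hx : 0 < x) (n : ℕ) :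
    HasDerivAt (besselJOrderDeriv n)
      (besselJ n x / x + n / x * besselJOrderDeriv n x - besselJOrderDeriv (n + 1) x) x := by
  have hlog : HasDerivAt (fun y : ℝ => Real.log (y / 2) + eulerMascheroniConstant) (1 / x) x := by
    refine ((((hasDerivAt_id x).div_const 2).log (by simp; positivity)).add_const _).congr_deriv ?_
    simp only [id_eq]
    field_simp
  have hc := (hasDerivAt_besselCore n _).comp x (hasDerivAt_sq_div_four x)
  have hh := (hasDerivAt_besselHarmonic n _).comp x (hasDerivAt_sq_div_four x)
  refine ((hasDerivAt_half_pow hx n).mul ((hlog.mul hc).sub hh)).congr_deriv ?_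
  simp only [besselJ_natCast, besselJOrderDeriv, Function.comp_apply, Pi.sub_apply, Pi.mul_apply]
  ring

theorem besselJ_recurrence {x : ℝ} (hx : 0 < x) (n : ℕ) :
    besselJ n x + besselJ (n + 2 : ℕ) x = 2 * (n + 1) / x * besselJ (n + 1 : ℕ) x := by
  have h := besselCore_recurrence n (x ^ 2 / 4)
  simp only [besselJ_natCast, pow_succ]
  field_simp
  linear_combination 4 * h

theorem besselJOrderDeriv_recurrence {x : ℝ} (hx : 0 < x) (n : ℕ) :
    besselJOrderDeriv n x + besselJOrderDeriv (n + 2) x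
      = 2 * (n + 1) / x * besselJOrderDeriv (n + 1) x + 2 / x * besselJ (n + 1 : ℕ) x := by
  have h := besselCore_recurrence n (x ^ 2 / 4)
  have h' := besselHarmonic_recurrence n (x ^ 2 / 4)
  simp only [besselJ_natCast, besselJOrderDeriv, pow_succ]
  field_simp
  linear_combination 4 * (Real.log (x / 2) + eulerMascheroniConstant) * h - 4 * h'

/-- The summand `ε_n J_n(x) ∂_ν J_ν(x)` at `ν = n`. -/
noncomputable def neumannTerm (n : ℕ) (x : ℝ) : ℝ :=
  (if n = 0 then (1 : ℝ) else 2) * besselJ n x * besselJOrderDeriv n x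

/-- The boundary term in the telescoping derivative of the partial sums. -/
noncomputable def neumannBoundary (n : ℕ) (x : ℝ) : ℝ :=
  besselJ n x * besselJOrderDeriv (n + 1) x + besselJ (n + 1 : ℕ) x * besselJOrderDeriv n x

theorem hasDerivAt_sum_neumannTerm {x : ℝ} (hx : 0 < x) (N : ℕ) :
    HasDerivAt (fun y => ∑ n ∈ Finset.range (N + 1), neumannTerm n y)
      (besselJ 0 x ^ 2 / x - neumannBoundary N x) x := by
  have hd := fun n => (hasDerivAt_besselJ_natCast hx n).mul (hasDerivAt_besselJOrderDeriv hx n)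
  induction N with
  | zero =>
    simp only [zero_add, Finset.range_one, Finset.sum_singleton, neumannTerm, if_true, one_mul]
    refine (hd 0).congr_deriv ?_
    simp only [neumannBoundary, Nat.cast_zero, zero_add]
    ring
  | succ N ih =>
    simp only [Finset.sum_range_succ _ (N + 1)]
    refine (ih.add (f := fun y => ∑ n ∈ Finset.range (N + 1), neumannTerm n y)
      (g := neumannTerm (N + 1)) (((hd (N + 1)).const_mul 2).congr_of_eventuallyEq
        (.of_forall fun y => by simp [neumannTerm, mul_assoc]))).congr_deriv ?_
    have h1 := besselJ_recurrence hx N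
    have h2 := besselJOrderDeriv_recurrence hx N
    simp only [neumannBoundary]
    push_cast at h1 h2 ⊢
    rw [show (N : ℝ) + 1 + 1 = N + 2 by ring]
    linear_combination -besselJOrderDeriv (N + 1) x * h1 - besselJ ((N : ℝ) + 1) x * h2

theorem abs_besselJ_natCast_le (n : ℕ) {x : ℝ} (hx : 0 < x) :
    |besselJ n x| ≤ (x / 2) ^ n * Real.exp (x ^ 2 / 4) / n.factorial := by
  have h := abs_shiftSeries_le (c := fun m => ((m.factorial : ℝ))⁻¹) (n := n)
    (C := (n.factorial : ℝ)⁻¹) (fun k => by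
      rw [abs_of_nonneg (by positivity)]
      gcongr
      exact Nat.le_add_right n k) (x ^ 2 / 4)
  rw [abs_of_nonneg (show 0 ≤ x ^ 2 / 4 by positivity)] at h
  rw [besselJ_natCast, abs_mul, abs_of_pos (show 0 < (x / 2) ^ n by positivity), mul_div_assoc]
  gcongr
  rw [div_eq_inv_mul (Real.exp _)]
  exact h

theorem abs_besselJOrderDeriv_le (n : ℕ) {x : ℝ} (hx : 0 < x) :
    |besselJOrderDeriv n x| ≤ (x / 2) ^ n * Real.exp (x ^ 2 / 4) *
      (|Real.log (x / 2) + eulerMascheroniConstant| + 1) := by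
  have h := abs_shiftSeries_le (c := fun m => ((m.factorial : ℝ))⁻¹)
    (fun k => abs_inv_factorial_le (n + k)) (x ^ 2 / 4)
  have h' := abs_shiftSeries_le (c := fun m => (harmonic m : ℝ) / m.factorial)
    (fun k => abs_harmonic_div_factorial_le (n + k)) (x ^ 2 / 4)
  rw [abs_of_nonneg (show 0 ≤ x ^ 2 / 4 by positivity), one_mul] at h h'
  rw [besselJOrderDeriv, abs_mul, abs_of_pos (show 0 < (x / 2) ^ n by positivity), mul_assoc]
  gcongr
  refine (abs_sub _ _).trans ?_
  rw [abs_mul, mul_comm (Real.exp _), add_mul, one_mul]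
  gcongr
  · exact h
  · exact h'

theorem summable_neumannTerm {x : ℝ} (hx : 0 < x) : Summable fun n => neumannTerm n x := by
  set L := |Real.log (x / 2) + eulerMascheroniConstant| + 1
  refine .of_norm_bounded ((Real.summable_pow_div_factorial ((x / 2) ^ 2)).mul_left
    (2 * Real.exp (x ^ 2 / 4) ^ 2 * L)) fun n => ?_
  rw [neumannTerm, Real.norm_eq_abs, abs_mul, abs_mul]
  have h1 : |if n = 0 then (1 : ℝ) else 2| ≤ 2 := by split_ifs <;> norm_num
  calc _ ≤ 2 * ((x / 2) ^ n * Real.exp (x ^ 2 / 4) / n.factorial) *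
        ((x / 2) ^ n * Real.exp (x ^ 2 / 4) * L) := by
        gcongr
        · exact abs_besselJ_natCast_le n hx
        · exact abs_besselJOrderDeriv_le n hx
    _ = _ := by rw [pow_right_comm]; ring

theorem exists_abs_neumannBoundary_le (x : ℝ) :
    ∃ B, ∀ n : ℕ, ∀ t ∈ Ioc 0 x,
      |neumannBoundary n t| ≤ B * (((x / 2) ^ 2) ^ n / n.factorial) := by
  obtain ⟨B, hB⟩ := (isCompact_Icc (a := 0) (b := x / 2)).exists_bound_of_continuousOn
    (f := fun s : ℝ => s * Real.log s) Real.continuous_mul_log.continuousOn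
  obtain ⟨K, hK⟩ : ∃ K, K = B + x / 2 * (|eulerMascheroniConstant| + 1) := ⟨_, rfl⟩
  refine ⟨2 * Real.exp (x ^ 2 / 4) ^ 2 * K, fun n t ht => ?_⟩
  have ht0 : 0 < t := ht.1
  have htx : t ≤ x := ht.2
  set L := |Real.log (t / 2) + eulerMascheroniConstant| + 1 with hL
  have hLB : t / 2 * L ≤ K := by
    rw [hK]
    have h1 := hB (t / 2) ⟨by positivity, by linarith⟩
    rw [Real.norm_eq_abs, abs_mul, abs_of_pos (show 0 < t / 2 by positivity)] at h1
    have h2 : L ≤ |Real.log (t / 2)| + (|eulerMascheroniConstant| + 1) := by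
      have := abs_add_le (Real.log (t / 2)) eulerMascheroniConstant
      linarith
    calc t / 2 * L ≤ t / 2 * (|Real.log (t / 2)| + (|eulerMascheroniConstant| + 1)) := by gcongr
      _ = t / 2 * |Real.log (t / 2)| + t / 2 * (|eulerMascheroniConstant| + 1) := by ring
      _ ≤ _ := by gcongr
  have hK0 : 0 ≤ K := le_trans (by positivity) hLB
  have h1 := abs_besselJ_natCast_le n ht0
  have h2 := abs_besselJ_natCast_le (n + 1) ht0
  have h3 := abs_besselJOrderDeriv_le n ht0
  have h4 := abs_besselJOrderDeriv_le (n + 1) ht0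
  have h5 : |besselJ (n + 1 : ℕ) t| ≤ (t / 2) ^ (n + 1) * Real.exp (t ^ 2 / 4) / n.factorial := by
    refine h2.trans ?_
    gcongr
    exact n.le_succ
  calc |neumannBoundary n t|
      ≤ |besselJ n t| * |besselJOrderDeriv (n + 1) t|
        + |besselJ (n + 1 : ℕ) t| * |besselJOrderDeriv n t| := by
        rw [← abs_mul, ← abs_mul]; exact abs_add_le _ _
    _ ≤ (t / 2) ^ n * Real.exp (t ^ 2 / 4) / n.factorial *
          ((t / 2) ^ (n + 1) * Real.exp (t ^ 2 / 4) * L)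
        + (t / 2) ^ (n + 1) * Real.exp (t ^ 2 / 4) / n.factorial *
          ((t / 2) ^ n * Real.exp (t ^ 2 / 4) * L) := by gcongr
    _ = 2 * Real.exp (t ^ 2 / 4) ^ 2 * (t / 2 * L) * (((t / 2) ^ 2) ^ n / n.factorial) := by
        rw [pow_right_comm, pow_succ]
        ring
    _ ≤ _ := by gcongr

theorem tendsto_mul_log_half_add_euler :
    Tendsto (fun x : ℝ => x * (Real.log (x / 2) + eulerMascheroniConstant)) (𝓝 0) (𝓝 0) := by
  have h : Continuous fun x : ℝ =>
      2 * (x / 2 * Real.log (x / 2)) + x * eulerMascheroniConstant := by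
    have := Real.continuous_mul_log.comp (continuous_id.div_const (2 : ℝ))
    simp only [Function.comp_def, id_eq] at this
    fun_prop
  have h0 := h.tendsto 0
  simp only [zero_div, zero_mul, mul_zero, add_zero] at h0
  refine h0.congr fun x => by ring

theorem tendsto_sum_neumannTerm (N : ℕ) :
    Tendsto (fun x => ∑ n ∈ Finset.range (N + 1), neumannTerm n x
      - (Real.log (x / 2) + eulerMascheroniConstant)) (𝓝 0) (𝓝 0) := by
  have hc : ∀ n, Continuous fun x : ℝ => besselCore n (x ^ 2 / 4) := fun n =>
    (continuous_besselCore n).comp (by fun_prop)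
  have hh : ∀ n, Continuous fun x : ℝ => besselHarmonic n (x ^ 2 / 4) := fun n =>
    (continuous_besselHarmonic n).comp (by fun_prop)
  have hc0 : besselCore 0 0 = 1 := by
    rw [besselCore, shiftSeries, tsum_eq_single 0 (fun k hk => by simp [hk])]
    simp
  have hh0 : besselHarmonic 0 0 = 0 := by
    rw [besselHarmonic, shiftSeries, tsum_eq_single 0 (fun k hk => by simp [hk])]
    simp
  induction N with
  | zero =>
    have hd : HasDerivAt (fun x : ℝ => besselCore 0 (x ^ 2 / 4) ^ 2) 0 0 := by
      refine (((hasDerivAt_besselCore 0 _).comp (0 : ℝ)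
        (hasDerivAt_sq_div_four 0)).pow 2).congr_deriv ?_
      simp
    have ho := hd.isLittleO
    simp only [sub_zero, smul_eq_mul, mul_zero, ne_eq, OfNat.ofNat_ne_zero, not_false_eq_true,
      zero_pow, zero_div, hc0, one_pow] at ho
    have h1 := (ho.isBigO.mul (Asymptotics.isBigO_refl
      (fun x : ℝ => Real.log (x / 2) + eulerMascheroniConstant) (𝓝 0))).trans_tendsto
        tendsto_mul_log_half_add_euler
    have h2 : Tendsto (fun x : ℝ => besselCore 0 (x ^ 2 / 4) * besselHarmonic 0 (x ^ 2 / 4))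
        (𝓝 0) (𝓝 0) := by
      exact ((hc 0).mul (hh 0)).tendsto' 0 0 (by simp [hh0])
    have h3 := h1.sub h2
    rw [sub_zero] at h3
    refine h3.congr fun x => ?_
    simp only [zero_add, Finset.range_one, Finset.sum_singleton, neumannTerm, if_true, one_mul,
      besselJ_natCast, besselJOrderDeriv, pow_zero]
    ring
  | succ N ih =>
    have h1 : Tendsto (neumannTerm (N + 1)) (𝓝 0) (𝓝 0) := by
      have ha : Tendsto (fun x : ℝ => (x / 2) ^ (2 * N + 1) * besselCore (N + 1) (x ^ 2 / 4) ^ 2)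
          (𝓝 0) (𝓝 0) := by
        exact ((by fun_prop : Continuous fun x : ℝ => (x / 2) ^ (2 * N + 1)).mul
          ((hc (N + 1)).pow 2)).tendsto' 0 0 (by simp)
      have hb : Tendsto (fun x : ℝ => 2 * (x / 2) ^ (2 * N + 2) *
          (besselCore (N + 1) (x ^ 2 / 4) * besselHarmonic (N + 1) (x ^ 2 / 4))) (𝓝 0) (𝓝 0) := by
        exact ((by fun_prop : Continuous fun x : ℝ => 2 * (x / 2) ^ (2 * N + 2)).mul
          ((hc (N + 1)).mul (hh (N + 1)))).tendsto' 0 0 (by simp)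
      have hab := (ha.mul tendsto_mul_log_half_add_euler).sub hb
      rw [mul_zero, sub_zero] at hab
      refine hab.congr fun x => ?_
      simp only [neumannTerm, besselJ_natCast, besselJOrderDeriv, Nat.add_eq_zero_iff, one_ne_zero,
        and_false, if_false]
      ring
    have h2 := ih.add h1
    rw [add_zero] at h2
    refine h2.congr fun x => ?_
    rw [Finset.sum_range_succ _ (N + 1)]
    ring

theorem hasSum_neumannTerm
    (hInt : ∀ x : ℝ, 0 < x → IntegrableOn (fun t => besselJ 0 t ^ 2 / t) (Ioi x))
    (hlim : Tendsto (fun x => (∫ t in Ioi x, besselJ 0 t ^ 2 / t)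
      + (Real.log (x / 2) + eulerMascheroniConstant)) (𝓝[>] 0) (𝓝 0)) {x : ℝ} (hx : 0 < x) :
    HasSum (fun n => neumannTerm n x) (-∫ t in Ioi x, besselJ 0 t ^ 2 / t) := by
  set f : ℝ → ℝ := fun t => besselJ 0 t ^ 2 / t
  have hf : ∀ t, 0 < t → ContinuousAt f t := fun t ht => by
    have := (hasDerivAt_besselJ_natCast ht 0).continuousAt
    rw [Nat.cast_zero] at this
    exact (this.pow 2).div continuousAt_id ht.ne'
  have hI : ∀ t, 0 < t → HasDerivAt (fun y => ∫ s in Ioi y, f s) (-f t) t := by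
    intro t ht
    have hm : StronglyMeasurableAtFilter f (𝓝 t) :=
      ⟨Ioi 0, Ioi_mem_nhds ht, ContinuousOn.aestronglyMeasurable
        (fun y hy => (hf y hy).continuousWithinAt) measurableSet_Ioi⟩
    have h1 : HasDerivAt (fun u => ∫ s in u..t + 1, f s) (-f t) t :=
      intervalIntegral.integral_hasDerivAt_left
        ((intervalIntegrable_iff_integrableOn_Ioc_of_le (by linarith)).2
          ((hInt t ht).mono_set Ioc_subset_Ioi_self)) hm (hf t ht)
    refine (h1.add_const (∫ s in Ioi (t + 1), f s)).congr_of_eventuallyEq ?_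
    filter_upwards [Ioi_mem_nhds ht] with y hy
    rw [intervalIntegral.integral_interval_add_Ioi (hInt y hy) (hInt (t + 1) (by linarith))]
  obtain ⟨B, hB⟩ := exists_abs_neumannBoundary_le x
  have hE : ∀ N : ℕ, |∑ n ∈ Finset.range (N + 1), neumannTerm n x + ∫ s in Ioi x, f s|
      ≤ B * (((x / 2) ^ 2) ^ N / N.factorial) * x := by
    intro N
    set E : ℝ → ℝ := fun y => ∑ n ∈ Finset.range (N + 1), neumannTerm n y + ∫ s in Ioi y, f s
    have hEd : ∀ y ∈ Ioc 0 x, HasDerivWithinAt E (-neumannBoundary N y) (Ioc 0 x) y :=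
      fun y hy => (((hasDerivAt_sum_neumannTerm hy.1 N).add (hI y hy.1)).congr_deriv
        (by simp only [f]; ring)).hasDerivWithinAt
    have hE0 : Tendsto E (𝓝[>] 0) (𝓝 0) := by
      have := ((tendsto_sum_neumannTerm N).mono_left (nhdsWithin_le_nhds (s := Ioi 0))).add hlim
      rw [add_zero] at this
      exact this.congr fun y => by simp only [E]; ring
    have hlim' : Tendsto (fun a => ‖E x - E a‖) (𝓝[>] 0) (𝓝 ‖E x - 0‖) :=
      (tendsto_const_nhds.sub hE0).norm
    rw [sub_zero] at hlim'
    refine le_of_tendsto hlim' ?_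
    filter_upwards [Ioc_mem_nhdsGT hx] with a ha
    refine ((convex_Ioc (0 : ℝ) x).norm_image_sub_le_of_norm_hasDerivWithin_le hEd
      (fun y hy => by rw [norm_neg]; exact hB N y hy) ha ⟨hx, le_rfl⟩).trans ?_
    have h0 := (abs_nonneg _).trans (hB N x ⟨hx, le_rfl⟩)
    gcongr
    rw [Real.norm_eq_abs, abs_of_nonneg (by linarith [ha.2])]
    linarith [ha.1]
  have hz : Tendsto (fun N : ℕ => B * (((x / 2) ^ 2) ^ N / N.factorial) * x) atTop (𝓝 0) := by
    have := ((FloorSemiring.tendsto_pow_div_factorial_atTop ((x / 2) ^ 2)).const_mul B).mul_const x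
    simpa using this
  have h1 := squeeze_zero_norm (f := fun N =>
    ∑ n ∈ Finset.range (N + 1), neumannTerm n x + ∫ s in Ioi x, f s) hE hz
  have h2 := ((summable_neumannTerm hx).hasSum.tendsto_sum_nat.comp (tendsto_add_atTop_nat 1))
  have h3 := tendsto_nhds_unique (h2.add_const (∫ s in Ioi x, f s)) h1
  rw [← eq_neg_of_add_eq_zero_left h3]
  exact (summable_neumannTerm hx).hasSum

theorem re_one_add_mul_sub_one_ge {c : ℂ} {s : ℝ} (hs : s ∈ Icc (0 : ℝ) 1) :
    min 1 c.re ≤ (1 + s * (c - 1)).re := by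
  have h : (1 + s * (c - 1)).re = (1 - s) * 1 + s * c.re := by simp; ring
  rw [h]
  have h1 := min_le_left 1 c.re
  have h2 := min_le_right 1 c.re
  nlinarith [hs.1, hs.2, mul_le_mul_of_nonneg_left h2 hs.1,
    mul_le_mul_of_nonneg_left h1 (sub_nonneg.2 hs.2)]

theorem norm_cexp_neg_segment_le {c : ℂ} {s t : ℝ} (hs : s ∈ Icc (0 : ℝ) 1) (ht : 0 < t) :
    ‖Complex.exp (-(1 + s * (c - 1)) * t)‖ ≤ Real.exp (-min 1 c.re * t) := by
  rw [Complex.norm_exp, Real.exp_le_exp, Complex.re_mul_ofReal, Complex.neg_re]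
  have := mul_le_mul_of_nonneg_right (re_one_add_mul_sub_one_ge (c := c) hs) ht.le
  linarith

theorem cexp_sub_cexp_div_eq_integral (c : ℂ) {t : ℝ} (ht : 0 < t) :
    (Complex.exp (-c * t) - Complex.exp (-t)) / t =
      ∫ s in (0 : ℝ)..1, -(c - 1) * Complex.exp (-(1 + s * (c - 1)) * t) := by
  have ht' : (t : ℂ) ≠ 0 := by exact_mod_cast ht.ne'
  have hd : ∀ s : ℝ, HasDerivAt (fun s : ℝ => Complex.exp (-(1 + s * (c - 1)) * t) / t)
      (-(c - 1) * Complex.exp (-(1 + s * (c - 1)) * t)) s := by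
    intro s
    have h1 : HasDerivAt (fun s : ℝ => (s : ℂ)) 1 s := Complex.ofRealCLM.hasDerivAt
    convert! (((((h1.mul_const (c - 1)).const_add 1).fun_neg).mul_const (t : ℂ)).cexp).div_const
      (t : ℂ) using 1
    field_simp
  rw [intervalIntegral.integral_eq_sub_of_hasDerivAt (fun s _ => hd s)
    ((by fun_prop : Continuous fun s : ℝ =>
      -(c - 1) * Complex.exp (-(1 + s * (c - 1)) * t)).intervalIntegrable _ _)]
  simp [sub_div]

theorem norm_cexp_sub_cexp_div_le (c : ℂ) {t : ℝ} (ht : 0 < t) :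
    ‖(Complex.exp (-c * t) - Complex.exp (-t)) / t‖ ≤
      ‖c - 1‖ * Real.exp (-min 1 c.re * t) := by
  rw [cexp_sub_cexp_div_eq_integral c ht]
  refine (intervalIntegral.norm_integral_le_of_norm_le_const
    (C := ‖c - 1‖ * Real.exp (-min 1 c.re * t))
    fun s hs => ?_).trans (by simp)
  rw [uIoc_of_le zero_le_one] at hs
  rw [norm_mul, norm_neg]
  gcongr
  exact norm_cexp_neg_segment_le ⟨hs.1.le, hs.2⟩ ht

theorem integral_cexp_sub_cexp_div {c : ℂ} (hc : 0 < c.re) :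
    ∫ t in Ioi (0 : ℝ), (Complex.exp (-c * t) - Complex.exp (-t)) / t = -Complex.log c := by
  have hm : 0 < min 1 c.re := lt_min one_pos hc
  have hpos : ∀ s ∈ Icc (0 : ℝ) 1, 0 < (1 + s * (c - 1)).re := fun s hs =>
    hm.trans_le (re_one_add_mul_sub_one_ge hs)
  have hInt : Integrable (Function.uncurry fun (t s : ℝ) =>
      -(c - 1) * Complex.exp (-(1 + s * (c - 1)) * t))
      ((volume.restrict (Ioi 0)).prod (volume.restrict (Ioc 0 1))) := by
    have hb : Integrable (fun p : ℝ × ℝ => Real.exp (-min 1 c.re * p.1) * ‖c - 1‖)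
        ((volume.restrict (Ioi 0)).prod (volume.restrict (Ioc 0 1))) :=
      (integrableOn_exp_mul_Ioi (neg_lt_zero.2 hm) 0).mul_prod (integrable_const _)
    refine hb.mono' (by fun_prop) ?_
    rw [Measure.prod_restrict]
    filter_upwards [ae_restrict_mem (measurableSet_Ioi.prod measurableSet_Ioc)] with p hp
    simp only [Function.uncurry]
    rw [norm_mul, norm_neg, mul_comm]
    gcongr
    exact norm_cexp_neg_segment_le ⟨hp.2.1.le, hp.2.2⟩ hp.1
  calc ∫ t in Ioi (0 : ℝ), (Complex.exp (-c * t) - Complex.exp (-t)) / t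
      = ∫ t in Ioi (0 : ℝ), ∫ s in Ioc (0 : ℝ) 1,
          -(c - 1) * Complex.exp (-(1 + s * (c - 1)) * t) := by
        refine setIntegral_congr_fun measurableSet_Ioi fun t ht => ?_
        simp only [cexp_sub_cexp_div_eq_integral c ht,
          intervalIntegral.integral_of_le zero_le_one]
    _ = ∫ s in Ioc (0 : ℝ) 1, ∫ t in Ioi (0 : ℝ),
          -(c - 1) * Complex.exp (-(1 + s * (c - 1)) * t) := integral_integral_swap hInt
    _ = ∫ s in (0 : ℝ)..1, -((c - 1) / (1 + s * (c - 1))) := by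
        rw [intervalIntegral.integral_of_le zero_le_one]
        refine setIntegral_congr_fun measurableSet_Ioc fun s hs => ?_
        have hs' := hpos s ⟨hs.1.le, hs.2⟩
        have h0 : (1 + s * (c - 1)) ≠ 0 := fun h => by rw [h] at hs'; simp at hs'
        rw [integral_const_mul, integral_exp_mul_complex_Ioi (by rw [Complex.neg_re]; linarith)]
        simp only [Complex.ofReal_zero, mul_zero, Complex.exp_zero, neg_div_neg_eq]
        ring
    _ = -Complex.log c := by
        have hd : ∀ s ∈ uIcc (0 : ℝ) 1, HasDerivAt (fun s : ℝ => -Complex.log (1 + s * (c - 1)))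
            (-((c - 1) / (1 + s * (c - 1)))) s := by
          intro s hs
          rw [uIcc_of_le zero_le_one] at hs
          have h1 : HasDerivAt (fun s : ℝ => (s : ℂ)) 1 s := Complex.ofRealCLM.hasDerivAt
          convert! (((h1.mul_const (c - 1)).const_add 1).clog_real (Or.inl (hpos s hs))).neg using 1
          simp
        rw [intervalIntegral.integral_eq_sub_of_hasDerivAt hd]
        · simp
        · refine ContinuousOn.intervalIntegrable fun s hs => ContinuousAt.continuousWithinAt ?_
          rw [uIcc_of_le zero_le_one] at hs
          have hs' := hpos s hs
          have h0 : (1 + s * (c - 1)) ≠ 0 := fun h => by rw [h] at hs'; simp at hs'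
          fun_prop (disch := assumption)

theorem re_cexp_sub_cexp_div (ε a t : ℝ) :
    ((Complex.exp (-(ε + a * Complex.I) * t) - Complex.exp (-t)) / t).re =
      (Real.exp (-ε * t) * Real.cos (a * t) - Real.exp (-t)) / t := by
  rw [Complex.div_ofReal_re, Complex.sub_re, Complex.exp_re, Complex.exp_re]
  simp

theorem integral_exp_mul_cos_sub_exp_div {ε : ℝ} (hε : 0 < ε) (a : ℝ) :
    ∫ t in Ioi (0 : ℝ), (Real.exp (-ε * t) * Real.cos (a * t) - Real.exp (-t)) / t =
      -(Real.log (ε ^ 2 + a ^ 2) / 2) := by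
  have hc : 0 < ((ε : ℂ) + a * Complex.I).re := by simpa using hε
  have hI : Integrable (fun t : ℝ =>
      (Complex.exp (-(ε + a * Complex.I) * t) - Complex.exp (-t)) / t) (volume.restrict (Ioi 0)) := by
    refine ((integrableOn_exp_mul_Ioi (neg_lt_zero.2 (lt_min one_pos hc)) 0).const_mul
      ‖(ε : ℂ) + a * Complex.I - 1‖).mono' (Measurable.aestronglyMeasurable (by fun_prop)) ?_
    filter_upwards [ae_restrict_mem measurableSet_Ioi] with t ht
    exact norm_cexp_sub_cexp_div_le _ ht
  have h := congrArg Complex.re (integral_cexp_sub_cexp_div hc)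
  rw [← RCLike.re_to_complex, ← integral_re hI] at h
  simp only [RCLike.re_to_complex, re_cexp_sub_cexp_div] at h
  rw [h, Complex.neg_re, Complex.log_re, Complex.norm_add_mul_I, Real.log_sqrt (by positivity)]

theorem integrable_uncurry_exp_mul_cos {Ω : Type*} [MeasurableSpace Ω] {μ : Measure Ω}
    [IsFiniteMeasure μ] {a : Ω → ℝ} (ha : Measurable a) {A : ℝ} (haA : ∀ᵐ ω ∂μ, |a ω| ≤ A)
    {ε : ℝ} (hε : 0 < ε) :
    Integrable (Function.uncurry fun (t : ℝ) (ω : Ω) =>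
      (Real.exp (-ε * t) * Real.cos (a ω * t) - Real.exp (-t)) / t)
      ((volume.restrict (Ioi 0)).prod μ) := by
  have hb : Integrable (fun p : ℝ × Ω => Real.exp (-min 1 ε * p.1) * (|ε - 1| + A))
      ((volume.restrict (Ioi 0)).prod μ) :=
    (integrableOn_exp_mul_Ioi (neg_lt_zero.2 (lt_min one_pos hε)) 0).mul_prod (integrable_const _)
  refine hb.mono' (Measurable.aestronglyMeasurable ?_) ?_
  · simp only [Function.uncurry_def]
    fun_prop
  have h1 : ∀ᵐ p ∂((volume.restrict (Ioi (0 : ℝ))).prod μ), p.1 ∈ Ioi (0 : ℝ) :=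
    Measure.quasiMeasurePreserving_fst.ae (ae_restrict_mem measurableSet_Ioi)
  have h2 : ∀ᵐ p ∂((volume.restrict (Ioi (0 : ℝ))).prod μ), |a p.2| ≤ A :=
    Measure.quasiMeasurePreserving_snd.ae haA
  filter_upwards [h1, h2] with p hp hpA
  simp only [Function.uncurry]
  rw [← re_cexp_sub_cexp_div, Real.norm_eq_abs]
  refine (Complex.abs_re_le_norm _).trans ((norm_cexp_sub_cexp_div_le _ hp).trans ?_)
  rw [mul_comm]
  have hre : ((ε : ℂ) + a p.2 * Complex.I).re = ε := by simp
  rw [hre]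
  gcongr
  calc ‖(ε : ℂ) + a p.2 * Complex.I - 1‖ = ‖((ε - 1 : ℝ) : ℂ) + ((a p.2 : ℝ) : ℂ) * Complex.I‖ := by
        congr 1; push_cast; ring
    _ ≤ |ε - 1| + |a p.2| := by
        refine (norm_add_le _ _).trans (le_of_eq ?_)
        rw [norm_mul, Complex.norm_I, mul_one, Complex.norm_real, Complex.norm_real,
          Real.norm_eq_abs, Real.norm_eq_abs]
    _ ≤ |ε - 1| + A := by gcongr

theorem integral_exp_mul_cos_sub_const {Ω : Type*} [MeasurableSpace Ω] {μ : Measure Ω}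
    [IsFiniteMeasure μ] {a : Ω → ℝ} (ha : Measurable a) (ε t : ℝ) :
    ∫ ω, (Real.exp (-ε * t) * Real.cos (a ω * t) - Real.exp (-t)) / t ∂μ =
      (Real.exp (-ε * t) * (∫ ω, Real.cos (a ω * t) ∂μ) - μ.real univ * Real.exp (-t)) / t := by
  have hcos : Integrable (fun ω => Real.cos (a ω * t)) μ :=
    (integrable_const (1 : ℝ)).mono' (Measurable.aestronglyMeasurable (by fun_prop))
      (ae_of_all _ fun ω => Real.abs_cos_le_one _)
  rw [integral_div, integral_sub (hcos.const_mul _) (integrable_const _), integral_const_mul,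
    integral_const, smul_eq_mul]

theorem tendsto_integral_log_sq_add_sq {Ω : Type*} [MeasurableSpace Ω] {μ : Measure Ω}
    [IsFiniteMeasure μ] {a : Ω → ℝ} (ha : Measurable a) {A : ℝ} (haA : ∀ᵐ ω ∂μ, 0 < a ω ∧ a ω ≤ A)
    (hlog : Integrable (fun ω => Real.log (a ω)) μ) :
    Tendsto (fun n : ℕ => ∫ ω, Real.log ((1 / ((n : ℝ) + 1)) ^ 2 + a ω ^ 2) / 2 ∂μ) atTop
      (𝓝 (∫ ω, Real.log (a ω) ∂μ)) := by
  refine tendsto_integral_of_dominated_convergence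
    (fun ω => |Real.log (a ω)| + Real.log (1 + A ^ 2)) (fun n => ?_)
    (hlog.abs.add (integrable_const _)) (fun n => ?_) ?_
  · exact Measurable.aestronglyMeasurable (by fun_prop)
  · filter_upwards [haA] with ω hω
    obtain ⟨h0, hA⟩ := hω
    have hn : (0 : ℝ) < 1 / ((n : ℝ) + 1) := by positivity
    have hn1 : (1 / ((n : ℝ) + 1)) ≤ 1 := by
      rw [div_le_one (by positivity)]; linarith [n.cast_nonneg (α := ℝ)]
    have hup : Real.log ((1 / ((n : ℝ) + 1)) ^ 2 + a ω ^ 2) ≤ Real.log (1 + A ^ 2) :=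
      Real.log_le_log (by positivity) (add_le_add (pow_le_one₀ hn.le hn1) (by gcongr))
    have hlow : 2 * Real.log (a ω) ≤ Real.log ((1 / ((n : ℝ) + 1)) ^ 2 + a ω ^ 2) := by
      have := Real.log_le_log (pow_pos h0 2) (le_add_of_nonneg_left (sq_nonneg (1 / ((n : ℝ) + 1))))
      rwa [Real.log_pow] at this
    have hA0 : 0 ≤ Real.log (1 + A ^ 2) := Real.log_nonneg (by nlinarith [sq_nonneg A])
    rw [Real.norm_eq_abs, abs_le]
    constructor <;> linarith [neg_abs_le (Real.log (a ω)), abs_nonneg (Real.log (a ω))]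
  · filter_upwards [haA] with ω hω
    have h0 := hω.1
    have h1 : Tendsto (fun n : ℕ => (1 / ((n : ℝ) + 1)) ^ 2 + a ω ^ 2) atTop (𝓝 (a ω ^ 2)) := by
      simpa using (tendsto_one_div_add_atTop_nhds_zero_nat (𝕜 := ℝ)).pow 2 |>.add_const (a ω ^ 2)
    have h2 := (h1.log (pow_pos h0 2).ne').div_const 2
    rwa [Real.log_pow, Nat.cast_ofNat, mul_div_cancel_left₀ _ two_ne_zero] at h2

/-- A Frullani-type formula for an average of cosines. -/
theorem integral_average_cos_sub_exp_div {Ω : Type*} [MeasurableSpace Ω] {μ : Measure Ω}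
    [IsFiniteMeasure μ] {a : Ω → ℝ} (ha : Measurable a) {A : ℝ} (haA : ∀ᵐ ω ∂μ, 0 < a ω ∧ a ω ≤ A)
    (hlog : Integrable (fun ω => Real.log (a ω)) μ)
    (hpos : ∀ t, 0 < t → 0 ≤ ∫ ω, Real.cos (a ω * t) ∂μ) :
    IntegrableOn (fun t => ((∫ ω, Real.cos (a ω * t) ∂μ) - μ.real univ * Real.exp (-t)) / t)
        (Ioi 0) ∧
      ∫ t in Ioi 0, ((∫ ω, Real.cos (a ω * t) ∂μ) - μ.real univ * Real.exp (-t)) / t =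
        -∫ ω, Real.log (a ω) ∂μ := by
  set G : ℝ → ℝ := fun t => ∫ ω, Real.cos (a ω * t) ∂μ with hG
  set F : ℕ → ℝ → ℝ := fun n t =>
    (Real.exp (-(1 / ((n : ℝ) + 1)) * t) * G t - μ.real univ * Real.exp (-t)) / t with hF
  have hab : ∀ᵐ ω ∂μ, |a ω| ≤ A := haA.mono fun ω h => by rw [abs_of_pos h.1]; exact h.2
  have hε : ∀ n : ℕ, (0 : ℝ) < 1 / ((n : ℝ) + 1) := fun n => by positivity
  have hFeq : ∀ n, F n = fun t => ∫ ω, (Real.exp (-(1 / ((n : ℝ) + 1)) * t) *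
      Real.cos (a ω * t) - Real.exp (-t)) / t ∂μ := fun n => by
    funext t; rw [integral_exp_mul_cos_sub_const ha]
  have hFint : ∀ n, IntegrableOn (F n) (Ioi 0) := fun n => by
    rw [hFeq]; exact (integrable_uncurry_exp_mul_cos ha hab (hε n)).integral_prod_left
  have hFval : ∀ n, ∫ t in Ioi 0, F n t =
      -∫ ω, Real.log ((1 / ((n : ℝ) + 1)) ^ 2 + a ω ^ 2) / 2 ∂μ := fun n => by
    rw [hFeq, integral_integral_swap (integrable_uncurry_exp_mul_cos ha hab (hε n)), ← integral_neg]
    exact integral_congr_ae (ae_of_all _ fun ω => integral_exp_mul_cos_sub_exp_div (hε n) (a ω))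
  have hlim : Tendsto (fun n => ∫ t in Ioi 0, F n t) atTop (𝓝 (-∫ ω, Real.log (a ω) ∂μ)) := by
    simp only [hFval]; exact (tendsto_integral_log_sq_add_sq ha haA hlog).neg
  have hmono : ∀ t ∈ Ioi (0 : ℝ), Monotone fun n => F n t := fun t ht m n hmn => by
    have ht' : (0 : ℝ) < t := ht
    have : 1 / ((n : ℝ) + 1) ≤ 1 / ((m : ℝ) + 1) := by gcongr
    have hg := hpos t ht
    simp only [hF]
    gcongr
  have hptw : ∀ t, Tendsto (fun n => F n t) atTop (𝓝 ((G t - μ.real univ * Real.exp (-t)) / t)) := by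
    intro t
    have h1 : Tendsto (fun n : ℕ => Real.exp (-(1 / ((n : ℝ) + 1)) * t)) atTop (𝓝 1) := by
      have := ((tendsto_one_div_add_atTop_nhds_zero_nat (𝕜 := ℝ)).neg.mul_const t).rexp
      simpa using this
    simpa [hF] using ((h1.mul_const (G t)).sub_const (μ.real univ * Real.exp (-t))).div_const t
  have hInt : IntegrableOn (fun t => (G t - μ.real univ * Real.exp (-t)) / t) (Ioi 0) := by
    have hd : Integrable (fun t => (G t - μ.real univ * Real.exp (-t)) / t - F 0 t)
        (volume.restrict (Ioi 0)) := by
      refine integrable_of_tendsto (G := fun n t => F n t - F 0 t)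
        (ae_of_all _ fun t => (hptw t).sub_const _)
        (fun n => ((hFint n).sub (hFint 0)).aestronglyMeasurable) ?_
      have he : ∀ n, ∫⁻ t in Ioi 0, ‖F n t - F 0 t‖ₑ =
          ENNReal.ofReal ((∫ t in Ioi 0, F n t) - ∫ t in Ioi 0, F 0 t) := fun n => by
        rw [← integral_sub (hFint n) (hFint 0)]
        refine (ofReal_integral_norm_eq_lintegral_enorm ((hFint n).sub (hFint 0))).symm.trans ?_
        congr 1
        refine setIntegral_congr_fun measurableSet_Ioi fun t ht => ?_
        exact abs_of_nonneg (sub_nonneg.2 (hmono t ht (Nat.zero_le n)))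
      simp only [he]
      have hl := (ENNReal.continuous_ofReal.tendsto _).comp (hlim.sub_const (∫ t in Ioi 0, F 0 t))
      rw [Function.comp_def] at hl
      rw [hl.liminf_eq]
      exact ENNReal.ofReal_ne_top
    exact (hd.add (hFint 0)).congr (ae_of_all _ fun t => sub_add_cancel _ _)
  refine ⟨hInt, tendsto_nhds_unique (integral_tendsto_of_tendsto_of_monotone hFint hInt ?_ ?_) hlim⟩
  · filter_upwards [ae_restrict_mem measurableSet_Ioi] with t ht using hmono t ht
  · exact ae_of_all _ hptw

theorem hasSum_besselCore_zero_sq (w : ℝ) :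
    HasSum (fun n : ℕ => (-w) ^ n * (n.centralBinom : ℝ) / (n.factorial : ℝ) ^ 2)
      (besselCore 0 w ^ 2) := by
  set u : ℕ → ℝ := fun k => (-1 : ℝ) ^ k * w ^ k * ((0 + k).factorial : ℝ)⁻¹ / k.factorial with hu
  have hs : Summable fun k => ‖u k‖ :=
    (summable_shiftSeries (c := fun m => (m.factorial : ℝ)⁻¹) (n := 0) (C := 1)
      (fun k => abs_inv_factorial_le _) w).norm
  have hterm : ∀ n : ℕ, ∑ i ∈ Finset.range (n + 1), u i * u (n - i) =
      (-w) ^ n * (n.centralBinom : ℝ) / (n.factorial : ℝ) ^ 2 := by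
    intro n
    have hc : (n.centralBinom : ℝ) = ∑ i ∈ Finset.range (n + 1), ((n.choose i : ℕ) : ℝ) ^ 2 := by
      rw [Nat.centralBinom, ← Nat.sum_range_choose_sq]; push_cast; rfl
    rw [hc, Finset.mul_sum, Finset.sum_div]
    refine Finset.sum_congr rfl fun i hi => ?_
    have hin : i ≤ n := Nat.lt_succ_iff.1 (Finset.mem_range.1 hi)
    rw [Nat.cast_choose ℝ hin]
    have h1 : (-w) ^ n = (-w) ^ i * (-w) ^ (n - i) := by rw [← pow_add, Nat.add_sub_cancel' hin]
    have f1 : (i.factorial : ℝ) ≠ 0 := by positivity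
    have f2 : ((n - i).factorial : ℝ) ≠ 0 := by positivity
    have f3 : (n.factorial : ℝ) ≠ 0 := by positivity
    simp only [hu, zero_add]
    rw [h1, neg_pow w i, neg_pow w (n - i)]
    field_simp
  have h := tsum_mul_tsum_eq_tsum_sum_range_of_summable_norm hs hs
  have h2 := (summable_norm_sum_mul_range_of_summable_norm hs hs).of_norm.hasSum
  rw [← h, ← sq] at h2
  simp only [hterm] at h2
  exact h2

theorem integral_sin_pow_two_mul (n : ℕ) :
    ∫ θ in Ioo 0 π, Real.sin θ ^ (2 * n) = π * ((n.centralBinom : ℝ) / 4 ^ n) := by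
  rw [← integral_Ioc_eq_integral_Ioo, ← intervalIntegral.integral_of_le pi_pos.le,
    integral_sin_pow_even]
  congr 1
  induction n with
  | zero => simp
  | succ k ih =>
    have h : ((k : ℝ) + 1) * (k + 1).centralBinom = 2 * (2 * k + 1) * k.centralBinom := by
      exact_mod_cast Nat.succ_mul_centralBinom_succ k
    have h' : ((k + 1).centralBinom : ℝ) = 2 * (2 * k + 1) * k.centralBinom / (k + 1) := by
      rw [← h]; field_simp
    rw [Finset.prod_range_succ, ih, h', pow_succ]
    field_simp
    ring

/-- The square of `J₀` as a double average of cosines. -/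
theorem integral_cos_two_mul_sin_mul_sin (t : ℝ) :
    ∫ p, Real.cos (2 * Real.sin p.1 * Real.sin p.2 * t)
        ∂((volume.restrict (Ioo 0 π)).prod (volume.restrict (Ioo 0 π))) =
      π ^ 2 * besselCore 0 (t ^ 2 / 4) ^ 2 := by
  set M := (volume.restrict (Ioo 0 π)).prod (volume.restrict (Ioo 0 π))
  set F : ℕ → ℝ × ℝ → ℝ := fun n p =>
    (-1) ^ n * (2 * Real.sin p.1 * Real.sin p.2 * t) ^ (2 * n) / (2 * n).factorial with hF
  have hbound : ∀ n p, ‖F n p‖ ≤ (2 * t) ^ (2 * n) / (2 * n).factorial := by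
    intro n p
    rw [hF, norm_div, norm_mul, norm_pow, norm_neg, norm_one, one_pow, one_mul, norm_pow,
      Real.norm_natCast, ← (even_two_mul n).pow_abs (2 * t)]
    gcongr
    rw [Real.norm_eq_abs, abs_mul, abs_mul, abs_mul, abs_mul 2 t]
    have h1 := Real.abs_sin_le_one p.1
    have h2 := Real.abs_sin_le_one p.2
    have h3 : |Real.sin p.1| * |Real.sin p.2| ≤ 1 := mul_le_one₀ h1 (abs_nonneg _) h2
    calc |(2 : ℝ)| * |Real.sin p.1| * |Real.sin p.2| * |t|
        = |(2 : ℝ)| * (|Real.sin p.1| * |Real.sin p.2|) * |t| := by ring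
      _ ≤ |(2 : ℝ)| * 1 * |t| := by gcongr
      _ = |(2 : ℝ)| * |t| := by ring
  have hInt : ∀ n, Integrable (F n) M := fun n =>
    (integrable_const ((2 * t) ^ (2 * n) / (2 * n).factorial)).mono'
      (Continuous.aestronglyMeasurable (by fun_prop)) (ae_of_all _ (hbound n))
  have hsum : Summable fun n => ∫ p, ‖F n p‖ ∂M := by
    refine Summable.of_nonneg_of_le (fun n => integral_nonneg fun p => norm_nonneg _) (fun n => ?_)
      ((Real.hasSum_cosh (2 * t)).summable.mul_right (M.real univ))
    refine (Real.le_norm_self _).trans (norm_integral_le_of_norm_le_const (ae_of_all _ fun p => ?_))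
    rw [norm_norm]
    exact hbound n p
  have hval : ∀ n, ∫ p, F n p ∂M =
      π ^ 2 * ((-(t ^ 2 / 4)) ^ n * (n.centralBinom : ℝ) / (n.factorial : ℝ) ^ 2) := by
    intro n
    have h1 : F n = fun p => (-1) ^ n * (4 * t ^ 2) ^ n / (2 * n).factorial *
        (Real.sin p.1 ^ (2 * n) * Real.sin p.2 ^ (2 * n)) := by
      funext p
      have : (2 * Real.sin p.1 * Real.sin p.2 * t) ^ (2 * n) =
          (4 * t ^ 2) ^ n * (Real.sin p.1 ^ (2 * n) * Real.sin p.2 ^ (2 * n)) := by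
        simp only [pow_mul, mul_pow]; ring
      simp only [hF, this]; ring
    rw [h1, integral_const_mul, integral_prod_mul (fun x => Real.sin x ^ (2 * n))
      (fun x => Real.sin x ^ (2 * n)), integral_sin_pow_two_mul, neg_pow (t ^ 2 / 4)]
    have h2 : ((2 * n).factorial : ℝ) = n.centralBinom * (n.factorial : ℝ) ^ 2 := by
      rw [Nat.centralBinom_eq_two_mul_choose, Nat.cast_choose ℝ (by omega : n ≤ 2 * n)]
      rw [show 2 * n - n = n by omega]
      field_simp
    have h3 : (n.centralBinom : ℝ) ≠ 0 := by exact_mod_cast n.centralBinom_ne_zero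
    rw [h2, mul_pow, div_pow]
    field_simp
  have h := hasSum_integral_of_summable_integral_norm hInt hsum
  simp only [hval] at h
  have h2 := (hasSum_besselCore_zero_sq (t ^ 2 / 4)).mul_left (π ^ 2)
  rw [h2.unique h]
  refine integral_congr_ae (ae_of_all _ fun p => ?_)
  exact (Real.hasSum_cos _).tsum_eq.symm

theorem integrable_log_sin :
    Integrable (fun θ => Real.log (Real.sin θ)) (volume.restrict (Ioo 0 π)) := by
  have h : IntervalIntegrable (fun θ => Real.log (Real.sin θ)) volume 0 π :=
    intervalIntegrable_log_sin
  rw [intervalIntegrable_iff_integrableOn_Ioo_of_le pi_pos.le] at h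
  exact h

theorem log_two_mul_sin_mul_sin :
    (fun p : ℝ × ℝ => Real.log (2 * Real.sin p.1 * Real.sin p.2)) =ᵐ[(volume.restrict
        (Ioo 0 π)).prod (volume.restrict (Ioo 0 π))]
      fun p => Real.log 2 + Real.log (Real.sin p.1) + Real.log (Real.sin p.2) := by
  rw [Measure.prod_restrict]
  filter_upwards [ae_restrict_mem (measurableSet_Ioo.prod measurableSet_Ioo)] with p hp
  have h1 := Real.sin_pos_of_pos_of_lt_pi hp.1.1 hp.1.2
  have h2 := Real.sin_pos_of_pos_of_lt_pi hp.2.1 hp.2.2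
  rw [Real.log_mul (by positivity) h2.ne', Real.log_mul two_ne_zero h1.ne']

theorem integrable_log_two_mul_sin_mul_sin :
    Integrable (fun p : ℝ × ℝ => Real.log (2 * Real.sin p.1 * Real.sin p.2))
      ((volume.restrict (Ioo 0 π)).prod (volume.restrict (Ioo 0 π))) :=
  (((integrable_const _).add (integrable_log_sin.comp_fst _)).add
    (integrable_log_sin.comp_snd _)).congr log_two_mul_sin_mul_sin.symm

theorem integral_log_two_mul_sin_mul_sin :
    ∫ p, Real.log (2 * Real.sin p.1 * Real.sin p.2)
        ∂((volume.restrict (Ioo 0 π)).prod (volume.restrict (Ioo 0 π))) =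
      -(π ^ 2 * Real.log 2) := by
  have hm : (volume.restrict (Ioo 0 π)).real univ = π := by
    simp [Measure.real, pi_pos.le]
  have hl : ∫ θ in Ioo 0 π, Real.log (Real.sin θ) = -Real.log 2 * π := by
    rw [← integral_Ioc_eq_integral_Ioo, ← intervalIntegral.integral_of_le pi_pos.le,
      integral_log_sin_zero_pi]
  set m := volume.restrict (Ioo 0 π)
  have h1 : Integrable (fun p : ℝ × ℝ => Real.log (Real.sin p.1)) (m.prod m) :=
    integrable_log_sin.comp_fst _
  have h2 : Integrable (fun p : ℝ × ℝ => Real.log (Real.sin p.2)) (m.prod m) :=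
    integrable_log_sin.comp_snd _
  have h12 : Integrable (fun p : ℝ × ℝ => Real.log 2 + Real.log (Real.sin p.1)) (m.prod m) :=
    (integrable_const _).add h1
  rw [integral_congr_ae log_two_mul_sin_mul_sin, integral_add h12 h2,
    integral_add (integrable_const _) h1, integral_fun_fst (fun θ => Real.log (Real.sin θ)),
    integral_fun_snd (fun θ => Real.log (Real.sin θ)), hm, hl,
    integral_const, ← univ_prod_univ, measureReal_prod_prod, hm]
  simp only [smul_eq_mul]
  ring

/-- The Frullani-type integral of `J₀²` over the half-line. -/
theorem integral_besselJ_zero_sq_sub_exp_div :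
    IntegrableOn (fun t => (besselJ 0 t ^ 2 - Real.exp (-t)) / t) (Ioi 0) ∧
      ∫ t in Ioi 0, (besselJ 0 t ^ 2 - Real.exp (-t)) / t = Real.log 2 := by
  have hm : ((volume.restrict (Ioo 0 π)).prod (volume.restrict (Ioo 0 π))).real univ = π ^ 2 := by
    rw [← univ_prod_univ, measureReal_prod_prod, sq]
    simp [Measure.real, pi_pos.le]
  have hJ : ∀ t, besselJ 0 t = besselCore 0 (t ^ 2 / 4) := fun t => by
    simpa using besselJ_natCast 0 t
  have haA : ∀ᵐ p ∂((volume.restrict (Ioo 0 π)).prod (volume.restrict (Ioo 0 π))),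
      0 < 2 * Real.sin p.1 * Real.sin p.2 ∧ 2 * Real.sin p.1 * Real.sin p.2 ≤ 2 := by
    rw [Measure.prod_restrict]
    filter_upwards [ae_restrict_mem (measurableSet_Ioo.prod measurableSet_Ioo)] with p hp
    have h1 := Real.sin_pos_of_pos_of_lt_pi hp.1.1 hp.1.2
    have h2 := Real.sin_pos_of_pos_of_lt_pi hp.2.1 hp.2.2
    refine ⟨by positivity, ?_⟩
    nlinarith [Real.sin_le_one p.1, Real.sin_le_one p.2]
  have h := integral_average_cos_sub_exp_div (a := fun p : ℝ × ℝ => 2 * Real.sin p.1 * Real.sin p.2)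
    (by fun_prop) haA integrable_log_two_mul_sin_mul_sin
    fun t _ => by rw [integral_cos_two_mul_sin_mul_sin]; positivity
  simp only [integral_cos_two_mul_sin_mul_sin, integral_log_two_mul_sin_mul_sin, hm, ← hJ,
    ← mul_sub, mul_div_assoc, neg_neg] at h
  have hpi : π ^ 2 ≠ 0 := by positivity
  refine ⟨?_, ?_⟩
  · exact (h.1.const_mul (π ^ 2)⁻¹).congr (ae_of_all _ fun t => inv_mul_cancel_left₀ hpi _)
  · have h2 := h.2
    rw [integral_const_mul] at h2
    exact mul_left_cancel₀ hpi h2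

theorem tendsto_setIntegral_Ioi_nhdsGT {f : ℝ → ℝ} (hf : IntegrableOn f (Ioi 0)) :
    Tendsto (fun x => ∫ t in Ioi x, f t) (𝓝[>] 0) (𝓝 (∫ t in Ioi 0, f t)) := by
  have hx : Tendsto (fun x : ℝ => x) (𝓝[>] 0) (𝓝 0) :=
    tendsto_nhdsWithin_of_tendsto_nhds tendsto_id
  refine ((aecover_Ioi_of_Ioi hx).integral_tendsto_of_countably_generated hf).congr' ?_
  filter_upwards [self_mem_nhdsWithin] with x hx
  rw [Measure.restrict_restrict measurableSet_Ioi,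
    inter_eq_self_of_subset_left (Ioi_subset_Ioi (le_of_lt hx))]

theorem integral_exp_neg_mul_log :
    ∫ t in Ioi (0 : ℝ), Real.exp (-t) * Real.log t = -eulerMascheroniConstant := by
  have h1 := Complex.hasDerivAt_GammaIntegral (s := 1) (by simp)
  have h2 : Complex.Gamma =ᶠ[𝓝 1] Complex.GammaIntegral := by
    filter_upwards [(isOpen_lt continuous_const Complex.continuous_re).mem_nhds
      (by simp : (1 : ℂ) ∈ {s : ℂ | 0 < s.re})] with s hs using Complex.Gamma_eq_integral hs
  have h3 := (h1.congr_of_eventuallyEq h2).unique Complex.hasDerivAt_Gamma_one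
  have h4 : ∫ t in Ioi (0 : ℝ), (t : ℂ) ^ ((1 : ℂ) - 1) * (Real.log t * Real.exp (-t)) =
      ((∫ t in Ioi (0 : ℝ), Real.exp (-t) * Real.log t : ℝ) : ℂ) := by
    rw [← integral_complex_ofReal]
    refine integral_congr_ae (ae_of_all _ fun t => ?_)
    simp only [sub_self, Complex.cpow_zero, one_mul, Complex.ofReal_mul, mul_comm]
  rw [h4] at h3
  exact_mod_cast h3

theorem integrableOn_exp_neg_mul_log :
    IntegrableOn (fun t => Real.exp (-t) * Real.log t) (Ioi 0) := by
  refine Integrable.of_integral_ne_zero ?_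
  rw [integral_exp_neg_mul_log]
  linarith [Real.one_half_lt_eulerMascheroniConstant]

theorem integrableOn_exp_neg_div {x : ℝ} (hx : 0 < x) :
    IntegrableOn (fun t => Real.exp (-t) / t) (Ioi x) := by
  refine ((integrableOn_exp_neg_Ioi x).div_const x).mono'
    (Measurable.aestronglyMeasurable (by fun_prop)) ?_
  filter_upwards [ae_restrict_mem measurableSet_Ioi] with t ht
  have ht0 : 0 < t := hx.trans ht
  rw [Real.norm_of_nonneg (by positivity)]
  gcongr
  exact le_of_lt ht

theorem tendsto_exp_neg_mul_log_atTop :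
    Tendsto (fun t => Real.exp (-t) * Real.log t) atTop (𝓝 0) := by
  have h := Real.tendsto_pow_mul_exp_neg_atTop_nhds_zero 1
  refine squeeze_zero' ?_ ?_ h
  · filter_upwards [eventually_ge_atTop 1] with t ht
    have := Real.log_nonneg ht
    positivity
  · filter_upwards [eventually_ge_atTop 1] with t ht
    rw [pow_one, mul_comm]
    gcongr
    exact Real.log_le_self (by linarith)

theorem integral_exp_neg_div {x : ℝ} (hx : 0 < x) :
    ∫ t in Ioi x, Real.exp (-t) / t =
      (∫ t in Ioi x, Real.exp (-t) * Real.log t) - Real.exp (-x) * Real.log x := by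
  have hlog := integrableOn_exp_neg_mul_log.mono_set (Ioi_subset_Ioi hx.le)
  have hd : ∀ t ∈ Ici x, HasDerivAt (fun t => Real.exp (-t) * Real.log t)
      (Real.exp (-t) / t - Real.exp (-t) * Real.log t) t := by
    intro t ht
    have ht0 : 0 < t := hx.trans_le ht
    convert! ((hasDerivAt_id t).neg.exp).mul (Real.hasDerivAt_log ht0.ne') using 1
    simp only [id_eq, Pi.neg_apply]
    ring
  have h := integral_Ioi_of_hasDerivAt_of_tendsto' hd
    ((integrableOn_exp_neg_div hx).sub hlog) tendsto_exp_neg_mul_log_atTop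
  rw [integral_sub (integrableOn_exp_neg_div hx) hlog] at h
  linarith

theorem tendsto_one_sub_exp_neg_mul_log :
    Tendsto (fun x => (1 - Real.exp (-x)) * Real.log x) (𝓝[>] 0) (𝓝 0) := by
  have h : Tendsto (fun x : ℝ => |x * Real.log x|) (𝓝[>] 0) (𝓝 0) :=
    tendsto_nhdsWithin_of_tendsto_nhds (Real.continuous_mul_log.abs.tendsto' 0 0 (by simp))
  refine squeeze_zero_norm' ?_ h
  filter_upwards [self_mem_nhdsWithin] with x hx
  have hx0 : (0 : ℝ) < x := hx
  have h0 : 0 ≤ 1 - Real.exp (-x) := sub_nonneg.2 (Real.exp_le_one_iff.2 (by linarith))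
  rw [Real.norm_eq_abs, abs_mul, abs_mul, abs_of_nonneg h0, abs_of_pos hx0]
  exact mul_le_mul_of_nonneg_right (by linarith [Real.add_one_le_exp (-x)]) (abs_nonneg _)

theorem integrableOn_besselJ_zero_sq_div {x : ℝ} (hx : 0 < x) :
    IntegrableOn (fun t => besselJ 0 t ^ 2 / t) (Ioi x) :=
  ((integral_besselJ_zero_sq_sub_exp_div.1.mono_set (Ioi_subset_Ioi hx.le)).add
    (integrableOn_exp_neg_div hx)).congr (ae_of_all _ fun t => by
      simp only [Pi.add_apply]; rw [← add_div, sub_add_cancel])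

theorem tendsto_integral_besselJ_zero_sq_div :
    Tendsto (fun x => (∫ t in Ioi x, besselJ 0 t ^ 2 / t)
      + (Real.log (x / 2) + eulerMascheroniConstant)) (𝓝[>] 0) (𝓝 0) := by
  obtain ⟨hInt, hval⟩ := integral_besselJ_zero_sq_sub_exp_div
  have h1 := tendsto_setIntegral_Ioi_nhdsGT hInt
  have h2 := tendsto_setIntegral_Ioi_nhdsGT integrableOn_exp_neg_mul_log
  rw [hval] at h1
  rw [integral_exp_neg_mul_log] at h2
  have h3 := ((h1.add h2).add tendsto_one_sub_exp_neg_mul_log).add_const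
    (eulerMascheroniConstant - Real.log 2)
  rw [show Real.log 2 + -eulerMascheroniConstant + 0 + (eulerMascheroniConstant - Real.log 2) = 0
    by ring] at h3
  refine h3.congr' ?_
  filter_upwards [self_mem_nhdsWithin] with x hx
  have hx0 : (0 : ℝ) < x := hx
  have h4 : ∫ t in Ioi x, besselJ 0 t ^ 2 / t =
      (∫ t in Ioi x, (besselJ 0 t ^ 2 - Real.exp (-t)) / t) + ∫ t in Ioi x, Real.exp (-t) / t := by
    rw [← integral_add (hInt.mono_set (Ioi_subset_Ioi hx0.le)) (integrableOn_exp_neg_div hx0)]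
    exact integral_congr_ae (ae_of_all _ fun t => by simp only; rw [← add_div, sub_add_cancel])
  rw [h4, integral_exp_neg_div hx0, Real.log_div hx0.ne' two_ne_zero]
  ring

theorem stmt7 (x : ℝ) (hx : 0 < x) :
    HasSum (fun n : ℕ =>
        (if n = 0 then (1:ℝ) else 2) * besselJ n x * deriv (fun μ => besselJ μ x) n)
      (-∫ t in Set.Ioi x, besselJ 0 t ^ 2 / t) := by
  refine (hasSum_neumannTerm (fun _ => integrableOn_besselJ_zero_sq_div)
    tendsto_integral_besselJ_zero_sq_div hx).congr_fun fun n => ?_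
  rw [(hasDerivAt_besselJ_order hx n).deriv]
  rfl
end
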